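/- For every context P and every threshold k ∈ ℤ+, there exists a context P' with |P'| ≤ |P| and with at most 1152k³ red characters such that P and P' are ted^w_{≤k}-equivalent for every normalized quasimetric weight function w. -/

import Mathlib

open scoped NNReal ENNReal

attribute [local instance] Classical.propDecidable

/-- A labeled parenthesis over the alphabet `α`: `(true, a)` is the opening
parenthesis with label `a`, and `(false, a)` is the closing parenthesis. -/
abbrev Paren (α : Type*) := Bool × α

/-- Balanced strings of labeled parentheses (forests), following Definition 2.1:
the smallest set containing the empty string, closed under concatenation, and
containing `(_a · F · )_a` for every forest `F` and label `a`. -/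
inductive IsForest {α : Type*} : List (Paren α) → Prop
  | nil : IsForest []
  | append {F G : List (Paren α)} : IsForest F → IsForest G → IsForest (F ++ G)
  | wrap {F : List (Paren α)} (a : α) : IsForest F → IsForest ((true, a) :: F ++ [(false, a)])

/-- The fragment `l[i..j)` of a list. -/
def frag {β : Type*} (l : List β) (i j : ℕ) : List β := (l.take j).drop i

/-- `IsNode F i j` means that `[i..j]` is a node of the forest `F`: `F[i]` is an
opening parenthesis, `F[j]` is a closing parenthesis with the same label,
and `F(i..j)` is balanced. -/
def IsNode {α : Type*} (F : List (Paren α)) (i j : ℕ) : Prop :=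
  i < j ∧ j < F.length ∧ (∃ a : α, F[i]? = some (true, a) ∧ F[j]? = some (false, a)) ∧
    IsForest (frag F (i + 1) j)

/-- `MateRel F i j` holds when positions `i` and `j` are the paired parentheses
of a node of `F` (in either order); `j` is the mate of `i`. -/
def MateRel {α : Type*} (F : List (Paren α)) (i j : ℕ) : Prop :=
  IsNode F i j ∨ IsNode F j i

/-- A single edge of the alignment graph: horizontal, vertical, or diagonal. -/
def AlignStep (p q : ℕ × ℕ) : Prop :=
  q = (p.1 + 1, p.2) ∨ q = (p.1, p.2 + 1) ∨ q = (p.1 + 1, p.2 + 1)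

/-- An alignment of `X[x..x')` onto `Y[y..y')` is a path in the alignment graph
from `(x, y)` to `(x', y')`, interpreted as its sequence of vertices. -/
def IsAlignment (x x' y y' : ℕ) (path : List (ℕ × ℕ)) : Prop :=
  path.head? = some (x, y) ∧ path.getLast? = some (x', y') ∧ path.Chain' AlignStep

/-- The alignment (path) aligns character `f` of `X` to character `g` of `Y`
(a diagonal edge `(f, g) → (f + 1, g + 1)`). -/
def AlignsAt (path : List (ℕ × ℕ)) (f g : ℕ) : Prop :=
  ∃ t, path[t]? = some (f, g) ∧ path[t + 1]? = some (f + 1, g + 1)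

/-- The alignment deletes character `f` of `X` (a horizontal edge). -/
def DeletesAt (path : List (ℕ × ℕ)) (f : ℕ) : Prop :=
  ∃ t g, path[t]? = some (f, g) ∧ path[t + 1]? = some (f + 1, g)

/-- The alignment inserts character `g` of `Y` (a vertical edge). -/
def InsertsAt (path : List (ℕ × ℕ)) (g : ℕ) : Prop :=
  ∃ t f, path[t]? = some (f, g) ∧ path[t + 1]? = some (f, g + 1)

/-- Consistency condition of forest alignments (Definition 2.6): whenever the
alignment aligns `F[f]` to `G[g]`, it also aligns the mate of `F[f]` to the mate
of `G[g]`.  An alignment satisfying this condition is a forest alignment. -/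
def Consistent {α : Type*} (F G : List (Paren α)) (path : List (ℕ × ℕ)) : Prop :=
  ∀ f g f' g', AlignsAt path f g → MateRel F f f' → MateRel G g g' → AlignsAt path f' g'

/-- The width of the alignment is at most `m`: every vertex `(x, y)` on the path
satisfies `|x - y| ≤ m`. -/
def WidthLE (m : ℕ) (path : List (ℕ × ℕ)) : Prop :=
  ∀ p ∈ path, p.1 ≤ p.2 + m ∧ p.2 ≤ p.1 + m

/-- The label of the `i`-th character of `X` (as an element of `Σ ∪ {ε}`,
encoded by `Option α`; out-of-range positions give `ε`). -/
def lbl {α : Type*} (X : List (Paren α)) (i : ℕ) : Option α := (X[i]?).map Prod.snd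

/-- Cost of an alignment path with respect to the weight function `w̃(p, q) = ½·w(λ(p), λ(q))`:
horizontal edges cost `½·w(λ(X[x]), ε)`, vertical edges `½·w(ε, λ(Y[y]))`, and
diagonal edges `½·w(λ(X[x]), λ(Y[y]))`. -/
noncomputable def pathCost {α : Type*} (w : Option α → Option α → ℝ≥0)
    (X Y : List (Paren α)) : List (ℕ × ℕ) → ℝ≥0
  | [] => 0
  | [_] => 0
  | p :: q :: rest =>
      (if q.1 = p.1 + 1 ∧ q.2 = p.2 then (1 / 2 : ℝ≥0) * w (lbl X p.1) none
       else if q.1 = p.1 ∧ q.2 = p.2 + 1 then (1 / 2 : ℝ≥0) * w none (lbl Y p.2)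
       else (1 / 2 : ℝ≥0) * w (lbl X p.1) (lbl Y p.2)) + pathCost w X Y (q :: rest)

/-- A weight function `w : (Σ ∪ {ε})² → ℝ≥0` is normalized if `w(a, a) = 0` and
`w(a, b) ≥ 1` for distinct `a, b`. -/
def Normalized {α : Type*} (w : Option α → Option α → ℝ≥0) : Prop :=
  (∀ a, w a a = 0) ∧ ∀ a b, a ≠ b → 1 ≤ w a b

/-- A weight function satisfies the triangle inequality (is a quasimetric). -/
def Quasimetric {α : Type*} (w : Option α → Option α → ℝ≥0) : Prop :=
  ∀ a b c, w a c ≤ w a b + w b c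

/-- The weighted tree edit distance `ted^w(F[f..f'), G[g..g'))`: the minimum cost
of a forest alignment of the fragment `F[f..f')` onto the fragment `G[g..g')`
(`∞` if no forest alignment exists). -/
noncomputable def tedFrag {α : Type*} (w : Option α → Option α → ℝ≥0)
    (F G : List (Paren α)) (f f' g g' : ℕ) : ℝ≥0∞ :=
  ⨅ p : { p : List (ℕ × ℕ) // IsAlignment f f' g g' p ∧ Consistent F G p },
    (pathCost w F G p.1 : ℝ≥0∞)

/-- The bounded tree edit distance `bted_k^w(F[f..f'), G[g..g'))`: the minimum
cost of a forest alignment of width at most `2k` (`∞` if none exists). -/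
noncomputable def btedFrag {α : Type*} (k : ℕ) (w : Option α → Option α → ℝ≥0)
    (F G : List (Paren α)) (f f' g g' : ℕ) : ℝ≥0∞ :=
  ⨅ p : { p : List (ℕ × ℕ) //
      IsAlignment f f' g g' p ∧ Consistent F G p ∧ WidthLE (2 * k) p },
    (pathCost w F G p.1 : ℝ≥0∞)

/-- A string `S` over `P_Σ` is a periodic block (Definition 5.4): `|S| ≥ 42k` and
`S` has a string period of length at most `4k` containing equally many opening
and closing parentheses. -/
def IsPeriodicBlock {α : Type*} (k : ℕ) (S : List (Paren α)) : Prop :=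
  42 * k ≤ S.length ∧ ∃ p, 0 < p ∧ p ≤ 4 * k ∧
    (∀ i, i + p < S.length → S[i]? = S[i + p]?) ∧
    (S.take p).countP (fun c => c.1) = (S.take p).countP (fun c => !c.1)

/-- A character `T[i]` is black (Definition 5.5) if there exists a periodic block
`T[l..r)` of `T` such that `i ∈ [l + 5k..r − 5k)`; otherwise it is red. -/
def IsBlack {α : Type*} (k : ℕ) (T : List (Paren α)) (i : ℕ) : Prop :=
  ∃ l r, r ≤ T.length ∧ l + 5 * k ≤ i ∧ i + 5 * k < r ∧ IsPeriodicBlock k (frag T l r)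

/-- The number of red characters of `T`. -/
noncomputable def redCount {α : Type*} (k : ℕ) (T : List (Paren α)) : ℕ :=
  ((Finset.range T.length).filter fun i => ¬ IsBlack k T i).card

/-- The capped tree edit distance `ted^w_{≤k}(F, G)`: equal to `ted^w(F, G)` if the
latter is at most `k`, and `∞` otherwise. -/
noncomputable def tedLE {α : Type*} (k : ℕ) (w : Option α → Option α → ℝ≥0)
    (F G : List (Paren α)) : ℝ≥0∞ :=
  if tedFrag w F G 0 F.length 0 G.length ≤ (k : ℝ≥0∞) then
    tedFrag w F G 0 F.length 0 G.length
  else ⊤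

/-- A tree: a balanced string of the form `(_a · F · )_a`. -/
def IsTree {α : Type*} (T : List (Paren α)) : Prop :=
  ∃ (a : α) (F : List (Paren α)), IsForest F ∧ T = (true, a) :: F ++ [(false, a)]

/-- A context `⟨L; R⟩`: a pair of non-empty strings such that `L · R` is a tree. -/
def IsContext {α : Type*} (L R : List (Paren α)) : Prop :=
  L ≠ [] ∧ R ≠ [] ∧ IsTree (L ++ R)

/-- Contexts `P = ⟨PL; PR⟩` and `P' = ⟨PL'; PR'⟩` are `ted^w_{≤k}`-equivalent
(Definition 5.9): for all forests `F = F₀ · PL · Fm · PR · F₁` and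
`G = G₀ · PL · Gm · PR · G₁` with matching occurrences of the context
(`Fm`, `Gm` balanced) whose left endpoints satisfy `|l_F − l_G| ≤ 2k` and whose
right endpoints satisfy `|r_F − r_G| ≤ 2k`, replacing both occurrences of the
context by `P'` preserves `ted^w_{≤k}`. -/
def ContextEquiv {α : Type*} (k : ℕ) (w : Option α → Option α → ℝ≥0)
    (PL PR PL' PR' : List (Paren α)) : Prop :=
  ∀ F0 Fm F1 G0 Gm G1 : List (Paren α),
    IsForest (F0 ++ PL ++ Fm ++ PR ++ F1) → IsForest (G0 ++ PL ++ Gm ++ PR ++ G1) →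
    IsForest Fm → IsForest Gm →
    F0.length ≤ G0.length + 2 * k → G0.length ≤ F0.length + 2 * k →
    F0.length + Fm.length ≤ G0.length + Gm.length + 2 * k →
    G0.length + Gm.length ≤ F0.length + Fm.length + 2 * k →
    tedLE k w (F0 ++ PL ++ Fm ++ PR ++ F1) (G0 ++ PL ++ Gm ++ PR ++ G1) =
      tedLE k w (F0 ++ PL' ++ Fm ++ PR' ++ F1) (G0 ++ PL' ++ Gm ++ PR' ++ G1)

/-! ### Heights, stack parsing and mates -/

/-- Sign of a parenthesis. -/
def sg {α : Type*} (c : Paren α) : ℤ := if c.1 = true then 1 else -1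

/-- Total height change of a string. -/
def ht {α : Type*} : List (Paren α) → ℤ
  | [] => 0
  | c :: l => sg c + ht l

/-- Height of a prefix. -/
def HH {α : Type*} (F : List (Paren α)) (n : ℕ) : ℤ := ht (F.take n)

theorem ht_append {α : Type*} (u v : List (Paren α)) : ht (u ++ v) = ht u + ht v := by
  induction u with
  | nil => simp [ht]
  | cons c u ih => simp [ht, ih, add_assoc]

@[simp] theorem ht_nil {α : Type*} : ht ([] : List (Paren α)) = 0 := rfl
@[simp] theorem ht_cons {α : Type*} (c : Paren α) (l) : ht (c :: l) = sg c + ht l := rfl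
@[simp] theorem sg_true {α : Type*} (a : α) : sg (true, a) = 1 := rfl
@[simp] theorem sg_false {α : Type*} (a : α) : sg (false, a) = -1 := rfl

theorem HH_zero {α : Type*} (F : List (Paren α)) : HH F 0 = 0 := by simp [HH]

theorem HH_len {α : Type*} (F : List (Paren α)) (n : ℕ) (h : F.length ≤ n) : HH F n = ht F := by
  simp [HH, List.take_of_length_le h]

theorem HH_app_left {α : Type*} (u v : List (Paren α)) (n : ℕ) (h : n ≤ u.length) :
    HH (u ++ v) n = HH u n := by
  simp [HH, List.take_append_of_le_length h]

theorem HH_app_right {α : Type*} (u v : List (Paren α)) (n : ℕ) :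
    HH (u ++ v) (u.length + n) = ht u + HH v n := by
  simp [HH, List.take_append, ht_append]
  rw [List.take_of_length_le (by omega)]

theorem HH_app_ge {α : Type*} (u v : List (Paren α)) (n : ℕ) (h : u.length ≤ n) :
    HH (u ++ v) n = ht u + HH v (n - u.length) := by
  obtain ⟨m, rfl⟩ := Nat.exists_eq_add_of_le h
  rw [HH_app_right]; simp

theorem HH_succ {α : Type*} (F : List (Paren α)) (n : ℕ) (c : Paren α) (h : F[n]? = some c) :
    HH F (n + 1) = HH F n + sg c := by
  simp [HH, List.take_add_one, h, ht_append]

theorem sg_cases {α : Type*} (c : Paren α) : sg c = 1 ∧ c.1 = true ∨ sg c = -1 ∧ c.1 = false := by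
  obtain ⟨b, a⟩ := c
  cases b <;> simp

theorem HH_step {α : Type*} (F : List (Paren α)) (n : ℕ) :
    HH F (n + 1) ≤ HH F n + 1 ∧ HH F n ≤ HH F (n + 1) + 1 := by
  rcases h : F[n]? with _ | c
  · have : F.length ≤ n := by simpa using h
    rw [HH_len F n this, HH_len F (n+1) (by omega)]; omega
  · rw [HH_succ F n c h]
    rcases sg_cases c with h | h <;> omega

theorem forest_ht {α : Type*} {F : List (Paren α)} (h : IsForest F) :
    ht F = 0 ∧ ∀ n, 0 ≤ HH F n := by
  induction h with
  | nil => simp [HH]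
  | @append F G _ _ ihF ihG =>
    refine ⟨by simp [ht_append, ihF.1, ihG.1], fun n => ?_⟩
    rcases le_total n F.length with h | h
    · rw [HH_app_left _ _ _ h]; exact ihF.2 n
    · rw [HH_app_ge _ _ _ h, ihF.1]; simpa using ihG.2 _
  | @wrap F a _ ih =>
    refine ⟨by simp [ht_append, ih.1], fun n => ?_⟩
    rcases n with _ | n
    · simp [HH_zero]
    · simp only [HH, List.cons_append, List.take_succ_cons, ht_cons, sg_true]
      rcases le_or_gt n F.length with h | h
      · have := ih.2 n
        rw [List.take_append_of_le_length h]; unfold HH at this; omega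
      · rw [List.take_of_length_le (by simp; omega)]
        simp [ht_append, ih.1]

/-- Stack parser. -/
noncomputable def srun {α : Type*} : List α → List (Paren α) → Option (List α)
  | st, [] => some st
  | st, (true, a) :: l => srun (a :: st) l
  | [], (false, _) :: _ => none
  | b :: st, (false, a) :: l => if a = b then srun st l else none

theorem srun_append {α : Type*} (u v : List (Paren α)) (st : List α) :
    srun st (u ++ v) = (srun st u).bind (fun s => srun s v) := by
  induction u generalizing st with
  | nil => simp [srun]
  | cons c u ih =>
    obtain ⟨b, a⟩ := c
    cases b
    · cases st with
      | nil => simp [srun]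
      | cons b st =>
        simp only [List.cons_append, srun]
        split <;> simp [ih]
    · simp [srun, ih]

theorem srun_forest {α : Type*} {F : List (Paren α)} (h : IsForest F) (st : List α) :
    srun st F = some st := by
  induction h generalizing st with
  | nil => simp [srun]
  | append _ _ ih1 ih2 => simp [srun_append, ih1, ih2]
  | wrap a _ ih => simp [srun, srun_append, ih]

/-- Structural reading of a suffix with pending closings. -/
def Pend {α : Type*} : List α → List (Paren α) → Prop
  | [], l => IsForest l
  | a :: st, l => ∃ B l', IsForest B ∧ l = B ++ (false, a) :: l' ∧ Pend st l'

theorem Pend_prepend {α : Type*} (st : List α) (T l : List (Paren α)) (hT : IsForest T)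
    (h : Pend st l) : Pend st (T ++ l) := by
  cases st with
  | nil => exact IsForest.append hT h
  | cons a st =>
    obtain ⟨B, l', hB, rfl, h'⟩ := h
    exact ⟨T ++ B, l', hT.append hB, by simp, h'⟩

theorem srun_pend {α : Type*} (l : List (Paren α)) (st : List α) (h : srun st l = some []) :
    Pend st l := by
  induction l generalizing st with
  | nil =>
    simp [srun] at h; subst h; exact IsForest.nil
  | cons c l ih =>
    obtain ⟨b, a⟩ := c
    cases b
    · cases st with
      | nil => simp [srun] at h
      | cons b st =>
        simp only [srun] at h
        split at h
        · subst_vars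
          exact ⟨[], l, IsForest.nil, by simp, ih _ h⟩
        · simp at h
    · simp only [srun] at h
      obtain ⟨B, l', hB, rfl, h'⟩ := ih _ h
      have := Pend_prepend st _ l' (IsForest.wrap a hB) h'
      simpa using this

theorem forest_iff_srun {α : Type*} (F : List (Paren α)) : IsForest F ↔ srun [] F = some [] :=
  ⟨fun h => srun_forest h [], fun h => srun_pend F [] h⟩

theorem forest_cancel {α : Type*} (u B v : List (Paren α)) (hB : IsForest B) :
    IsForest (u ++ B ++ v) ↔ IsForest (u ++ v) := by
  simp only [forest_iff_srun, srun_append]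
  have : ((srun [] u).bind fun s => srun s B) = srun [] u := by
    cases h : srun [] u with
    | none => rfl
    | some s => simp [srun_forest hB]
  rw [this]

theorem forest_cancel_mid {α : Type*} (A g B : List (Paren α)) (hA : IsForest A) (hB : IsForest B) :
    IsForest (A ++ g ++ B) ↔ IsForest g := by
  have h1 := forest_cancel (A ++ g) B [] hB
  have h2 := forest_cancel [] A g hA
  simp only [List.append_nil, List.nil_append] at h1 h2
  rw [h1, h2]

/-- Height description of nodes. -/
def Nd {α : Type*} (F : List (Paren α)) (i j : ℕ) : Prop :=
  i < j ∧ j < F.length ∧ HH F (j + 1) = HH F i ∧ ∀ l, i < l → l ≤ j → HH F i < HH F l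

def Mt {α : Type*} (F : List (Paren α)) (i j : ℕ) : Prop := Nd F i j ∨ Nd F j i

theorem Mt.symm {α : Type*} {F : List (Paren α)} {i j : ℕ} (h : Mt F i j) : Mt F j i := Or.symm h

theorem Nd_unique {α : Type*} {F : List (Paren α)} {i j j' : ℕ} (h : Nd F i j) (h' : Nd F i j') :
    j = j' := by
  rcases lt_trichotomy j j' with hl | hl | hl
  · have := h'.2.2.2 (j+1) (by have := h.1; omega) (by omega)
    have := h.2.2.1; omega
  · exact hl
  · have := h.2.2.2 (j'+1) (by have := h'.1; omega) (by omega)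
    have := h'.2.2.1; omega

theorem Nd_unique' {α : Type*} {F : List (Paren α)} {i i' j : ℕ} (h : Nd F i j) (h' : Nd F i' j) :
    i = i' := by
  rcases lt_trichotomy i i' with hl | hl | hl
  · have h1 := h.2.2.2 i' hl h'.1.le
    have := h.2.2.1; have := h'.2.2.1; omega
  · exact hl
  · have h1 := h'.2.2.2 i hl h.1.le
    have := h.2.2.1; have := h'.2.2.1; omega

theorem Nd_open {α : Type*} {F : List (Paren α)} {i j : ℕ} (h : Nd F i j) :
    HH F (i+1) = HH F i + 1 := by
  have := h.2.2.2 (i+1) (by omega) h.1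
  have := HH_step F i
  omega

theorem Nd_close {α : Type*} {F : List (Paren α)} {i j : ℕ} (h : Nd F i j) :
    HH F (j+1) = HH F j - 1 := by
  have := h.2.2.2 j h.1 le_rfl
  have := HH_step F j
  have := h.2.2.1
  omega

theorem Mt_unique {α : Type*} {F : List (Paren α)} {i j j' : ℕ} (h : Mt F i j) (h' : Mt F i j') :
    j = j' := by
  rcases h with h | h <;> rcases h' with h' | h'
  · exact Nd_unique h h'
  · have := Nd_open h; have := Nd_close h'; omega
  · have := Nd_open h'; have := Nd_close h; omega
  · exact Nd_unique' h h'

theorem Mt_lt {α : Type*} {F : List (Paren α)} {i j : ℕ} (h : Mt F i j) :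
    i < F.length ∧ j < F.length := by
  rcases h with h | h <;> have := h.1 <;> have := h.2.1 <;> omega

theorem frag_len {β : Type*} (l : List β) (i j : ℕ) : (frag l i j).length = min j l.length - i := by
  simp [frag]

theorem HH_frag {α : Type*} (F : List (Paren α)) (i j n : ℕ) (h : i + n ≤ j) (hj : j ≤ F.length) :
    HH F (i + n) = HH F i + HH (frag F i j) n := by
  have h1 : F.take j = F.take i ++ frag F i j := by
    rw [frag, ← List.take_append_drop i (F.take j)]
    congr 1
    · simp [List.take_take]; omega
    · simp [List.take_append_drop]
  have h2 : F.take (i+n) = (F.take j).take (i+n) := by simp [List.take_take]; omega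
  have h3 : (F.take i).length = i := by simp; omega
  simp only [HH]
  rw [h2, h1, List.take_append, ht_append, h3, List.take_of_length_le (by omega)]
  simp

theorem IsNode_Nd {α : Type*} {F : List (Paren α)} {i j : ℕ} (h : IsNode F i j) : Nd F i j := by
  obtain ⟨hij, hj, ⟨a, ha, hb⟩, hf⟩ := h
  have hi1 := HH_succ F i _ ha
  have hj1 := HH_succ F j _ hb
  have hf' := forest_ht hf
  have hl : (frag F (i+1) j).length = j - (i+1) := by rw [frag_len]; omega
  simp at hi1 hj1
  refine ⟨hij, hj, ?_, ?_⟩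
  · have := HH_frag F (i+1) j (j - (i+1)) (by omega) hj.le
    rw [show i + 1 + (j - (i+1)) = j by omega, HH_len _ _ hl.le, hf'.1] at this
    omega
  · intro l h1 h2
    have := HH_frag F (i+1) j (l - (i+1)) (by omega) hj.le
    rw [show i + 1 + (l - (i+1)) = l by omega] at this
    have := hf'.2 (l - (i+1))
    omega

theorem IsNode_embed {α : Type*} {M : List (Paren α)} {i j : ℕ} (a b : List (Paren α))
    (h : IsNode M i j) : IsNode (a ++ M ++ b) (a.length + i) (a.length + j) := by
  obtain ⟨hij, hj, ⟨x, ha, hb⟩, hf⟩ := h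
  refine ⟨by omega, by simp; omega, ⟨x, ?_, ?_⟩, ?_⟩
  · rw [List.append_assoc, List.getElem?_append_right (by omega), List.getElem?_append_left (by omega)]
    simpa using ha
  · rw [List.append_assoc, List.getElem?_append_right (by omega), List.getElem?_append_left (by omega)]
    simpa using hb
  · have : frag (a ++ M ++ b) (a.length + i + 1) (a.length + j) = frag M (i+1) j := by
      unfold frag
      rw [List.append_assoc, List.take_append, List.take_append]
      simp only [Nat.add_sub_cancel_left]
      rw [show j - M.length = 0 by omega, List.take_of_length_le (by omega), List.take_zero,
        List.append_nil, add_assoc, List.drop_append]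
      simp
    rw [this]; exact hf

theorem mate_exists {α : Type*} {F : List (Paren α)} (h : IsForest F) :
    ∀ i, i < F.length → ∃ j, MateRel F i j := by
  induction h with
  | nil => simp
  | @append F G _ _ ihF ihG =>
    intro i hi
    rcases lt_or_ge i F.length with h | h
    · obtain ⟨j, hj⟩ := ihF i h
      refine ⟨j, ?_⟩
      rcases hj with hj | hj
      · left; simpa using IsNode_embed [] G hj
      · right; simpa using IsNode_embed [] G hj
    · obtain ⟨m, rfl⟩ := Nat.exists_eq_add_of_le h
      obtain ⟨j, hj⟩ := ihG m (by simpa using hi)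
      refine ⟨F.length + j, ?_⟩
      rcases hj with hj | hj
      · left; simpa using IsNode_embed F [] hj
      · right; simpa using IsNode_embed F [] hj
  | @wrap F a hF ih =>
    have hnode : IsNode ((true, a) :: F ++ [(false, a)]) 0 (F.length + 1) := by
      refine ⟨by omega, by simp, ⟨a, by simp, by simp⟩, ?_⟩
      simpa [frag] using hF
    intro i hi
    rcases i with _ | i
    · exact ⟨_, Or.inl hnode⟩
    · rcases lt_or_ge i F.length with h | h
      · obtain ⟨j, hj⟩ := ih i h
        refine ⟨j + 1, ?_⟩
        rcases hj with hj | hj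
        · left; simpa [add_comm] using IsNode_embed [(true, a)] [(false, a)] hj
        · right; simpa [add_comm] using IsNode_embed [(true, a)] [(false, a)] hj
      · have : i = F.length := by simp at hi; omega
        subst this
        exact ⟨0, Or.inr hnode⟩

theorem MateRel_Mt {α : Type*} {F : List (Paren α)} {i j : ℕ} (h : MateRel F i j) : Mt F i j :=
  h.imp IsNode_Nd IsNode_Nd

theorem Mt_exists {α : Type*} {F : List (Paren α)} (h : IsForest F) (i : ℕ) (hi : i < F.length) :
    ∃ j, Mt F i j := by
  obtain ⟨j, hj⟩ := mate_exists h i hi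
  exact ⟨j, MateRel_Mt hj⟩

theorem MateRel_iff {α : Type*} {F : List (Paren α)} (h : IsForest F) (i j : ℕ) :
    MateRel F i j ↔ Mt F i j := by
  refine ⟨MateRel_Mt, fun hm => ?_⟩
  obtain ⟨j', hj'⟩ := mate_exists h i (Mt_lt hm).1
  rw [Mt_unique hm (MateRel_Mt hj')]; exact hj'

theorem IsNode_iff {α : Type*} {F : List (Paren α)} (h : IsForest F) (i j : ℕ) :
    IsNode F i j ↔ Nd F i j := by
  refine ⟨IsNode_Nd, fun hm => ?_⟩
  rcases (MateRel_iff h i j).2 (Or.inl hm) with h' | h'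
  · exact h'
  · have := h'.1; have := hm.1; omega

/-- Embedding of positions of `a ++ b` into `a ++ M ++ b`. -/
def emb (la lM i : ℕ) : ℕ := if i < la then i else i + lM

theorem HH_emb {α : Type*} (a M b : List (Paren α)) (hM : ht M = 0) (n : ℕ) :
    (n ≤ a.length → HH (a ++ M ++ b) n = HH (a ++ b) n) ∧
    (a.length ≤ n → HH (a ++ M ++ b) (n + M.length) = HH (a ++ b) n) := by
  constructor
  · intro h
    rw [HH_app_left _ _ _ (by simp; omega), HH_app_left _ _ _ h, HH_app_left _ _ _ h]
  · intro h
    rw [HH_app_ge _ _ _ (by simp; omega), HH_app_ge _ _ _ h, ht_append, hM]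
    simp only [List.length_append]
    congr 2 <;> omega

theorem HH_mid {α : Type*} (a M b : List (Paren α)) (n : ℕ) (h1 : a.length ≤ n)
    (h2 : n ≤ a.length + M.length) : HH (a ++ M ++ b) n = ht a + HH M (n - a.length) := by
  rw [HH_app_left _ _ _ (by simp; omega), HH_app_ge _ _ _ h1]

theorem Nd_emb {α : Type*} (a M b : List (Paren α)) (hM : IsForest M) (i j : ℕ)
    (h : Nd (a ++ b) i j) :
    Nd (a ++ M ++ b) (emb a.length M.length i) (emb a.length M.length j) := by
  obtain ⟨hij, hj, he, hl⟩ := h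
  have fM := forest_ht hM
  have H := HH_emb a M b fM.1
  simp only [List.length_append] at hj
  have haa : HH (a ++ b) a.length = ht a := by
    rw [HH_app_left _ _ _ le_rfl, HH_len _ _ le_rfl]
  have hi0 : HH (a ++ M ++ b) (emb a.length M.length i) = HH (a ++ b) i := by
    unfold emb; split
    · exact (H i).1 (by omega)
    · exact (H i).2 (by omega)
  refine ⟨?_, ?_, ?_, ?_⟩
  · unfold emb; split <;> split <;> omega
  · unfold emb; simp; split <;> omega
  · rw [hi0, ← he]
    unfold emb; split
    · exact (H (j+1)).1 (by omega)
    · rw [show j + M.length + 1 = (j + 1) + M.length by omega]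
      exact (H (j+1)).2 (by omega)
  · intro l h1 h2
    rw [hi0]
    rcases lt_or_ge l a.length with hla | hla
    · rw [(H l).1 hla.le]
      apply hl
      · unfold emb at h1; split at h1 <;> omega
      · unfold emb at h2; split at h2 <;> omega
    · rcases lt_or_ge l (a.length + M.length) with hlb | hlb
      · rw [HH_mid a M b l hla hlb.le]
        have h3 := fM.2 (l - a.length)
        have h4 := hl a.length (by unfold emb at h1; split at h1 <;> omega)
          (by unfold emb at h2; split at h2 <;> omega)
        omega
      · obtain ⟨m, rfl⟩ : ∃ m, l = m + M.length := ⟨l - M.length, by omega⟩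
        rw [(H m).2 (by omega)]
        apply hl
        · unfold emb at h1; split at h1 <;> omega
        · unfold emb at h2; split at h2 <;> omega

theorem Mt_emb {α : Type*} (a M b : List (Paren α)) (hM : IsForest M) (i j : ℕ)
    (h : Mt (a ++ b) i j) :
    Mt (a ++ M ++ b) (emb a.length M.length i) (emb a.length M.length j) :=
  h.imp (Nd_emb a M b hM i j) (Nd_emb a M b hM j i)

theorem Nd_mid {α : Type*} (a M b : List (Paren α)) (i j : ℕ) (h : Nd M i j) :
    Nd (a ++ M ++ b) (a.length + i) (a.length + j) := by
  obtain ⟨hij, hj, he, hl⟩ := h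
  refine ⟨by omega, by simp; omega, ?_, ?_⟩
  · rw [HH_mid _ _ _ _ (by omega) (by omega), HH_mid _ _ _ _ (by omega) (by omega)]
    rw [show a.length + j + 1 - a.length = j + 1 by omega]; simp [he]
  · intro l h1 h2
    rw [HH_mid _ _ _ _ (by omega) (by omega), HH_mid _ _ _ _ (by omega) (by omega)]
    have := hl (l - a.length) (by omega) (by omega)
    simpa using this

theorem Mt_mid {α : Type*} (a M b : List (Paren α)) (i j : ℕ) (h : Mt M i j) :
    Mt (a ++ M ++ b) (a.length + i) (a.length + j) :=
  h.imp (Nd_mid a M b i j) (Nd_mid a M b j i)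

/-- Two nodes at the same height containing a common position coincide. -/
theorem Nd_same {α : Type*} {F : List (Paren α)} {x x' y y' z : ℕ} (h : Nd F x x') (h' : Nd F y y')
    (hx : x ≤ z) (hx' : z ≤ x') (hy : y ≤ z) (hy' : z ≤ y') (hH : HH F x = HH F y) : x = y := by
  rcases lt_trichotomy x y with hl | hl | hl
  · have := h.2.2.2 y hl (by omega); omega
  · exact hl
  · have := h'.2.2.2 x hl (by omega); omega

/-- Laminarity. -/
theorem Nd_laminar {α : Type*} {F : List (Paren α)} {x x' y y' : ℕ} (h : Nd F x x') (h' : Nd F y y')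
    (hxy : x < y) : x' < y ∨ y' < x' := by
  by_contra hc
  push Not at hc
  have h1 := h.2.2.2 y hxy hc.1
  rcases eq_or_lt_of_le hc.2 with h2 | h2
  · have := Nd_unique' h (h2 ▸ h'); omega
  · have h3 := h'.2.2.2 (x'+1) (by omega) (by omega)
    have := h.2.2.1; omega

/-! ### Alignments as lists of operations -/

/-- One edit operation. -/
inductive Op (α : Type*) : Type _
  | del (p : Paren α) : Op α
  | ins (q : Paren α) : Op α
  | sub (p q : Paren α) : Op α

/-- Source string of an operation list. -/
def p1 {α : Type*} : List (Op α) → List (Paren α)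
  | [] => []
  | Op.del p :: W => p :: p1 W
  | Op.ins _ :: W => p1 W
  | Op.sub p _ :: W => p :: p1 W

/-- Target string of an operation list. -/
def p2 {α : Type*} : List (Op α) → List (Paren α)
  | [] => []
  | Op.del _ :: W => p2 W
  | Op.ins q :: W => q :: p2 W
  | Op.sub _ q :: W => q :: p2 W

/-- Cost of an operation list. -/
noncomputable def cost {α : Type*} (w : Option α → Option α → ℝ≥0) : List (Op α) → ℝ≥0
  | [] => 0
  | Op.del p :: W => (1 / 2 : ℝ≥0) * w (some p.2) none + cost w W
  | Op.ins q :: W => (1 / 2 : ℝ≥0) * w none (some q.2) + cost w W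
  | Op.sub p q :: W => (1 / 2 : ℝ≥0) * w (some p.2) (some q.2) + cost w W

/-- Number of non-identical operations. -/
noncomputable def ed {α : Type*} : List (Op α) → ℕ
  | [] => 0
  | Op.del _ :: W => 1 + ed W
  | Op.ins _ :: W => 1 + ed W
  | Op.sub p q :: W => (if p = q then 0 else 1) + ed W

/-- `Al W x y`: the operation list aligns source position `x` with target position `y`. -/
def Al {α : Type*} : List (Op α) → ℕ → ℕ → Prop
  | [], _, _ => False
  | Op.del _ :: W, x, y => ∃ x', x = x' + 1 ∧ Al W x' y
  | Op.ins _ :: W, x, y => ∃ y', y = y' + 1 ∧ Al W x y'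
  | Op.sub _ _ :: W, x, y => (x = 0 ∧ y = 0) ∨ ∃ x' y', x = x' + 1 ∧ y = y' + 1 ∧ Al W x' y'

/-- `Vx W x y`: the path passes through vertex `(x, y)`. -/
def Vx {α : Type*} (W : List (Op α)) (x y : ℕ) : Prop :=
  ∃ W1 W2, W = W1 ++ W2 ∧ (p1 W1).length = x ∧ (p2 W1).length = y

def Cons {α : Type*} (W : List (Op α)) : Prop :=
  ∀ x y x' y', Al W x y → Mt (p1 W) x x' → Mt (p2 W) y y' → Al W x' y'

def ids {α : Type*} (S : List (Paren α)) : List (Op α) := S.map (fun c => Op.sub c c)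

@[simp] theorem p1_nil {α : Type*} : p1 ([] : List (Op α)) = [] := rfl
@[simp] theorem p2_nil {α : Type*} : p2 ([] : List (Op α)) = [] := rfl
@[simp] theorem p1_del {α : Type*} (p : Paren α) (W) : p1 (Op.del p :: W) = p :: p1 W := rfl
@[simp] theorem p1_ins {α : Type*} (p : Paren α) (W) : p1 (Op.ins p :: W) = p1 W := rfl
@[simp] theorem p1_sub {α : Type*} (p q : Paren α) (W) : p1 (Op.sub p q :: W) = p :: p1 W := rfl
@[simp] theorem p2_del {α : Type*} (p : Paren α) (W) : p2 (Op.del p :: W) = p2 W := rfl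
@[simp] theorem p2_ins {α : Type*} (p : Paren α) (W) : p2 (Op.ins p :: W) = p :: p2 W := rfl
@[simp] theorem p2_sub {α : Type*} (p q : Paren α) (W) : p2 (Op.sub p q :: W) = q :: p2 W := rfl

@[simp] theorem p1_append {α : Type*} (A B : List (Op α)) : p1 (A ++ B) = p1 A ++ p1 B := by
  induction A with
  | nil => simp
  | cons o A ih => cases o <;> simp [ih]

@[simp] theorem p2_append {α : Type*} (A B : List (Op α)) : p2 (A ++ B) = p2 A ++ p2 B := by
  induction A with
  | nil => simp
  | cons o A ih => cases o <;> simp [ih]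

theorem cost_append {α : Type*} (w : Option α → Option α → ℝ≥0) (A B : List (Op α)) :
    cost w (A ++ B) = cost w A + cost w B := by
  induction A with
  | nil => simp [cost]
  | cons o A ih => cases o <;> simp [cost, ih, add_assoc]

theorem ed_append {α : Type*} (A B : List (Op α)) : ed (A ++ B) = ed A + ed B := by
  induction A with
  | nil => simp [ed]
  | cons o A ih => cases o <;> simp [ed, ih, add_assoc]

@[simp] theorem p1_ids {α : Type*} (S : List (Paren α)) : p1 (ids S) = S := by
  induction S with
  | nil => rfl
  | cons c S ih => simpa [ids] using ih

@[simp] theorem p2_ids {α : Type*} (S : List (Paren α)) : p2 (ids S) = S := by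
  induction S with
  | nil => rfl
  | cons c S ih => simpa [ids] using ih

theorem cost_ids {α : Type*} (w : Option α → Option α → ℝ≥0) (hw : Normalized w)
    (S : List (Paren α)) : cost w (ids S) = 0 := by
  induction S with
  | nil => rfl
  | cons c S ih =>
    simp only [ids, List.map_cons, cost] at ih ⊢
    rw [ih, hw.1]; simp

theorem Al_ids {α : Type*} (S : List (Paren α)) (x y : ℕ) :
    Al (ids S) x y ↔ x = y ∧ x < S.length := by
  induction S generalizing x y with
  | nil => simp [ids, Al]
  | cons c S ih =>
    simp only [ids, List.map_cons, Al] at ih ⊢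
    constructor
    · rintro (⟨rfl, rfl⟩ | ⟨x', y', rfl, rfl, h⟩)
      · simp
      · have := (ih _ _).1 h; simp; omega
    · rintro ⟨rfl, h⟩
      cases x with
      | zero => simp
      | succ n => right; exact ⟨n, n, rfl, rfl, (ih _ _).2 ⟨rfl, by simpa using h⟩⟩

theorem Al_append {α : Type*} (A B : List (Op α)) (x y : ℕ) :
    Al (A ++ B) x y ↔ Al A x y ∨
      ∃ x' y', x = (p1 A).length + x' ∧ y = (p2 A).length + y' ∧ Al B x' y' := by
  induction A generalizing x y with
  | nil => simp [Al]
  | cons o A ih =>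
    cases o with
    | del p =>
      simp only [List.cons_append, Al, ih, p1_del, p2_del, List.length_cons]
      constructor
      · rintro ⟨x', rfl, h | ⟨u, v, rfl, rfl, h⟩⟩
        · exact Or.inl ⟨x', rfl, h⟩
        · exact Or.inr ⟨u, v, by omega, rfl, h⟩
      · rintro (⟨x', rfl, h⟩ | ⟨u, v, rfl, rfl, h⟩)
        · exact ⟨x', rfl, Or.inl h⟩
        · exact ⟨_, by omega, Or.inr ⟨u, v, rfl, rfl, h⟩⟩
    | ins p =>
      simp only [List.cons_append, Al, ih, p1_ins, p2_ins, List.length_cons]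
      constructor
      · rintro ⟨x', rfl, h | ⟨u, v, rfl, rfl, h⟩⟩
        · exact Or.inl ⟨x', rfl, h⟩
        · exact Or.inr ⟨u, v, rfl, by omega, h⟩
      · rintro (⟨x', rfl, h⟩ | ⟨u, v, rfl, rfl, h⟩)
        · exact ⟨x', rfl, Or.inl h⟩
        · exact ⟨_, by omega, Or.inr ⟨u, v, rfl, rfl, h⟩⟩
    | sub p q =>
      simp only [List.cons_append, Al, ih, p1_sub, p2_sub, List.length_cons]
      constructor
      · rintro (h | ⟨x', y', rfl, rfl, h | ⟨u, v, rfl, rfl, h⟩⟩)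
        · exact Or.inl (Or.inl h)
        · exact Or.inl (Or.inr ⟨x', y', rfl, rfl, h⟩)
        · exact Or.inr ⟨u, v, by omega, by omega, h⟩
      · rintro ((h | ⟨x', y', rfl, rfl, h⟩) | ⟨u, v, rfl, rfl, h⟩)
        · exact Or.inl h
        · exact Or.inr ⟨x', y', rfl, rfl, Or.inl h⟩
        · exact Or.inr ⟨_, _, by omega, by omega, Or.inr ⟨u, v, rfl, rfl, h⟩⟩

theorem Al_lt {α : Type*} {W : List (Op α)} {x y : ℕ} (h : Al W x y) :
    x < (p1 W).length ∧ y < (p2 W).length := by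
  induction W generalizing x y with
  | nil => simp [Al] at h
  | cons o W ih =>
    cases o with
    | del p => obtain ⟨x', rfl, h⟩ := h; have := ih h; simp; omega
    | ins p => obtain ⟨x', rfl, h⟩ := h; have := ih h; simp; omega
    | sub p q =>
      rcases h with ⟨rfl, rfl⟩ | ⟨x', y', rfl, rfl, h⟩
      · simp
      · have := ih h; simp; omega

theorem Al_emb {α : Type*} (A M B : List (Op α)) (x y : ℕ) :
    Al (A ++ M ++ B) (emb (p1 A).length (p1 M).length x) (emb (p2 A).length (p2 M).length y) ↔
      Al (A ++ B) x y := by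
  simp only [Al_append, List.append_assoc]
  unfold emb
  constructor
  · rintro (h | ⟨u, v, hu, hv, h | ⟨u', v', rfl, rfl, h⟩⟩)
    · left
      have := Al_lt h
      split_ifs at h <;> first | exact h | (exfalso; split_ifs at this <;> omega)
    · exfalso
      have := Al_lt h
      split_ifs at hu <;> omega
    · right
      refine ⟨u', v', ?_, ?_, h⟩
      · split_ifs at hu <;> omega
      · split_ifs at hv <;> omega
  · rintro (h | ⟨u', v', rfl, rfl, h⟩)
    · left
      have := Al_lt h
      rw [if_pos this.1, if_pos this.2]; exact h
    · right
      rw [if_neg (by omega), if_neg (by omega)]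
      exact ⟨_, _, by rw [add_assoc], by rw [add_assoc], Or.inr ⟨u', v', by omega, by omega, h⟩⟩

theorem Al_mid {α : Type*} (A M B : List (Op α)) (x y : ℕ) (hx : x < (p1 M).length) :
    Al (A ++ M ++ B) ((p1 A).length + x) ((p2 A).length + y) ↔ Al M x y := by
  simp only [Al_append, List.append_assoc]
  constructor
  · rintro (h | ⟨u, v, hu, hv, h | ⟨u', v', rfl, rfl, h⟩⟩)
    · have := Al_lt h; omega
    · obtain rfl : x = u := by omega
      obtain rfl : y = v := by omega
      exact h
    · omega
  · intro h
    exact Or.inr ⟨x, y, rfl, rfl, Or.inl h⟩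

theorem cut_out {α : Type*} (A M B : List (Op α)) (h1 : IsForest (p1 M)) (h2 : IsForest (p2 M))
    (hc : Cons (A ++ M ++ B)) : Cons (A ++ B) := by
  intro x y x' y' hA hx hy
  rw [← Al_emb A M B]
  refine hc _ _ _ _ ((Al_emb A M B _ _).2 hA) ?_ ?_
  · simp only [p1_append] at hx ⊢
    exact Mt_emb _ _ _ h1 _ _ hx
  · simp only [p2_append] at hy ⊢
    exact Mt_emb _ _ _ h2 _ _ hy

theorem cut_in {α : Type*} (A M B : List (Op α)) (hc : Cons (A ++ M ++ B)) : Cons M := by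
  intro x y x' y' hA hx hy
  rw [← Al_mid A M B _ _ (Mt_lt hx).2]
  refine hc _ _ _ _ ((Al_mid A M B _ _ (Mt_lt hx).1).2 hA) ?_ ?_
  · simp only [p1_append]
    exact Mt_mid _ _ _ _ _ hx
  · simp only [p2_append]
    exact Mt_mid _ _ _ _ _ hy

theorem paste {α : Type*} (A M B : List (Op α)) (h1 : IsForest (p1 M)) (h2 : IsForest (p2 M))
    (h3 : IsForest (p1 (A ++ B))) (h4 : IsForest (p2 (A ++ B)))
    (hc : Cons (A ++ B)) (hM : Cons M) : Cons (A ++ M ++ B) := by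
  intro x y x' y' hA hx hy
  by_cases hm : ∃ u v, x = (p1 A).length + u ∧ y = (p2 A).length + v ∧ Al M u v
  · obtain ⟨u, v, rfl, rfl, h⟩ := hm
    have hl := Al_lt h
    obtain ⟨u', hu'⟩ := Mt_exists h1 u hl.1
    obtain ⟨v', hv'⟩ := Mt_exists h2 v hl.2
    have e1 := Mt_mid (p1 A) _ (p1 B) _ _ hu'
    have e2 := Mt_mid (p2 A) _ (p2 B) _ _ hv'
    simp only [p1_append, p2_append] at hx hy
    rw [Mt_unique hx e1, Mt_unique hy e2, Al_mid _ _ _ _ _ (Mt_lt hu').2]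
    exact hM _ _ _ _ h hu' hv'
  · have : ∃ i j, x = emb (p1 A).length (p1 M).length i ∧ y = emb (p2 A).length (p2 M).length j ∧
        Al (A ++ B) i j := by
      simp only [List.append_assoc, Al_append] at hA
      rcases hA with h | ⟨u, v, hu, hv, h | ⟨u', v', rfl, rfl, h⟩⟩
      · refine ⟨x, y, ?_, ?_, (Al_append _ _ _ _).2 (Or.inl h)⟩
        · rw [emb, if_pos (Al_lt h).1]
        · rw [emb, if_pos (Al_lt h).2]
      · exact absurd ⟨u, v, hu, hv, h⟩ hm
      · refine ⟨(p1 A).length + u', (p2 A).length + v', ?_, ?_,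
          (Al_append _ _ _ _).2 (Or.inr ⟨u', v', rfl, rfl, h⟩)⟩
        · rw [emb, if_neg (by omega)]; omega
        · rw [emb, if_neg (by omega)]; omega
    obtain ⟨i, j, rfl, rfl, h⟩ := this
    have hl := Al_lt h
    obtain ⟨u', hu'⟩ := Mt_exists h3 i hl.1
    obtain ⟨v', hv'⟩ := Mt_exists h4 j hl.2
    have e1 := hu'
    have e2 := hv'
    simp only [p1_append, p2_append] at hx hy e1 e2
    rw [Mt_unique hx (Mt_emb _ _ _ h1 _ _ e1), Mt_unique hy (Mt_emb _ _ _ h2 _ _ e2), Al_emb]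
    exact hc _ _ _ _ h hu' hv'

theorem Cons_ids {α : Type*} (S : List (Paren α)) : Cons (ids S) := by
  intro x y x' y' h hx hy
  rw [Al_ids] at h ⊢
  obtain ⟨rfl, h⟩ := h
  rw [p1_ids] at hx; rw [p2_ids] at hy
  exact ⟨Mt_unique hx hy, (Mt_lt hx).2⟩

/-! ### Monotonicity, vertices -/

theorem Al_mono {α : Type*} {W : List (Op α)} {x y x' y' : ℕ} (h : Al W x y) (h' : Al W x' y') :
    (x < x' ↔ y < y') := by
  induction W generalizing x y x' y' with
  | nil => simp [Al] at h
  | cons o W ih =>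
    cases o with
    | del p =>
      obtain ⟨u, rfl, h⟩ := h; obtain ⟨u', rfl, h'⟩ := h'
      have := ih h h'; omega
    | ins p =>
      obtain ⟨u, rfl, h⟩ := h; obtain ⟨u', rfl, h'⟩ := h'
      have := ih h h'; omega
    | sub p q =>
      rcases h with ⟨rfl, rfl⟩ | ⟨u, v, rfl, rfl, h⟩ <;>
      rcases h' with ⟨rfl, rfl⟩ | ⟨u', v', rfl, rfl, h'⟩
      · simp
      · simp
      · simp
      · have := ih h h'; omega

theorem Vx_mono {α : Type*} {W : List (Op α)} {x y x' y' : ℕ} (h : Vx W x y) (h' : Vx W x' y') :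
    (x ≤ x' ∧ y ≤ y') ∨ (x' ≤ x ∧ y' ≤ y) := by
  obtain ⟨A, B, rfl, rfl, rfl⟩ := h
  obtain ⟨A', B', e, rfl, rfl⟩ := h'
  rcases List.append_eq_append_iff.1 e with ⟨c, rfl, rfl⟩ | ⟨c, rfl, rfl⟩
  · left; simp
  · right; simp

theorem Al_Vx {α : Type*} {W : List (Op α)} {x y : ℕ} (h : Al W x y) :
    ∃ W1 p q W2, W = W1 ++ Op.sub p q :: W2 ∧ (p1 W1).length = x ∧ (p2 W1).length = y := by
  induction W generalizing x y with
  | nil => simp [Al] at h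
  | cons o W ih =>
    cases o with
    | del p =>
      obtain ⟨u, rfl, h⟩ := h
      obtain ⟨W1, p', q, W2, rfl, rfl, rfl⟩ := ih h
      exact ⟨Op.del p :: W1, p', q, W2, rfl, rfl, rfl⟩
    | ins p =>
      obtain ⟨u, rfl, h⟩ := h
      obtain ⟨W1, p', q, W2, rfl, rfl, rfl⟩ := ih h
      exact ⟨Op.ins p :: W1, p', q, W2, rfl, rfl, rfl⟩
    | sub p q =>
      rcases h with ⟨rfl, rfl⟩ | ⟨u, v, rfl, rfl, h⟩
      · exact ⟨[], p, q, W, rfl, rfl, rfl⟩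
      · obtain ⟨W1, p', q', W2, rfl, rfl, rfl⟩ := ih h
        exact ⟨Op.sub p q :: W1, p', q', W2, rfl, rfl, rfl⟩

theorem Vx_of_Al {α : Type*} {W : List (Op α)} {x y : ℕ} (h : Al W x y) :
    Vx W x y ∧ Vx W (x+1) (y+1) := by
  obtain ⟨W1, p, q, W2, rfl, rfl, rfl⟩ := Al_Vx h
  refine ⟨⟨W1, _, rfl, rfl, rfl⟩, ⟨W1 ++ [Op.sub p q], W2, by simp, by simp, by simp⟩⟩

theorem Al_of_eq {α : Type*} (W1 : List (Op α)) (p q : Paren α) (W2 : List (Op α)) :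
    Al (W1 ++ Op.sub p q :: W2) (p1 W1).length (p2 W1).length := by
  rw [Al_append]; right; exact ⟨0, 0, rfl, rfl, Or.inl ⟨rfl, rfl⟩⟩

theorem ed_width {α : Type*} (W : List (Op α)) :
    (p1 W).length ≤ (p2 W).length + ed W ∧ (p2 W).length ≤ (p1 W).length + ed W := by
  induction W with
  | nil => simp
  | cons o W ih => cases o <;> simp [ed] <;> omega

theorem Vx_width {α : Type*} {W : List (Op α)} {x y : ℕ} (h : Vx W x y) :
    x ≤ y + ed W ∧ y ≤ x + ed W := by
  obtain ⟨A, B, rfl, rfl, rfl⟩ := h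
  have := ed_width A
  rw [ed_append]; omega

/-- Subs of a consistent alignment preserve the direction of parentheses. -/
theorem Al_dir {α : Type*} {W : List (Op α)} (hc : Cons W) (h1 : IsForest (p1 W))
    (h2 : IsForest (p2 W)) {x y : ℕ} (h : Al W x y) :
    ∃ x' y', Al W x' y' ∧ (Nd (p1 W) x x' ∧ Nd (p2 W) y y' ∨ Nd (p1 W) x' x ∧ Nd (p2 W) y' y) := by
  have hl := Al_lt h
  obtain ⟨x', hx⟩ := Mt_exists h1 x hl.1
  obtain ⟨y', hy⟩ := Mt_exists h2 y hl.2
  have h' := hc _ _ _ _ h hx hy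
  have m := Al_mono h h'
  refine ⟨x', y', h', ?_⟩
  rcases hx with hx | hx <;> rcases hy with hy | hy
  · exact Or.inl ⟨hx, hy⟩
  · have := hx.1; have := hy.1; omega
  · have := hx.1; have := hy.1; omega
  · exact Or.inr ⟨hx, hy⟩

/-- Source-position-indexed edit count. -/
noncomputable def cum {α : Type*} : List (Op α) → ℕ → ℕ
  | [], _ => 0
  | _ :: _, 0 => 0
  | Op.del _ :: W, n + 1 => 1 + cum W n
  | Op.ins _ :: W, n + 1 => 1 + cum W (n + 1)
  | Op.sub p q :: W, n + 1 => (if p = q then 0 else 1) + cum W n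

theorem cum_zero {α : Type*} (W : List (Op α)) : cum W 0 = 0 := by
  cases W <;> simp [cum]

theorem cum_le {α : Type*} (W : List (Op α)) (n : ℕ) : cum W n ≤ ed W := by
  induction W generalizing n with
  | nil => simp [cum]
  | cons o W ih =>
    cases n with
    | zero => simp [cum]
    | succ n =>
      have := ih n; have := ih (n+1)
      cases o <;> simp [cum, ed] <;> omega

theorem cum_mono {α : Type*} (W : List (Op α)) {m n : ℕ} (h : m ≤ n) : cum W m ≤ cum W n := by
  induction W generalizing m n with
  | nil => simp [cum]
  | cons o W ih =>
    cases m with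
    | zero => simp [cum]
    | succ m =>
      obtain ⟨n, rfl⟩ : ∃ n', n = n' + 1 := ⟨n - 1, by omega⟩
      have := ih (m := m) (n := n) (by omega); have := ih h
      cases o <;> simp [cum] <;> omega

theorem cum_clean {α : Type*} (W : List (Op α)) (a b : ℕ) (hab : a ≤ b) (hb : b ≤ (p1 W).length)
    (h : cum W a = cum W b) :
    ∃ W1 S W2, W = W1 ++ ids S ++ W2 ∧ (p1 W1).length = a ∧ S.length = b - a := by
  induction W generalizing a b with
  | nil =>
    simp at hb; obtain rfl : a = 0 := by omega
    exact ⟨[], [], [], rfl, rfl, by simp [hb]⟩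
  | cons o W ih =>
    cases b with
    | zero => obtain rfl : a = 0 := by omega
              exact ⟨[], [], o :: W, rfl, rfl, rfl⟩
    | succ b =>
      cases a with
      | zero =>
        cases o with
        | del p => simp [cum] at h; omega
        | ins p => simp [cum] at h; omega
        | sub p q =>
          simp only [cum] at h
          have hpq : p = q := by
            by_contra hn
            rw [if_neg hn] at h; omega
          subst hpq
          have h : cum W b = 0 := by simpa using h.symm
          have hb' : b ≤ (p1 W).length := by simpa using hb
          obtain ⟨W1, S, W2, rfl, e, hS⟩ := ih 0 b (by omega) hb' (by rw [cum_zero]; exact h.symm)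
          have hW1 : ∀ W1 : List (Op α), p1 W1 = [] → cum (W1 ++ ids S ++ W2) b = 0 → 0 < S.length →
              W1 = [] := by
            intro W1 h1 h2 h3
            cases W1 with
            | nil => rfl
            | cons o W1 =>
              obtain ⟨b, rfl⟩ : ∃ b', b = b' + 1 := ⟨b - 1, by omega⟩
              cases o <;> simp [cum] at h1 h2
          by_cases h0 : 0 < S.length
          · obtain rfl := hW1 W1 (by simpa using e) h h0
            exact ⟨[], p :: S, W2, rfl, rfl, by simp; omega⟩
          · obtain rfl : b = 0 := by omega
            exact ⟨[], [p], W1 ++ ids S ++ W2, rfl, rfl, rfl⟩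
      | succ a =>
        cases o with
        | del p =>
          simp [cum] at h hb
          obtain ⟨W1, S, W2, rfl, e, hS⟩ := ih a b (by omega) hb h
          exact ⟨Op.del p :: W1, S, W2, rfl, by simp [e], by omega⟩
        | ins p =>
          simp [cum] at h
          obtain ⟨W1, S, W2, rfl, e, hS⟩ := ih (a+1) (b+1) (by omega) hb h
          exact ⟨Op.ins p :: W1, S, W2, rfl, by simp [e], by omega⟩
        | sub p q =>
          simp [cum] at h hb
          obtain ⟨W1, S, W2, rfl, e, hS⟩ := ih a b (by omega) hb h
          exact ⟨Op.sub p q :: W1, S, W2, rfl, by simp [e], by omega⟩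

/-! ### Bridge to alignment paths -/

def pth {α : Type*} : List (Op α) → ℕ → ℕ → List (ℕ × ℕ)
  | [], x, y => [(x, y)]
  | Op.del _ :: W, x, y => (x, y) :: pth W (x + 1) y
  | Op.ins _ :: W, x, y => (x, y) :: pth W x (y + 1)
  | Op.sub _ _ :: W, x, y => (x, y) :: pth W (x + 1) (y + 1)

theorem pth_cons {α : Type*} (W : List (Op α)) (x y : ℕ) : ∃ t, pth W x y = (x, y) :: t := by
  cases W with
  | nil => exact ⟨_, rfl⟩
  | cons o W => cases o <;> exact ⟨_, rfl⟩

theorem pth_last {α : Type*} (W : List (Op α)) (x y : ℕ) :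
    (pth W x y).getLast? = some (x + (p1 W).length, y + (p2 W).length) := by
  induction W generalizing x y with
  | nil => simp [pth]
  | cons o W ih =>
    cases o with
    | del p =>
      have := ih (x+1) y
      obtain ⟨t, ht⟩ := pth_cons W (x+1) y
      simp only [pth, ht, List.getLast?_cons_cons] at this ⊢
      rw [this]; simp; omega
    | ins p =>
      have := ih x (y+1)
      obtain ⟨t, ht⟩ := pth_cons W x (y+1)
      simp only [pth, ht, List.getLast?_cons_cons] at this ⊢
      rw [this]; simp; omega
    | sub p q =>
      have := ih (x+1) (y+1)
      obtain ⟨t, ht⟩ := pth_cons W (x+1) (y+1)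
      simp only [pth, ht, List.getLast?_cons_cons] at this ⊢
      rw [this]; simp; omega

theorem pth_chain {α : Type*} (W : List (Op α)) (x y : ℕ) :
    (pth W x y).IsChain AlignStep := by
  induction W generalizing x y with
  | nil => simp [pth]
  | cons o W ih =>
    cases o with
    | del p =>
      have := ih (x+1) y
      obtain ⟨t, ht⟩ := pth_cons W (x+1) y
      simp only [pth, ht, List.isChain_cons_cons] at this ⊢
      exact ⟨Or.inl rfl, this⟩
    | ins p =>
      have := ih x (y+1)
      obtain ⟨t, ht⟩ := pth_cons W x (y+1)
      simp only [pth, ht, List.isChain_cons_cons] at this ⊢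
      exact ⟨Or.inr (Or.inl rfl), this⟩
    | sub p q =>
      have := ih (x+1) (y+1)
      obtain ⟨t, ht⟩ := pth_cons W (x+1) (y+1)
      simp only [pth, ht, List.isChain_cons_cons] at this ⊢
      exact ⟨Or.inr (Or.inr rfl), this⟩

theorem AlignsAt_cons (p q : ℕ × ℕ) (t : List (ℕ × ℕ)) (f g : ℕ) :
    AlignsAt (p :: q :: t) f g ↔ (p = (f, g) ∧ q = (f+1, g+1)) ∨ AlignsAt (q :: t) f g := by
  constructor
  · rintro ⟨n, h1, h2⟩
    cases n with
    | zero => left; exact ⟨by simpa using h1, by simpa using h2⟩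
    | succ n => right; exact ⟨n, by simpa using h1, by simpa using h2⟩
  · rintro (⟨rfl, rfl⟩ | ⟨n, h1, h2⟩)
    · exact ⟨0, rfl, rfl⟩
    · exact ⟨n+1, by simpa using h1, by simpa using h2⟩

theorem pth_aligns {α : Type*} (W : List (Op α)) (x y f g : ℕ) :
    AlignsAt (pth W x y) f g ↔ ∃ i j, f = x + i ∧ g = y + j ∧ Al W i j := by
  induction W generalizing x y with
  | nil =>
    simp only [pth, Al]
    constructor
    · rintro ⟨t, h1, h2⟩; simp at h2
    · simp
  | cons o W ih =>
    cases o with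
    | del p =>
      have := ih (x+1) y
      obtain ⟨t, ht⟩ := pth_cons W (x+1) y
      simp only [pth, ht, AlignsAt_cons] at this ⊢
      rw [this]
      constructor
      · rintro (⟨h1, h2⟩ | ⟨i, j, rfl, rfl, h⟩)
        · simp at h1 h2; omega
        · exact ⟨i+1, j, by omega, rfl, ⟨i, rfl, h⟩⟩
      · rintro ⟨i, j, rfl, rfl, ⟨i', rfl, h⟩⟩
        exact Or.inr ⟨i', j, by omega, rfl, h⟩
    | ins p =>
      have := ih x (y+1)
      obtain ⟨t, ht⟩ := pth_cons W x (y+1)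
      simp only [pth, ht, AlignsAt_cons] at this ⊢
      rw [this]
      constructor
      · rintro (⟨h1, h2⟩ | ⟨i, j, rfl, rfl, h⟩)
        · simp at h1 h2; omega
        · exact ⟨i, j+1, rfl, by omega, ⟨j, rfl, h⟩⟩
      · rintro ⟨i, j, rfl, rfl, ⟨i', rfl, h⟩⟩
        exact Or.inr ⟨i, i', rfl, by omega, h⟩
    | sub p q =>
      have := ih (x+1) (y+1)
      obtain ⟨t, ht⟩ := pth_cons W (x+1) (y+1)
      simp only [pth, ht, AlignsAt_cons] at this ⊢
      rw [this]
      constructor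
      · rintro (⟨h1, h2⟩ | ⟨i, j, rfl, rfl, h⟩)
        · simp at h1; exact ⟨0, 0, by omega, by omega, Or.inl ⟨rfl, rfl⟩⟩
        · exact ⟨i+1, j+1, by omega, by omega, Or.inr ⟨i, j, rfl, rfl, h⟩⟩
      · rintro ⟨i, j, rfl, rfl, ⟨rfl, rfl⟩ | ⟨i', j', rfl, rfl, h⟩⟩
        · left; simp
        · exact Or.inr ⟨i', j', by omega, by omega, h⟩

theorem drop_cons_eq {β : Type*} {F : List β} {x : ℕ} {c : β} {t : List β} (h : c :: t = F.drop x) :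
    F[x]? = some c ∧ t = F.drop (x+1) := by
  have h2 : (F.drop x)[0]? = some c := by rw [← h]; rfl
  refine ⟨by simpa using h2, ?_⟩
  have h3 : (F.drop x).tail = t := by rw [← h]; rfl
  rw [← h3]; simp

theorem pth_cost {α : Type*} (w : Option α → Option α → ℝ≥0) (F G : List (Paren α))
    (W : List (Op α)) (x y : ℕ) (h1 : p1 W = F.drop x) (h2 : p2 W = G.drop y) :
    pathCost w F G (pth W x y) = cost w W := by
  induction W generalizing x y with
  | nil => simp [pth, pathCost, cost]
  | cons o W ih =>
    cases o with
    | del p =>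
      obtain ⟨e1, e2⟩ := drop_cons_eq h1
      have := ih (x+1) y e2 h2
      obtain ⟨t, ht⟩ := pth_cons W (x+1) y
      simp only [pth, ht, pathCost, cost] at this ⊢
      rw [this]; simp [lbl, e1]
    | ins p =>
      obtain ⟨e1, e2⟩ := drop_cons_eq h2
      have := ih x (y+1) h1 e2
      obtain ⟨t, ht⟩ := pth_cons W x (y+1)
      simp only [pth, ht, pathCost, cost] at this ⊢
      rw [this]; simp [lbl, e1]
    | sub p q =>
      obtain ⟨e1, e2⟩ := drop_cons_eq h1
      obtain ⟨e3, e4⟩ := drop_cons_eq h2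
      have := ih (x+1) (y+1) e2 e4
      obtain ⟨t, ht⟩ := pth_cons W (x+1) (y+1)
      simp only [pth, ht, pathCost, cost] at this ⊢
      rw [this]; simp [lbl, e1, e3]

theorem pth_surj {α : Type*} (F G : List (Paren α)) (path : List (ℕ × ℕ)) (x y : ℕ)
    (h1 : path.head? = some (x, y)) (h2 : path.getLast? = some (F.length, G.length))
    (h3 : path.IsChain AlignStep) :
    ∃ W, path = pth W x y ∧ p1 W = F.drop x ∧ p2 W = G.drop y := by
  induction path generalizing x y with
  | nil => simp at h1
  | cons p t ih =>
    cases t with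
    | nil =>
      simp at h1 h2; subst h1; simp at h2
      exact ⟨[], rfl, by simp [h2.1], by simp [h2.2]⟩
    | cons q t =>
      simp at h1; subst h1
      rw [List.isChain_cons_cons] at h3
      rw [List.getLast?_cons_cons] at h2
      obtain ⟨hs, h3⟩ := h3
      obtain ⟨u, v⟩ := q
      obtain ⟨W, e, w1, w2⟩ := ih u v rfl h2 h3
      have hl := h2
      rw [e, pth_last] at hl
      simp at hl
      rcases hs with hs | hs | hs
      · simp at hs; obtain ⟨rfl, rfl⟩ := hs
        refine ⟨Op.del (F[x]'(by omega)) :: W, by simp [pth, e], ?_, w2⟩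
        simp [w1]
      · simp at hs; obtain ⟨rfl, rfl⟩ := hs
        refine ⟨Op.ins (G[y]'(by omega)) :: W, by simp [pth, e], w1, ?_⟩
        simp [w2]
      · simp at hs; obtain ⟨rfl, rfl⟩ := hs
        refine ⟨Op.sub (F[x]'(by omega)) (G[y]'(by omega)) :: W, by simp [pth, e], ?_, ?_⟩
        · simp [w1]
        · simp [w2]

theorem pth_consistent {α : Type*} (W : List (Op α)) (h1 : IsForest (p1 W)) (h2 : IsForest (p2 W)) :
    Consistent (p1 W) (p2 W) (pth W 0 0) ↔ Cons W := by
  unfold Consistent Cons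
  simp only [pth_aligns, MateRel_iff h1, MateRel_iff h2, Nat.zero_add]
  constructor
  · intro h x y x' y' a b c
    obtain ⟨i, j, rfl, rfl, r⟩ := h x y x' y' ⟨x, y, rfl, rfl, a⟩ b c
    exact r
  · rintro h x y x' y' ⟨i, j, rfl, rfl, a⟩ b c
    exact ⟨x', y', rfl, rfl, h _ _ _ _ a b c⟩

theorem ed_le_cost {α : Type*} (w : Option α → Option α → ℝ≥0) (hw : Normalized w)
    (W : List (Op α)) (h : ∀ p q, Op.sub p q ∈ W → p.1 = q.1) : (ed W : ℝ≥0) ≤ 2 * cost w W := by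
  induction W with
  | nil => simp [ed, cost]
  | cons o W ih =>
    have ih := ih (fun p q hm => h p q (List.mem_cons_of_mem _ hm))
    cases o with
    | del p =>
      have := hw.2 (some p.2) none (by simp)
      simp only [ed, cost]; push_cast
      rw [mul_add, ← mul_assoc]; gcongr; simpa using this
    | ins p =>
      have := hw.2 none (some p.2) (by simp)
      simp only [ed, cost]; push_cast
      rw [mul_add, ← mul_assoc]; gcongr; simpa using this
    | sub p q =>
      simp only [ed, cost]; push_cast
      rw [mul_add, ← mul_assoc]; gcongr
      split_ifs with hpq
      · simp
      · have hd := h p q (by simp)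
        have := hw.2 (some p.2) (some q.2) (by
          intro h'; apply hpq; exact Prod.ext hd (by simpa using h'))
        simpa using this

theorem Cons_dir {α : Type*} {W : List (Op α)} (hc : Cons W) (h1 : IsForest (p1 W))
    (h2 : IsForest (p2 W)) (p q : Paren α) (h : Op.sub p q ∈ W) : p.1 = q.1 := by
  obtain ⟨W1, W2, rfl⟩ := List.append_of_mem h
  obtain ⟨x', y', -, hh⟩ := Al_dir hc h1 h2 (Al_of_eq W1 p q W2)
  have e1 := HH_succ (p1 (W1 ++ Op.sub p q :: W2)) (p1 W1).length p (by simp)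
  have e2 := HH_succ (p2 (W1 ++ Op.sub p q :: W2)) (p2 W1).length q (by simp)
  rcases hh with ⟨a, b⟩ | ⟨a, b⟩
  · have := Nd_open a; have := Nd_open b
    rcases sg_cases p with h | h <;> rcases sg_cases q with h' | h' <;> first | omega | simp [h.2, h'.2]
  · have := Nd_close a; have := Nd_close b
    rcases sg_cases p with h | h <;> rcases sg_cases q with h' | h' <;> first | omega | simp [h.2, h'.2]

theorem tedLE_le {α : Type*} (k : ℕ) (w : Option α → Option α → ℝ≥0) (hw : Normalized w)
    (F G F' G' : List (Paren α)) (hF : IsForest F) (hG : IsForest G) (hF' : IsForest F')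
    (hG' : IsForest G')
    (h : ∀ W, p1 W = F → p2 W = G → Cons W → ed W ≤ 2 * k →
      ∃ W', p1 W' = F' ∧ p2 W' = G' ∧ Cons W' ∧ cost w W' ≤ cost w W) :
    tedLE k w F' G' ≤ tedLE k w F G := by
  unfold tedLE
  by_cases hk : tedFrag w F G 0 F.length 0 G.length ≤ (k : ℝ≥0∞)
  swap
  · rw [if_neg hk]; exact le_top
  rw [if_pos hk]
  have key : tedFrag w F' G' 0 F'.length 0 G'.length ≤ tedFrag w F G 0 F.length 0 G.length := by
    apply le_of_forall_gt_imp_ge_of_dense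
    intro c hc
    have hc' : tedFrag w F G 0 F.length 0 G.length < min c (k + (1/2 : ℝ≥0) : ℝ≥0) := by
      apply lt_min hc
      refine lt_of_le_of_lt hk ?_
      rw [show (k : ℝ≥0∞) = ((k : ℝ≥0) : ℝ≥0∞) by simp, ENNReal.coe_lt_coe]
      exact lt_add_of_pos_right _ (by norm_num)
    rw [tedFrag, iInf_lt_iff] at hc'
    obtain ⟨⟨path, ⟨ha, hb, hch⟩, hcons⟩, hlt⟩ := hc'
    obtain ⟨W, rfl, w1, w2⟩ := pth_surj F G path 0 0 ha hb hch
    simp at w1 w2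
    subst w1 w2
    rw [pth_consistent W hF hG] at hcons
    simp only [pth_cost w (p1 W) (p2 W) W 0 0 (by simp) (by simp)] at hlt
    rw [lt_min_iff] at hlt
    have hed : ed W ≤ 2 * k := by
      have h1 := ed_le_cost w hw W (Cons_dir hcons hF hG)
      have h2 := hlt.2
      rw [ENNReal.coe_lt_coe] at h2
      have h3 : (ed W : ℝ≥0) < 2 * k + 1 := by
        calc (ed W : ℝ≥0) ≤ 2 * cost w W := h1
          _ < 2 * (k + 1/2) := by gcongr
          _ = 2 * k + 1 := by rw [mul_add]; norm_num
      have : ed W < 2 * k + 1 := by exact_mod_cast h3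
      omega
    obtain ⟨W', rfl, rfl, hc2, hle⟩ := h W rfl rfl hcons hed
    have hhd : (pth W' 0 0).head? = some (0, 0) := by
      obtain ⟨t, ht⟩ := pth_cons W' 0 0; rw [ht]; rfl
    have hlst : (pth W' 0 0).getLast? = some ((p1 W').length, (p2 W').length) := by
      rw [pth_last]; simp
    refine le_trans (iInf_le _ ⟨pth W' 0 0, ⟨hhd, hlst, pth_chain _ _ _⟩,
      (pth_consistent W' hF' hG').2 hc2⟩) ?_
    · simp only [pth_cost w (p1 W') (p2 W') W' 0 0 (by simp) (by simp)]
      exact le_trans (by exact_mod_cast hle) hlt.1.le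
  rw [if_pos (key.trans hk)]
  exact key

/-! ### Trimming common affixes -/

def dels {α : Type*} (S : List (Paren α)) : List (Op α) := S.map Op.del
def inss {α : Type*} (S : List (Paren α)) : List (Op α) := S.map Op.ins

@[simp] theorem p1_dels {α : Type*} (S : List (Paren α)) : p1 (dels S) = S := by
  induction S with
  | nil => rfl
  | cons c S ih => simpa [dels] using ih
@[simp] theorem p2_dels {α : Type*} (S : List (Paren α)) : p2 (dels S) = [] := by
  induction S with
  | nil => rfl
  | cons c S ih => simpa [dels] using ih
@[simp] theorem p1_inss {α : Type*} (S : List (Paren α)) : p1 (inss S) = [] := by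
  induction S with
  | nil => rfl
  | cons c S ih => simpa [inss] using ih
@[simp] theorem p2_inss {α : Type*} (S : List (Paren α)) : p2 (inss S) = S := by
  induction S with
  | nil => rfl
  | cons c S ih => simpa [inss] using ih

theorem dels_append {α : Type*} (S T : List (Paren α)) : dels (S ++ T) = dels S ++ dels T := by
  simp [dels]
theorem inss_append {α : Type*} (S T : List (Paren α)) : inss (S ++ T) = inss S ++ inss T := by
  simp [inss]

theorem dels_le {α : Type*} (w : Option α → Option α → ℝ≥0) (hq : Quasimetric w)
    (T : List (Op α)) : cost w (dels (p1 T)) ≤ cost w T + cost w (dels (p2 T)) := by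
  induction T with
  | nil => simp [dels, cost]
  | cons o T ih =>
    cases o with
    | del p =>
      simp only [p1_del, p2_del, dels, List.map_cons, cost] at ih ⊢
      rw [add_assoc]; gcongr
    | ins p =>
      simp only [p1_ins, p2_ins, dels, List.map_cons, cost] at ih ⊢
      refine ih.trans ?_
      rw [show ∀ a b c d : ℝ≥0, a + b + (c + d) = (b + d) + (a + c) by intros; ring]
      exact le_add_of_nonneg_right zero_le
    | sub p q =>
      simp only [p1_sub, p2_sub, dels, List.map_cons, cost] at ih ⊢
      have := hq (some p.2) (some q.2) none
      calc _ ≤ 1 / 2 * (w (some p.2) (some q.2) + w (some q.2) none) +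
            (cost w T + cost w (List.map Op.del (p2 T))) := by gcongr
        _ = _ := by ring

theorem inss_le {α : Type*} (w : Option α → Option α → ℝ≥0) (hq : Quasimetric w)
    (T : List (Op α)) : cost w (inss (p2 T)) ≤ cost w T + cost w (inss (p1 T)) := by
  induction T with
  | nil => simp [inss, cost]
  | cons o T ih =>
    cases o with
    | ins p =>
      simp only [p1_ins, p2_ins, inss, List.map_cons, cost] at ih ⊢
      rw [add_assoc]; gcongr
    | del p =>
      simp only [p1_del, p2_del, inss, List.map_cons, cost] at ih ⊢
      refine ih.trans ?_
      rw [show ∀ a b c d : ℝ≥0, a + b + (c + d) = (b + d) + (a + c) by intros; ring]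
      exact le_add_of_nonneg_right zero_le
    | sub p q =>
      simp only [p1_sub, p2_sub, inss, List.map_cons, cost] at ih ⊢
      have := hq none (some p.2) (some q.2)
      calc _ ≤ 1 / 2 * (w none (some p.2) + w (some p.2) (some q.2)) +
            (cost w T + cost w (List.map Op.ins (p1 T))) := by gcongr
        _ = _ := by ring

theorem dels_trim {α : Type*} (w : Option α → Option α → ℝ≥0) (hq : Quasimetric w)
    (T : List (Op α)) (f X : List (Paren α)) (h1 : p1 T = f ++ X ∨ p1 T = X ++ f) (h2 : p2 T = X) :
    cost w (dels f) ≤ cost w T := by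
  have := dels_le w hq T
  rcases h1 with h1 | h1
  · rw [h1, h2, dels_append, cost_append] at this
    exact le_of_add_le_add_right this
  · rw [h1, h2, dels_append, cost_append, add_comm] at this
    exact le_of_add_le_add_right this

theorem inss_trim {α : Type*} (w : Option α → Option α → ℝ≥0) (hq : Quasimetric w)
    (T : List (Op α)) (f X : List (Paren α)) (h1 : p2 T = f ++ X ∨ p2 T = X ++ f) (h2 : p1 T = X) :
    cost w (inss f) ≤ cost w T := by
  have := inss_le w hq T
  rcases h1 with h1 | h1
  · rw [h1, h2, inss_append, cost_append] at this
    exact le_of_add_le_add_right this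
  · rw [h1, h2, inss_append, cost_append, add_comm] at this
    exact le_of_add_le_add_right this

theorem trim_pre {α : Type*} (W : List (Op α)) (f g X : List (Paren α))
    (h1 : p1 W = f ++ X) (h2 : p2 W = g ++ X) :
    ∃ V, p1 V = f ∧ p2 V = g ∧ (∀ x y, x < f.length → y < g.length → (Al V x y ↔ Al W x y)) ∧
      ∀ w, Quasimetric w → cost w V ≤ cost w W := by
  induction W generalizing f g with
  | nil =>
    simp at h1 h2
    obtain ⟨rfl, rfl⟩ := h1; obtain ⟨rfl, -⟩ := h2
    exact ⟨[], rfl, rfl, by simp, by simp [cost]⟩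
  | cons o W ih =>
    rcases f with _ | ⟨c, f⟩
    · exact ⟨inss g, by simp, by simp, by simp,
        fun w hq => inss_trim w hq _ g X (Or.inl h2) (by simpa using h1)⟩
    rcases g with _ | ⟨d, g⟩
    · exact ⟨dels (c :: f), by simp, by simp, by simp,
        fun w hq => dels_trim w hq _ (c :: f) X (Or.inl h1) (by simpa using h2)⟩
    cases o with
    | del p =>
      simp only [p1_del, p2_del, List.cons_append, List.cons.injEq] at h1 h2
      obtain ⟨rfl, h1⟩ := h1
      obtain ⟨V, v1, v2, v3, v4⟩ := ih f (d :: g) h1 h2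
      refine ⟨Op.del p :: V, by simp [v1], by simp [v2], ?_, fun w hq => ?_⟩
      · intro x y hx hy
        simp only [Al]
        cases x with
        | zero => simp
        | succ x => simpa using v3 x y (by simpa using hx) hy
      · simp only [cost]; gcongr; exact v4 w hq
    | ins p =>
      simp only [p1_ins, p2_ins, List.cons_append, List.cons.injEq] at h1 h2
      obtain ⟨rfl, h2⟩ := h2
      obtain ⟨V, v1, v2, v3, v4⟩ := ih (c :: f) g h1 h2
      refine ⟨Op.ins p :: V, by simp [v1], by simp [v2], ?_, fun w hq => ?_⟩
      · intro x y hx hy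
        simp only [Al]
        cases y with
        | zero => simp
        | succ y => simpa using v3 x y hx (by simpa using hy)
      · simp only [cost]; gcongr; exact v4 w hq
    | sub p q =>
      simp only [p1_sub, p2_sub, List.cons_append, List.cons.injEq] at h1 h2
      obtain ⟨rfl, h1⟩ := h1
      obtain ⟨rfl, h2⟩ := h2
      obtain ⟨V, v1, v2, v3, v4⟩ := ih f g h1 h2
      refine ⟨Op.sub p q :: V, by simp [v1], by simp [v2], ?_, fun w hq => ?_⟩
      · intro x y hx hy
        simp only [Al]
        rcases x with _ | x <;> rcases y with _ | y <;> simp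
        exact v3 x y (by simpa using hx) (by simpa using hy)
      · simp only [cost]; gcongr; exact v4 w hq

theorem list_snoc {β : Type*} (l : List β) : l = [] ∨ ∃ t c, l = t ++ [c] := by
  rcases List.eq_nil_or_concat l with h | ⟨t, c, h⟩
  · exact Or.inl h
  · exact Or.inr ⟨t, c, by simpa using h⟩

theorem trim_suf {α : Type*} (W : List (Op α)) (f g X : List (Paren α))
    (h1 : p1 W = X ++ f) (h2 : p2 W = X ++ g) :
    ∃ V, p1 V = f ∧ p2 V = g ∧
      (∀ x y, x < f.length → y < g.length → (Al V x y ↔ Al W (X.length + x) (X.length + y))) ∧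
      ∀ w, Quasimetric w → cost w V ≤ cost w W := by
  induction W using List.reverseRecOn generalizing f g with
  | nil =>
    simp at h1 h2
    obtain ⟨rfl, rfl⟩ := h1; obtain ⟨-, rfl⟩ := h2
    exact ⟨[], rfl, rfl, by simp, by simp [cost]⟩
  | append_singleton W o ih =>
    rcases list_snoc f with rfl | ⟨f, c, rfl⟩
    · exact ⟨inss g, by simp, by simp, by simp,
        fun w hq => inss_trim w hq _ g X (Or.inr h2) (by simpa using h1)⟩
    rcases list_snoc g with rfl | ⟨g, d, rfl⟩
    · exact ⟨dels (f ++ [c]), by simp, by simp, by simp,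
        fun w hq => dels_trim w hq _ (f ++ [c]) X (Or.inr h1) (by simpa using h2)⟩
    cases o with
    | del p =>
      simp only [p1_append, p2_append, p1_del, p2_del, p1_nil, p2_nil, List.append_nil,
        ← List.append_assoc] at h1 h2
      have hc := (List.append_inj' h1 rfl).2
      replace h1 := (List.append_inj' h1 rfl).1
      obtain rfl : p = c := by simpa using hc
      obtain ⟨V, v1, v2, v3, v4⟩ := ih f (g ++ [d]) h1 (by rw [h2, List.append_assoc])
      refine ⟨V ++ [Op.del p], by simp [v1], by simp [v2], ?_, fun w hq => ?_⟩
      · intro x y hx hy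
        simp only [Al_append, Al, and_false, exists_false, or_false]
        by_cases hx' : x < f.length
        · exact v3 x y hx' hy
        · constructor
          · intro h; have := (Al_lt h).1; rw [v1] at this; omega
          · intro h; have := (Al_lt h).1; rw [h1] at this; simp at this; omega
      · rw [cost_append, cost_append]; gcongr; exact v4 w hq
    | ins p =>
      simp only [p1_append, p2_append, p1_ins, p2_ins, p1_nil, p2_nil, List.append_nil,
        ← List.append_assoc] at h1 h2
      have hc := (List.append_inj' h2 rfl).2
      replace h2 := (List.append_inj' h2 rfl).1
      obtain rfl : p = d := by simpa using hc
      obtain ⟨V, v1, v2, v3, v4⟩ := ih (f ++ [c]) g (by rw [h1, List.append_assoc]) h2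
      refine ⟨V ++ [Op.ins p], by simp [v1], by simp [v2], ?_, fun w hq => ?_⟩
      · intro x y hx hy
        simp only [Al_append, Al, and_false, exists_false, or_false]
        by_cases hy' : y < g.length
        · exact v3 x y hx hy'
        · constructor
          · intro h; have := (Al_lt h).2; rw [v2] at this; omega
          · intro h; have := (Al_lt h).2; rw [h2] at this; simp at this; omega
      · rw [cost_append, cost_append]; gcongr; exact v4 w hq
    | sub p q =>
      simp only [p1_append, p2_append, p1_sub, p2_sub, p1_nil, p2_nil,
        ← List.append_assoc] at h1 h2
      have hc := (List.append_inj' h1 rfl).2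
      replace h1 := (List.append_inj' h1 rfl).1
      have hd := (List.append_inj' h2 rfl).2
      replace h2 := (List.append_inj' h2 rfl).1
      obtain rfl : p = c := by simpa using hc
      obtain rfl : q = d := by simpa using hd
      obtain ⟨V, v1, v2, v3, v4⟩ := ih f g h1 h2
      refine ⟨V ++ [Op.sub p q], by simp [v1], by simp [v2], ?_, fun w hq => ?_⟩
      · intro x y hx hy
        simp only [Al_append, Al, and_false, exists_false, or_false, v1, v2, h1, h2,
          List.length_append]
        simp only [List.length_append, List.length_singleton] at hx hy
        constructor
        · rintro (h | ⟨x', y', rfl, rfl, rfl, rfl⟩)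
          · have := Al_lt h; rw [v1, v2] at this
            exact Or.inl ((v3 _ _ this.1 this.2).1 h)
          · exact Or.inr ⟨0, 0, by omega, by omega, rfl, rfl⟩
        · rintro (h | ⟨x', y', e1, e2, rfl, rfl⟩)
          · have := Al_lt h; rw [h1, h2] at this; simp at this
            exact Or.inl ((v3 _ _ this.1 this.2).2 h)
          · exact Or.inr ⟨0, 0, by omega, by omega, rfl, rfl⟩
      · rw [cost_append, cost_append]; gcongr; exact v4 w hq

/-! ### Replacing an identified context -/

theorem eq_nil_of_proj {α : Type*} (c : List (Op α)) (h1 : (p1 c).length = 0)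
    (h2 : (p2 c).length = 0) : c = [] := by
  cases c with
  | nil => rfl
  | cons o c => cases o <;> simp at h1 h2

theorem replace2 {α : Type*} (W : List (Op α)) (f0 s f1 s' f2 g0 g1 g2 : List (Paren α))
    (h1 : p1 W = f0 ++ s ++ f1 ++ s' ++ f2) (h2 : p2 W = g0 ++ s ++ g1 ++ s' ++ g2)
    (hc : Cons W) (hF : IsForest (p1 W)) (hG : IsForest (p2 W)) (hf1 : IsForest f1)
    (hg1 : IsForest g1) (hs : IsForest (s ++ s')) (y y' : ℕ) (hy : y ≤ s.length)
    (hv : Vx W (f0.length + y) (g0.length + y)) (hy' : y' ≤ s'.length)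
    (hv' : Vx W (f0.length + s.length + f1.length + y') (g0.length + s.length + g1.length + y'))
    (r r' : List (Paren α)) (hr : IsForest (r ++ r')) :
    ∃ W', p1 W' = f0 ++ r ++ f1 ++ r' ++ f2 ∧ p2 W' = g0 ++ r ++ g1 ++ r' ++ g2 ∧ Cons W' ∧
      ∀ w, Normalized w → Quasimetric w → cost w W' ≤ cost w W := by
  have hsplit : ∃ W1 W2 W3, W = W1 ++ W2 ++ W3 ∧ (p1 W1).length = f0.length + y ∧
      (p2 W1).length = g0.length + y ∧
      (p1 (W1 ++ W2)).length = f0.length + s.length + f1.length + y' ∧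
      (p2 (W1 ++ W2)).length = g0.length + s.length + g1.length + y' := by
    obtain ⟨A, B, rfl, a1, a2⟩ := hv
    obtain ⟨A', B', e, b1, b2⟩ := hv'
    rcases List.append_eq_append_iff.1 e with ⟨c, rfl, rfl⟩ | ⟨c, rfl, rfl⟩
    · exact ⟨A, c, B', by simp, a1, a2, b1, b2⟩
    · simp at a1 a2
      obtain rfl := eq_nil_of_proj c (by omega) (by omega)
      simp at a1 a2
      exact ⟨A', [], B, by simp, by omega, by omega, by simp; omega, by simp; omega⟩
  obtain ⟨W1, W2, W3, rfl, l1, l2, l3, l4⟩ := hsplit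
  obtain ⟨sa, sb, rfl, rfl⟩ : ∃ sa sb, s = sa ++ sb ∧ sa.length = y :=
    ⟨s.take y, s.drop y, by simp, by simp [hy]⟩
  obtain ⟨ta, tb, rfl, rfl⟩ : ∃ sa sb, s' = sa ++ sb ∧ sa.length = y' :=
    ⟨s'.take y', s'.drop y', by simp, by simp [hy']⟩
  simp only [p1_append, p2_append, List.length_append] at l1 l2 l3 l4
  have e1 : p1 W1 = f0 ++ sa ∧ p1 W2 = sb ++ (f1 ++ ta) ∧ p1 W3 = tb ++ f2 := by
    have : (p1 W1 ++ p1 W2) ++ p1 W3 = ((f0 ++ sa) ++ (sb ++ (f1 ++ ta))) ++ (tb ++ f2) := by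
      simpa using h1
    obtain ⟨e, e3⟩ := List.append_inj this (by simp; omega)
    obtain ⟨e1, e2⟩ := List.append_inj e (by simp; omega)
    exact ⟨e1, e2, e3⟩
  have e2 : p2 W1 = g0 ++ sa ∧ p2 W2 = sb ++ (g1 ++ ta) ∧ p2 W3 = tb ++ g2 := by
    have : (p2 W1 ++ p2 W2) ++ p2 W3 = ((g0 ++ sa) ++ (sb ++ (g1 ++ ta))) ++ (tb ++ g2) := by
      simpa using h2
    obtain ⟨e, e3⟩ := List.append_inj this (by simp; omega)
    obtain ⟨e1, e2⟩ := List.append_inj e (by simp; omega)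
    exact ⟨e1, e2, e3⟩
  obtain ⟨V0, a1, a2, a3, a4⟩ := trim_pre W1 f0 g0 sa e1.1 e2.1
  obtain ⟨V1', b1, b2, b3, b4⟩ := trim_suf W2 (f1 ++ ta) (g1 ++ ta) sb e1.2.1 e2.2.1
  obtain ⟨V1, c1, c2, c3, c4⟩ := trim_pre V1' f1 g1 ta b1 b2
  obtain ⟨V2, d1, d2, d3, d4⟩ := trim_suf W3 f2 g2 tb e1.2.2 e2.2.2
  have m1 : IsForest ((sa ++ sb) ++ f1 ++ (ta ++ tb)) := (forest_cancel _ _ _ hf1).2 hs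
  have m2 : IsForest ((sa ++ sb) ++ g1 ++ (ta ++ tb)) := (forest_cancel _ _ _ hg1).2 hs
  have hC1 : Cons V1 := by
    have key : ∀ x y, x < f1.length → y < g1.length → (Al V1 x y ↔
        Al (W1 ++ W2 ++ W3) ((f0 ++ (sa ++ sb)).length + x) ((g0 ++ (sa ++ sb)).length + y)) := by
      intro x y hx hy
      rw [c3 x y hx hy, b3 x y (by simp; omega) (by simp; omega),
        ← Al_mid W1 W2 W3 _ _ (by rw [e1.2.1]; simp; omega), e1.1, e2.1]
      simp [add_assoc]
    intro x y x' y' hA hx hy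
    rw [c1] at hx; rw [c2] at hy
    rw [key _ _ (Mt_lt hx).2 (Mt_lt hy).2]
    rw [key _ _ (Mt_lt hx).1 (Mt_lt hy).1] at hA
    refine hc _ _ _ _ hA ?_ ?_
    · rw [h1, List.append_assoc _ (ta ++ tb)]; exact Mt_mid _ _ _ _ _ hx
    · rw [h2, List.append_assoc _ (ta ++ tb)]; exact Mt_mid _ _ _ _ _ hy
  have hC02 : Cons (V0 ++ V2) := by
    have key : ∀ x y, x < (f0 ++ f2).length → y < (g0 ++ g2).length → (Al (V0 ++ V2) x y ↔
        Al (W1 ++ W2 ++ W3) (emb f0.length ((sa ++ sb) ++ f1 ++ (ta ++ tb)).length x)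
          (emb g0.length ((sa ++ sb) ++ g1 ++ (ta ++ tb)).length y)) := by
      intro x y hx hy
      simp only [List.length_append] at hx hy
      simp only [Al_append, List.append_assoc, e1, e2, a1, a2, List.length_append]
      constructor
      · rintro (h | ⟨u, v, rfl, rfl, h⟩)
        · have hl := Al_lt h
          rw [a1, a2] at hl
          left
          rw [emb, emb, if_pos hl.1, if_pos hl.2, ← a3 _ _ hl.1 hl.2]; exact h
        · have hl := Al_lt h
          rw [d1, d2] at hl
          right
          rw [emb, emb, if_neg (by omega), if_neg (by omega)]
          refine ⟨sb.length + f1.length + ta.length + tb.length + u,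
            sb.length + g1.length + ta.length + tb.length + v, by omega, by omega, Or.inr
            ⟨tb.length + u, tb.length + v, by omega, by omega, ?_⟩⟩
          rw [← d3 _ _ hl.1 hl.2]; exact h
      · unfold emb
        rintro (h | ⟨u, v, hu, hv, h | ⟨u', v', rfl, rfl, h⟩⟩)
        · have hl := Al_lt h
          rw [e1.1, e2.1] at hl
          simp only [List.length_append] at hl
          have hx0 : x < f0.length := by by_contra hn; rw [if_neg hn] at hl; omega
          have hy0 : y < g0.length := by by_contra hn; rw [if_neg hn] at hl; omega
          rw [if_pos hx0, if_pos hy0, ← a3 _ _ hx0 hy0] at h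
          exact Or.inl h
        · exfalso
          have hl := Al_lt h
          rw [e1.2.1, e2.2.1] at hl
          simp only [List.length_append] at hl
          split_ifs at hu <;> omega
        · right
          have hl := Al_lt h
          rw [e1.2.2, e2.2.2] at hl
          simp only [List.length_append] at hl
          have hx0 : ¬ x < f0.length := by intro hn; rw [if_pos hn] at hu; omega
          have hy0 : ¬ y < g0.length := by intro hn; rw [if_pos hn] at hv; omega
          rw [if_neg hx0] at hu
          rw [if_neg hy0] at hv
          refine ⟨x - f0.length, y - g0.length, by omega, by omega, ?_⟩
          rw [d3 _ _ (by omega) (by omega)]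
          convert h using 1 <;> omega
    intro x y x' y' hA hx hy
    rw [p1_append, a1, d1] at hx; rw [p2_append, a2, d2] at hy
    rw [key _ _ (Mt_lt hx).2 (Mt_lt hy).2]
    rw [key _ _ (Mt_lt hx).1 (Mt_lt hy).1] at hA
    refine hc _ _ _ _ hA ?_ ?_
    · rw [h1]
      have := Mt_emb f0 _ f2 m1 _ _ hx
      simpa only [List.append_assoc] using this
    · rw [h2]
      have := Mt_emb g0 _ g2 m2 _ _ hy
      simpa only [List.append_assoc] using this
  have hids : ids r ++ ids r' = ids (r ++ r') := by simp [ids]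
  have hM : Cons (ids r ++ V1 ++ ids r') := by
    apply paste _ _ _ (by rwa [c1]) (by rwa [c2]) _ _ _ hC1
    · rw [hids, p1_ids]; exact hr
    · rw [hids, p2_ids]; exact hr
    · rw [hids]; exact Cons_ids _
  refine ⟨V0 ++ (ids r ++ V1 ++ ids r') ++ V2, ?_, ?_, ?_, ?_⟩
  · simp [a1, c1, d1]
  · simp [a2, c2, d2]
  · apply paste _ _ _ _ _ _ _ hC02 hM
    · simp only [p1_append, p1_ids, c1]; exact (forest_cancel _ _ _ hf1).2 hr
    · simp only [p2_append, p2_ids, c2]; exact (forest_cancel _ _ _ hg1).2 hr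
    · rw [p1_append, a1, d1, ← forest_cancel _ _ _ m1]
      rw [h1] at hF; simpa using hF
    · rw [p2_append, a2, d2, ← forest_cancel _ _ _ m2]
      rw [h2] at hG; simpa using hG
  · intro w hw hq
    simp only [cost_append, cost_ids w hw]
    have := a4 w hq
    have := (c4 w hq).trans (b4 w hq)
    have := d4 w hq
    simp only [zero_add, add_zero]
    gcongr

theorem replace1 {α : Type*} (W : List (Op α)) (f0 D f2 g0 g2 : List (Paren α))
    (h1 : p1 W = f0 ++ D ++ f2) (h2 : p2 W = g0 ++ D ++ g2)
    (hc : Cons W) (hF : IsForest (p1 W)) (hG : IsForest (p2 W)) (hD : IsForest D) (y : ℕ)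
    (hy : y ≤ D.length) (hv : Vx W (f0.length + y) (g0.length + y))
    (r : List (Paren α)) (hr : IsForest r) :
    ∃ W', p1 W' = f0 ++ r ++ f2 ∧ p2 W' = g0 ++ r ++ g2 ∧ Cons W' ∧
      ∀ w, Normalized w → Quasimetric w → cost w W' ≤ cost w W := by
  have hl : (D.take y).length = y := by simp [hy]
  have := replace2 W f0 (D.take y) [] (D.drop y) f2 g0 [] g2 (by simp [h1]) (by simp [h2]) hc hF hG
    IsForest.nil IsForest.nil (by simpa using hD) y 0 (by omega) hv (by omega)
    (by rw [hl]; simpa using hv) r [] (by simpa using hr)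
  simpa using this

/-- One-sided reduction between contexts. -/
def Redu {α : Type*} (k : ℕ) (PL PR PL' PR' : List (Paren α)) : Prop :=
  ∀ (F0 Fm F1 G0 Gm G1 : List (Paren α)) (W : List (Op α)),
    p1 W = F0 ++ PL ++ Fm ++ PR ++ F1 → p2 W = G0 ++ PL ++ Gm ++ PR ++ G1 →
    IsForest (p1 W) → IsForest (p2 W) → IsForest Fm → IsForest Gm →
    F0.length ≤ G0.length + 2 * k → G0.length ≤ F0.length + 2 * k →
    F0.length + Fm.length ≤ G0.length + Gm.length + 2 * k →
    G0.length + Gm.length ≤ F0.length + Fm.length + 2 * k →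
    Cons W → ed W ≤ 2 * k →
    ∃ W', p1 W' = F0 ++ PL' ++ Fm ++ PR' ++ F1 ∧ p2 W' = G0 ++ PL' ++ Gm ++ PR' ++ G1 ∧ Cons W' ∧
      ∀ w, Normalized w → Quasimetric w → cost w W' ≤ cost w W

def Equi {α : Type*} (k : ℕ) (PL PR PL' PR' : List (Paren α)) : Prop :=
  ∀ w : Option α → Option α → ℝ≥0, Normalized w → Quasimetric w → ContextEquiv k w PL PR PL' PR'

theorem IsContext.forest {α : Type*} {PL PR : List (Paren α)} (h : IsContext PL PR) :
    IsForest (PL ++ PR) := by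
  obtain ⟨-, -, a, F, hF, e⟩ := h
  rw [e]; exact IsForest.wrap a hF

theorem swap_forest {α : Type*} {F0 PL PR PL' PR' Fm F1 : List (Paren α)} (h : IsForest (PL ++ PR))
    (h' : IsForest (PL' ++ PR')) (hm : IsForest Fm) (hF : IsForest (F0 ++ PL ++ Fm ++ PR ++ F1)) :
    IsForest (F0 ++ PL' ++ Fm ++ PR' ++ F1) := by
  have e : ∀ a b : List (Paren α), F0 ++ a ++ Fm ++ b ++ F1 = F0 ++ (a ++ Fm ++ b) ++ F1 := by simp
  rw [e, forest_cancel _ _ _ ((forest_cancel _ _ _ hm).2 h)] at hF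
  rw [e, forest_cancel _ _ _ ((forest_cancel _ _ _ hm).2 h')]
  exact hF

theorem Equi_of_Redu {α : Type*} {k : ℕ} {PL PR PL' PR' : List (Paren α)}
    (hP : IsForest (PL ++ PR)) (hP' : IsForest (PL' ++ PR'))
    (h1 : Redu k PL PR PL' PR') (h2 : Redu k PL' PR' PL PR) : Equi k PL PR PL' PR' := by
  intro w hw hq F0 Fm F1 G0 Gm G1 hF hG hFm hGm a b c d
  have hF' := swap_forest hP hP' hFm hF
  have hG' := swap_forest hP hP' hGm hG
  apply le_antisymm
  · apply tedLE_le k w hw _ _ _ _ hF' hG' hF hG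
    intro W w1 w2 hc he
    obtain ⟨W', x1, x2, x3, x4⟩ := h2 F0 Fm F1 G0 Gm G1 W w1 w2 (by rwa [w1]) (by rwa [w2]) hFm hGm
      a b c d hc he
    exact ⟨W', x1, x2, x3, x4 w hw hq⟩
  · apply tedLE_le k w hw _ _ _ _ hF hG hF' hG'
    intro W w1 w2 hc he
    obtain ⟨W', x1, x2, x3, x4⟩ := h1 F0 Fm F1 G0 Gm G1 W w1 w2 (by rwa [w1]) (by rwa [w2]) hFm hGm
      a b c d hc he
    exact ⟨W', x1, x2, x3, x4 w hw hq⟩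

theorem Equi_refl {α : Type*} (k : ℕ) (PL PR : List (Paren α)) : Equi k PL PR PL PR := by
  intro w _ _ F0 Fm F1 G0 Gm G1 _ _ _ _ _ _ _ _
  rfl

theorem Equi_trans {α : Type*} {k : ℕ} {PL PR PL' PR' PL'' PR'' : List (Paren α)}
    (hP : IsForest (PL ++ PR)) (hP' : IsForest (PL' ++ PR'))
    (h1 : Equi k PL PR PL' PR') (h2 : Equi k PL' PR' PL'' PR'') : Equi k PL PR PL'' PR'' := by
  intro w hw hq F0 Fm F1 G0 Gm G1 hF hG hFm hGm a b c d
  rw [h1 w hw hq F0 Fm F1 G0 Gm G1 hF hG hFm hGm a b c d]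
  exact h2 w hw hq F0 Fm F1 G0 Gm G1 (swap_forest hP hP' hFm hF) (swap_forest hP hP' hGm hG)
    hFm hGm a b c d

/-! ### Crossing lemmas -/

theorem ivt_up {α : Type*} (M : List (Op α)) (d : ℤ) (h0 : d ≤ 0)
    (h1 : 0 ≤ d + (p2 M).length - (p1 M).length) :
    ∃ M1 M2, M = M1 ++ M2 ∧ d + (p2 M1).length - (p1 M1).length = 0 := by
  induction M generalizing d with
  | nil => exact ⟨[], [], rfl, by simp at h1 ⊢; omega⟩
  | cons o M ih =>
    by_cases hd : d = 0
    · exact ⟨[], o :: M, rfl, by simp [hd]⟩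
    cases o with
    | del p =>
      obtain ⟨M1, M2, rfl, h⟩ := ih (d - 1) (by omega) (by simp at h1; omega)
      exact ⟨Op.del p :: M1, M2, rfl, by simp; omega⟩
    | ins p =>
      obtain ⟨M1, M2, rfl, h⟩ := ih (d + 1) (by omega) (by simp at h1; omega)
      exact ⟨Op.ins p :: M1, M2, rfl, by simp; omega⟩
    | sub p q =>
      obtain ⟨M1, M2, rfl, h⟩ := ih d (by omega) (by simp at h1; omega)
      exact ⟨Op.sub p q :: M1, M2, rfl, by simp; omega⟩

theorem ivt_dn {α : Type*} (M : List (Op α)) (d : ℤ) (h0 : 0 ≤ d)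
    (h1 : d + (p2 M).length - (p1 M).length ≤ 0) :
    ∃ M1 M2, M = M1 ++ M2 ∧ d + (p2 M1).length - (p1 M1).length = 0 := by
  induction M generalizing d with
  | nil => exact ⟨[], [], rfl, by simp at h1 ⊢; omega⟩
  | cons o M ih =>
    by_cases hd : d = 0
    · exact ⟨[], o :: M, rfl, by simp [hd]⟩
    cases o with
    | del p =>
      obtain ⟨M1, M2, rfl, h⟩ := ih (d - 1) (by omega) (by simp at h1; omega)
      exact ⟨Op.del p :: M1, M2, rfl, by simp; omega⟩
    | ins p =>
      obtain ⟨M1, M2, rfl, h⟩ := ih (d + 1) (by omega) (by simp at h1; omega)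
      exact ⟨Op.ins p :: M1, M2, rfl, by simp; omega⟩
    | sub p q =>
      obtain ⟨M1, M2, rfl, h⟩ := ih d (by omega) (by simp at h1; omega)
      exact ⟨Op.sub p q :: M1, M2, rfl, by simp; omega⟩

theorem cross_aux {α : Type*} {A M B : List (Op α)} {f0 g0 x x2 x' x2' N : ℕ}
    (a1 : (p1 A).length = f0 + x) (a2 : (p2 A).length = g0 + x2)
    (b1 : (p1 (A ++ M)).length = f0 + x') (b2 : (p2 (A ++ M)).length = g0 + x2')
    (hs : (x ≤ x2 ∧ x2' ≤ x') ∨ (x2 ≤ x ∧ x' ≤ x2')) (hx' : x' ≤ N) :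
    ∃ y, y ≤ N ∧ Vx (A ++ M ++ B) (f0 + y) (g0 + y) := by
  simp at b1 b2
  have : ∃ M1 M2, M = M1 ++ M2 ∧ ((x2 : ℤ) - x) + (p2 M1).length - (p1 M1).length = 0 := by
    rcases hs with hs | hs
    · exact ivt_dn M _ (by omega) (by omega)
    · exact ivt_up M _ (by omega) (by omega)
  obtain ⟨M1, M2, rfl, h⟩ := this
  simp at b1 b2
  exact ⟨x + (p1 M1).length, by omega, A ++ M1, M2 ++ B, by simp, by simp; omega, by simp; omega⟩

theorem cross_of {α : Type*} {W : List (Op α)} {f0 g0 x x2 x' x2' N : ℕ}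
    (h : Vx W (f0 + x) (g0 + x2)) (h' : Vx W (f0 + x') (g0 + x2'))
    (hs : (x ≤ x2 ∧ x2' ≤ x') ∨ (x2 ≤ x ∧ x' ≤ x2')) (hx : x ≤ N) (hx' : x' ≤ N) :
    ∃ y, y ≤ N ∧ Vx W (f0 + y) (g0 + y) := by
  obtain ⟨A, B, rfl, a1, a2⟩ := h
  obtain ⟨A', B', e, b1, b2⟩ := h'
  rcases List.append_eq_append_iff.1 e with ⟨c, rfl, rfl⟩ | ⟨c, rfl, rfl⟩
  · rw [← List.append_assoc]
    exact cross_aux a1 a2 b1 b2 hs hx'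
  · exact cross_aux b1 b2 a1 a2 (by omega) hx

/-- A forest always crossed by cheap alignments. -/
def XGood {α : Type*} (k : ℕ) (D : List (Paren α)) : Prop :=
  ∀ (f0 f2 g0 g2 : List (Paren α)) (W : List (Op α)), p1 W = f0 ++ D ++ f2 →
    p2 W = g0 ++ D ++ g2 → IsForest (p1 W) → IsForest (p2 W) → Cons W → ed W ≤ 2 * k →
    f0.length ≤ g0.length + 2 * k → g0.length ≤ f0.length + 2 * k →
    ∃ y, y ≤ D.length ∧ Vx W (f0.length + y) (g0.length + y)

theorem pigeon (c : ℕ → ℕ) (hc : ∀ m n, m ≤ n → c m ≤ c n) (n : ℕ) (hn : ∀ m, c m < n)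
    (a b : ℕ → ℕ) (hab : ∀ i, i < n → a i ≤ b i) (hba : ∀ i, i + 1 < n → b i ≤ a (i + 1)) :
    ∃ i, i < n ∧ c (a i) = c (b i) := by
  by_contra hcon
  push Not at hcon
  have key : ∀ i, i < n → i + 1 ≤ c (b i) := by
    intro i
    induction i with
    | zero => intro h; have := hcon 0 h; have := hc _ _ (hab 0 h); omega
    | succ i ih =>
      intro h
      have := ih (by omega)
      have := hc _ _ (hba i h)
      have := hcon _ h
      have := hc _ _ (hab _ h)
      omega
  rcases n with _ | n
  · exact absurd (hn 0) (by omega)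
  · have := key n (by omega); have := hn (b n); omega

/-- Crossing from a nested pair of mates in `D`. -/
theorem cross_mates {α : Type*} {W : List (Op α)} {f0 f2 g0 g2 D : List (Paren α)}
    (h1 : p1 W = f0 ++ D ++ f2) (h2 : p2 W = g0 ++ D ++ g2) (hc : Cons W) {x x2 x' x2' : ℕ}
    (hA : Al W (f0.length + x) (g0.length + x2)) (hx : Mt D x x') (hx2 : Mt D x2 x2')
    (hs : (x ≤ x2 ∧ x2' ≤ x') ∨ (x2 ≤ x ∧ x' ≤ x2')) :
    ∃ y, y ≤ D.length ∧ Vx W (f0.length + y) (g0.length + y) := by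
  have hA' := hc _ _ _ _ hA (by rw [h1]; exact Mt_mid _ _ _ _ _ hx)
    (by rw [h2]; exact Mt_mid _ _ _ _ _ hx2)
  exact cross_of (Vx_of_Al hA).1 (Vx_of_Al hA').1 hs (Mt_lt hx).1.le (Mt_lt hx).2.le

def chn {α : Type*} (a : α) (N : ℕ) : List (Paren α) :=
  List.replicate N (true, a) ++ List.replicate N (false, a)

theorem chn_forest {α : Type*} (a : α) (N : ℕ) : IsForest (chn a N) := by
  induction N with
  | zero => exact IsForest.nil
  | succ N ih =>
    have := IsForest.wrap a ih
    simpa [chn, List.replicate_succ, List.replicate_succ'.symm] using this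

theorem ht_rep {α : Type*} (c : Paren α) (n : ℕ) : ht (List.replicate n c) = n * sg c := by
  induction n with
  | zero => simp
  | succ n ih => simp [List.replicate_succ, ih]; ring

theorem HH_chn {α : Type*} (a : α) (N n : ℕ) :
    (n ≤ N → HH (chn a N) n = n) ∧ (N ≤ n → n ≤ 2 * N → HH (chn a N) n = 2 * N - n) := by
  constructor
  · intro h
    rw [chn, HH_app_left _ _ _ (by simpa using h), HH, List.take_replicate, ht_rep]
    simp [h]
  · intro h h'
    rw [chn, HH_app_ge _ _ _ (by simpa using h), HH, List.take_replicate, ht_rep, ht_rep]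
    simp only [List.length_replicate, sg_true, sg_false]
    rw [min_eq_left (by omega)]
    push_cast [h]; ring

theorem Nd_chn {α : Type*} (a : α) (N t : ℕ) (h : t < N) : Nd (chn a N) t (2 * N - 1 - t) := by
  refine ⟨by omega, by simp [chn]; omega, ?_, ?_⟩
  · rw [(HH_chn a N t).1 (by omega), (HH_chn a N _).2 (by omega) (by omega)]; omega
  · intro l h1 h2
    rw [(HH_chn a N t).1 (by omega)]
    by_cases hl : l ≤ N
    · rw [(HH_chn a N l).1 hl]; omega
    · rw [(HH_chn a N l).2 (by omega) (by omega)]; omega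

theorem chn_len {α : Type*} (a : α) (N : ℕ) : (chn a N).length = 2 * N := by simp [chn]; omega

theorem get_mid {β : Type*} (u S v : List β) (i : ℕ) (h : i < S.length) :
    (u ++ S ++ v)[u.length + i]? = S[i]? := by
  rw [List.append_assoc, List.getElem?_append_right (by omega), List.getElem?_append_left (by omega)]
  simp

/-- Alignment facts for a clean segment. -/
theorem clean_al {α : Type*} {W : List (Op α)} {a b : ℕ} (hab : a ≤ b) (hb : b ≤ (p1 W).length)
    (h : cum W a = cum W b) :
    ∃ q, Vx W a q ∧ Vx W b (q + (b - a)) ∧ (∀ i, i < b - a → Al W (a + i) (q + i)) ∧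
      (∀ i, i < b - a → (p1 W)[a + i]? = (p2 W)[q + i]?) := by
  obtain ⟨W1, S, W2, rfl, e, hS⟩ := cum_clean W a b hab hb h
  refine ⟨(p2 W1).length, ⟨W1, ids S ++ W2, by simp, e, rfl⟩,
    ⟨W1 ++ ids S, W2, by simp, by simp; omega, by simp; omega⟩, ?_, ?_⟩
  · intro i hi
    rw [← e, Al_mid _ _ _ _ _ (by simp; omega), Al_ids]; exact ⟨rfl, by omega⟩
  · intro i hi
    simp only [p1_append, p2_append, p1_ids, p2_ids]
    rw [← e, get_mid _ _ _ _ (by omega),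
      get_mid _ _ _ _ (by omega)]

theorem chn_XGood {α : Type*} (k : ℕ) (a : α) : XGood k (chn a (10 * k + 1)) := by
  intro f0 f2 g0 g2 W h1 h2 hF hG hc he ha hb
  have hl1 : (p1 W).length = f0.length + 2 * (10 * k + 1) + f2.length := by
    rw [h1]; simp [chn_len]; omega
  obtain ⟨i, hi, hcl⟩ := pigeon (cum W) (fun m n h => cum_mono W h) (2 * k + 1)
    (fun m => by have := cum_le W m; omega) (fun i => f0.length + 4 * k + i)
    (fun i => f0.length + 4 * k + i + 1) (by intros; omega) (by intros; omega)
  obtain ⟨q, hq, -, hA, -⟩ := clean_al (by omega) (by omega) hcl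
  have hA := hA 0 (by omega)
  have := Vx_width hq
  rw [show f0.length + 4 * k + i + 0 = f0.length + (4 * k + i) by omega,
    show q + 0 = g0.length + (q - g0.length) by omega] at hA
  refine cross_mates h1 h2 hc hA (Or.inl (Nd_chn _ _ _ (by omega))) (Or.inl (Nd_chn _ _ _ (by omega))) ?_
  omega

/-! ### Periodic stretches -/

theorem exists_last_min (f : ℕ → ℤ) (lo hi : ℕ) (h : lo ≤ hi) :
    ∃ m, lo ≤ m ∧ m ≤ hi ∧ (∀ y, lo ≤ y → y ≤ hi → f m ≤ f y) ∧ ∀ y, m < y → y ≤ hi → f m < f y := by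
  induction hi, h using Nat.le_induction with
  | base => exact ⟨lo, le_rfl, le_rfl, fun y h1 h2 => by rw [le_antisymm h2 h1], fun y h1 h2 => by omega⟩
  | succ hi h ih =>
    obtain ⟨m, a, b, c, d⟩ := ih
    by_cases hm : f (hi + 1) ≤ f m
    · refine ⟨hi + 1, by omega, le_rfl, fun y h1 h2 => ?_, fun y h1 h2 => by omega⟩
      rcases Nat.lt_or_ge hi y with h3 | h3
      · rw [show y = hi + 1 by omega]
      · exact hm.trans (c y h1 h3)
    · refine ⟨m, a, by omega, fun y h1 h2 => ?_, fun y h1 h2 => ?_⟩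
      · rcases Nat.lt_or_ge hi y with h3 | h3
        · rw [show y = hi + 1 by omega]; omega
        · exact c y h1 h3
      · rcases Nat.lt_or_ge hi y with h3 | h3
        · rw [show y = hi + 1 by omega]; omega
        · exact d y h1 h3

theorem exists_first_min (f : ℕ → ℤ) (lo hi : ℕ) (h : lo ≤ hi) :
    ∃ m, lo ≤ m ∧ m ≤ hi ∧ (∀ y, lo ≤ y → y ≤ hi → f m ≤ f y) ∧ ∀ y, lo ≤ y → y < m → f m < f y := by
  induction hi, h using Nat.le_induction with
  | base => exact ⟨lo, le_rfl, le_rfl, fun y h1 h2 => by rw [le_antisymm h2 h1], fun y h1 h2 => by omega⟩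
  | succ hi h ih =>
    obtain ⟨m, a, b, c, d⟩ := ih
    by_cases hm : f (hi + 1) < f m
    · refine ⟨hi + 1, by omega, le_rfl, fun y h1 h2 => ?_, fun y h1 h2 => ?_⟩
      · rcases Nat.lt_or_ge hi y with h3 | h3
        · rw [show y = hi + 1 by omega]
        · exact hm.le.trans (c y h1 h3)
      · exact hm.trans_le (c y h1 (by omega))
    · refine ⟨m, a, by omega, fun y h1 h2 => ?_, d⟩
      rcases Nat.lt_or_ge hi y with h3 | h3
      · rw [show y = hi + 1 by omega]; omega
      · exact c y h1 h3

theorem HH_congr {α : Type*} (D : List (Paren α)) (x y : ℕ) (h : D[x]? = D[y]?)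
    (hx : x < D.length) : HH D (x + 1) - HH D x = HH D (y + 1) - HH D y := by
  have e : D[x]? = some D[x] := by simp [hx]
  rw [HH_succ D x _ e, HH_succ D y _ (h ▸ e)]; omega

theorem period_HH {α : Type*} (D : List (Paren α)) (lo p L : ℕ)
    (hper : ∀ x, lo ≤ x → x < lo + L → D[x]? = D[x + p]?) (hle : lo + L + p ≤ D.length) (x : ℕ)
    (hx : lo ≤ x) (hx' : x ≤ lo + L) : HH D (x + p) - HH D x = HH D (lo + p) - HH D lo := by
  induction x, hx using Nat.le_induction with
  | base => rfl
  | succ x h ih =>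
    have := ih (by omega)
    have := HH_congr D x (x + p) (hper x h (by omega)) (by omega)
    rw [show x + 1 + p = x + p + 1 by omega]; omega

theorem Nd_of_open {α : Type*} {D : List (Paren α)} (hD : IsForest D) (x : ℕ) (hx : x < D.length)
    (h : HH D x < HH D (x + 1)) : ∃ x', Nd D x x' := by
  obtain ⟨x', h' | h'⟩ := Mt_exists hD x hx
  · exact ⟨x', h'⟩
  · have := Nd_close h'; omega

theorem Nd_of_close {α : Type*} {D : List (Paren α)} (hD : IsForest D) (x : ℕ) (hx : x < D.length)
    (h : HH D (x + 1) < HH D x) : ∃ x', Nd D x' x := by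
  obtain ⟨x', h' | h'⟩ := Mt_exists hD x hx
  · have := Nd_open h'; omega
  · exact ⟨x', h'⟩

theorem period_cross {α : Type*} (D : List (Paren α)) (hD : IsForest D) (lo p L : ℕ) (hp : 0 < p)
    (hpL : 2 * p < L) (hper : ∀ x, lo ≤ x → x < lo + L → D[x]? = D[x + p]?)
    (hle : lo + L + p ≤ D.length) (hne : HH D (lo + p) ≠ HH D lo) :
    ∃ x x' x2', lo ≤ x ∧ x < lo + L ∧ Mt D x x' ∧ Mt D (x + p) x2' ∧ x2' < x' := by
  have hH := period_HH D lo p L hper hle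
  rcases lt_or_gt_of_ne hne with hη | hη
  · obtain ⟨m, a, b, c, d⟩ := exists_first_min (HH D) lo (lo + L + p) (by omega)
    have hm : lo + L < m := by
      by_contra hcon
      have := hH m a (by omega)
      have := c (m + p) (by omega) (by omega)
      omega
    obtain ⟨m, rfl⟩ : ∃ m', m = m' + 1 := ⟨m - 1, by omega⟩
    have h1 := d m (by omega) (by omega)
    obtain ⟨n, hn⟩ := Nd_of_close hD m (by omega) h1
    have hnlo : n < lo := by
      by_contra hcon
      have := d n (by omega) (by have := hn.1; omega)
      have := hn.2.2.1; omega
    obtain ⟨y, rfl⟩ : ∃ y, m = y + p := ⟨m - p, by omega⟩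
    have h2 := HH_congr D y (y + p) (hper y (by omega) (by omega)) (by omega)
    obtain ⟨n2, hn2⟩ := Nd_of_close hD y (by omega) (by omega)
    refine ⟨y, n2, n, by omega, by omega, Or.inr hn2, Or.inr hn, ?_⟩
    rcases lt_trichotomy n n2 with h | h | h
    · exact h
    · subst h; have := Nd_unique hn hn2; omega
    · rcases Nd_laminar hn2 hn h with h' | h' <;> omega
  · obtain ⟨m, a, b, c, d⟩ := exists_last_min (HH D) lo (lo + L) (by omega)
    have hm : m < lo + p := by
      by_contra hcon
      have := hH (m - p) (by omega) (by omega)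
      rw [show m - p + p = m by omega] at this
      have := c (m - p) (by omega) (by omega)
      omega
    have h1 := d (m + 1) (by omega) (by omega)
    obtain ⟨n, hn⟩ := Nd_of_open hD m (by omega) h1
    have hnhi : lo + L ≤ n := by
      by_contra hcon
      have := d (n + 1) (by have := hn.1; omega) (by omega)
      have := hn.2.2.1; omega
    have h2 := HH_congr D m (m + p) (hper m (by omega) (by omega)) (by omega)
    obtain ⟨n2, hn2⟩ := Nd_of_open hD (m + p) (by omega) (by omega)
    refine ⟨m, n, n2, by omega, by omega, Or.inl hn, Or.inl hn2, ?_⟩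
    rcases Nd_laminar hn hn2 (by omega) with h' | h' <;> omega

theorem ht_count {α : Type*} (S : List (Paren α)) :
    ht S = (S.countP (fun c => c.1) : ℤ) - (S.countP (fun c => !c.1) : ℤ) := by
  induction S with
  | nil => simp
  | cons c S ih =>
    obtain ⟨b, a⟩ := c
    cases b <;> simp [ih] <;> omega

theorem frag_get {β : Type*} (l : List β) (i j n : ℕ) (h : i + n < j) : (frag l i j)[n]? = l[i+n]? := by
  simp [frag, List.getElem?_take, h]

theorem greedy (L m : ℕ) (S : Finset ℕ) (h : m * L < S.card) :
    ∃ ρ : ℕ → ℕ, (∀ i, i ≤ m → ρ i ∈ S) ∧ ∀ i, i < m → ρ i + L ≤ ρ (i + 1) := by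
  induction m generalizing S with
  | zero =>
    obtain ⟨x, hx⟩ := Finset.card_pos.1 (by omega : 0 < S.card)
    exact ⟨fun _ => x, fun _ _ => hx, by intros; omega⟩
  | succ m ih =>
    have hne : S.Nonempty := Finset.card_pos.1 (by omega)
    set x := S.min' hne with hx
    have hsub : S ⊆ (S.filter (fun y => x + L ≤ y)) ∪ Finset.Ico x (x + L) := by
      intro y hy
      have := S.min'_le y hy
      simp only [Finset.mem_union, Finset.mem_filter, Finset.mem_Ico]
      by_cases hh : x + L ≤ y
      · exact Or.inl ⟨hy, hh⟩
      · right; omega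
    have h1 := (Finset.card_le_card hsub).trans (Finset.card_union_le _ _)
    rw [Nat.card_Ico] at h1
    obtain ⟨ρ, r1, r2⟩ := ih (S.filter (fun y => x + L ≤ y)) (by rw [Nat.succ_mul] at h; omega)
    refine ⟨fun i => if i = 0 then x else ρ (i - 1), ?_, ?_⟩
    · intro i hi
      rcases i with _ | i
      · simpa using S.min'_mem hne
      · have := r1 i (by omega); simp at this ⊢; exact this.1
    · intro i hi
      rcases i with _ | i
      · have := r1 0 (by omega); simp at this ⊢; exact this.2
      · have := r2 i (by omega); simpa using this

theorem red_rich {α : Type*} (k : ℕ) (hk : 0 < k) (D : List (Paren α)) (hD : IsForest D)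
    (S : Finset ℕ) (hS : ∀ ρ ∈ S, ρ < D.length ∧ (21 * k ≤ ρ → ρ + 21 * k ≤ D.length →
      ¬ IsPeriodicBlock k (frag D (ρ - 21 * k) (ρ + 21 * k))))
    (hcard : 84 * k ^ 2 + 50 * k < S.card) : XGood k D := by
  intro f0 f2 g0 g2 W h1 h2 hF hG hc he ha hb
  have hsub : S ⊆ (S.filter (fun y => 25 * k ≤ y ∧ y + 25 * k < D.length)) ∪
      (Finset.range (25 * k) ∪ Finset.Ico (D.length - 25 * k) D.length) := by
    intro y hy
    have := (hS y hy).1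
    simp only [Finset.mem_union, Finset.mem_filter, Finset.mem_Ico, Finset.mem_range]
    by_cases hh : 25 * k ≤ y ∧ y + 25 * k < D.length
    · exact Or.inl ⟨hy, hh⟩
    · right; omega
  have hcd := (Finset.card_le_card hsub).trans ((Finset.card_union_le _ _).trans
    (Nat.add_le_add_left (Finset.card_union_le _ _) _))
  rw [Nat.card_Ico, Finset.card_range] at hcd
  obtain ⟨ρ, r1, r2⟩ := greedy (42 * k) (2 * k) (S.filter (fun y => 25 * k ≤ y ∧ y + 25 * k < D.length))
    (by
      have : 2 * k * (42 * k) = 84 * k ^ 2 := by ring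
      omega)
  have hl1 : (p1 W).length = f0.length + D.length + f2.length := by
    rw [h1]; simp; omega
  have r3 : ∀ i, i ≤ 2 * k → 25 * k ≤ ρ i ∧ ρ i + 25 * k < D.length := by
    intro i hi; have := r1 i hi; simp at this; exact this.2
  obtain ⟨i, hi, hcl⟩ := pigeon (cum W) (fun m n h => cum_mono W h) (2 * k + 1)
    (fun m => by have := cum_le W m; omega) (fun i => f0.length + (ρ i - 21 * k))
    (fun i => f0.length + (ρ i + 21 * k)) (by intros; omega)
    (by intro i hi; have := r2 i (by omega); omega)
  have hρ := r3 i (by omega)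
  have hnp := (hS _ (Finset.mem_filter.1 (r1 i (by omega))).1).2 (by omega) (by omega)
  obtain ⟨q, hq, -, hA, hE⟩ := clean_al (by omega) (by omega) hcl
  have hw := Vx_width hq
  set a := ρ i - 21 * k with hadef
  have hb' : ρ i + 21 * k = a + 42 * k := by omega
  rw [hb'] at hnp hA hE
  obtain ⟨b, rfl⟩ : ∃ b, q = g0.length + b := ⟨q - g0.length, by omega⟩
  have hA' : ∀ i, i < 42 * k → Al W (f0.length + (a + i)) (g0.length + (b + i)) := by
    intro i hi; have := hA i (by omega); simpa only [add_assoc] using this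
  have hE' : ∀ i, i < 42 * k → D[a + i]? = D[b + i]? := by
    intro i hi
    have := hE i (by omega)
    rw [h1, h2] at this
    rw [add_assoc, add_assoc, get_mid _ _ _ _ (by omega), get_mid _ _ _ _ (by omega)] at this
    exact this
  have hblock : ∀ p lo, 0 < p → p ≤ 4 * k → (∀ x, lo ≤ x → x < lo + 42 * k → D[x]? = D[x + p]?) →
      (a = lo ∨ a = lo + p) → lo + 42 * k + p ≤ D.length → HH D (lo + p) ≠ HH D lo := by
    intro p lo hp hp4 hper hal hlen heq
    apply hnp
    have hfl : (frag D a (a + 42 * k)).length = 42 * k := by rw [frag_len]; omega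
    refine ⟨by omega, p, hp, hp4, ?_, ?_⟩
    · intro j hj
      rw [hfl] at hj
      rw [frag_get _ _ _ _ (by omega), frag_get _ _ _ _ (by omega)]
      have := hper (a + j) (by omega) (by omega)
      rw [this]; congr 1; omega
    · have e1 := ht_count ((frag D a (a + 42 * k)).take p)
      have e2 := HH_frag D a (a + 42 * k) p (by omega) (by omega)
      have e3 := period_HH D lo p (42 * k) hper hlen a (by omega) (by omega)
      unfold HH at e1 e2 e3 heq
      omega
  rcases lt_trichotomy a b with hlt | heq | hgt
  · obtain ⟨p, rfl⟩ : ∃ p, b = a + p := ⟨b - a, by omega⟩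
    have hper : ∀ x, a ≤ x → x < a + 42 * k → D[x]? = D[x + p]? := by
      intro x hx hx'
      have := hE' (x - a) (by omega)
      convert this using 2 <;> omega
    obtain ⟨x, x', x2', e1, e2, e3, e4, e5⟩ := period_cross D hD a p (42 * k) (by omega) (by omega) hper
      (by omega) (hblock p a (by omega) (by omega) hper (Or.inl rfl) (by omega))
    have := hA' (x - a) (by omega)
    rw [show a + (x - a) = x by omega, show a + p + (x - a) = x + p by omega] at this
    exact cross_mates h1 h2 hc this e3 e4 (by omega)
  · refine ⟨a, by omega, ?_⟩
    rw [← heq] at hq; exact hq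
  · obtain ⟨p, hpe⟩ : ∃ p, a = b + p := ⟨a - b, by omega⟩
    have hper : ∀ x, b ≤ x → x < b + 42 * k → D[x]? = D[x + p]? := by
      intro x hx hx'
      have := hE' (x - b) (by omega)
      rw [show b + (x - b) = x by omega] at this
      rw [← this]; congr 1; omega
    obtain ⟨x, x', x2', e1, e2, e3, e4, e5⟩ := period_cross D hD b p (42 * k) (by omega) (by omega) hper
      (by omega) (hblock p b (by omega) (by omega) hper (Or.inr hpe) (by omega))
    have := hA' (x - b) (by omega)
    rw [show a + (x - b) = x + p by omega, show b + (x - b) = x by omega] at this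
    exact cross_mates h1 h2 hc this e4 e3 (by omega)

/-- A spine node: its label, the forest to the left of the spine child, the forest to the right. -/
abbrev Sp (α : Type*) := α × List (Paren α) × List (Paren α)

def LL {α : Type*} : List (Sp α) → List (Paren α)
  | [] => []
  | c :: cs => (true, c.1) :: c.2.1 ++ LL cs

def RR {α : Type*} : List (Sp α) → List (Paren α)
  | [] => []
  | c :: cs => RR cs ++ c.2.2 ++ [(false, c.1)]

def Good {α : Type*} (cs : List (Sp α)) : Prop := ∀ c ∈ cs, IsForest c.2.1 ∧ IsForest c.2.2

@[simp] theorem LL_nil {α : Type*} : LL ([] : List (Sp α)) = [] := rfl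
@[simp] theorem RR_nil {α : Type*} : RR ([] : List (Sp α)) = [] := rfl
theorem LL_cons {α : Type*} (c : Sp α) (cs) : LL (c :: cs) = (true, c.1) :: c.2.1 ++ LL cs := rfl
theorem RR_cons {α : Type*} (c : Sp α) (cs) : RR (c :: cs) = RR cs ++ c.2.2 ++ [(false, c.1)] := rfl

theorem LL_append {α : Type*} (a b : List (Sp α)) : LL (a ++ b) = LL a ++ LL b := by
  induction a with
  | nil => rfl
  | cons c a ih => simp [LL_cons, ih]

theorem RR_append {α : Type*} (a b : List (Sp α)) : RR (a ++ b) = RR b ++ RR a := by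
  induction a with
  | nil => simp
  | cons c a ih => simp [RR_cons, ih]

theorem Good_append {α : Type*} {a b : List (Sp α)} : Good (a ++ b) ↔ Good a ∧ Good b := by
  unfold Good
  constructor
  · intro h; exact ⟨fun c hc => h c (by simp [hc]), fun c hc => h c (by simp [hc])⟩
  · rintro ⟨h1, h2⟩ c hc
    rcases List.mem_append.1 hc with h | h
    · exact h1 c h
    · exact h2 c h

theorem Good_cons {α : Type*} {c : Sp α} {b : List (Sp α)} :
    Good (c :: b) ↔ (IsForest c.2.1 ∧ IsForest c.2.2) ∧ Good b := by
  unfold Good; simp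

theorem spine_forest {α : Type*} (cs : List (Sp α)) (h : Good cs) (f : List (Paren α))
    (hf : IsForest f) : IsForest (LL cs ++ f ++ RR cs) := by
  induction cs with
  | nil => simpa using hf
  | cons c cs ih =>
    rw [Good_cons] at h
    have := IsForest.wrap c.1 (h.1.1.append ((ih h.2).append h.1.2))
    simpa [LL_cons, RR_cons] using this

theorem spine_forest' {α : Type*} (cs : List (Sp α)) (h : Good cs) : IsForest (LL cs ++ RR cs) := by
  simpa using spine_forest cs h [] IsForest.nil

theorem context_of_spine {α : Type*} (cs : List (Sp α)) (h : Good cs) (hn : cs ≠ []) :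
    IsContext (LL cs) (RR cs) := by
  cases cs with
  | nil => simp at hn
  | cons c cs =>
    rw [Good_cons] at h
    refine ⟨by simp [LL_cons], by simp [RR_cons], c.1, c.2.1 ++ ((LL cs ++ RR cs) ++ c.2.2),
      h.1.1.append ((spine_forest' cs h.2).append h.1.2), by simp [LL_cons, RR_cons]⟩

theorem spine_split {α : Type*} {F : List (Paren α)} (hF : IsForest F) :
    ∀ L1 R1, F = L1 ++ R1 → ∃ A0 cs B0, IsForest A0 ∧ IsForest B0 ∧ Good cs ∧ L1 = A0 ++ LL cs ∧
      R1 = RR cs ++ B0 := by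
  induction hF with
  | nil =>
    intro L1 R1 h
    have h := List.append_eq_nil_iff.1 h.symm
    exact ⟨[], [], [], IsForest.nil, IsForest.nil, by simp [Good], by simp [h.1], by simp [h.2]⟩
  | @append F G hF hG ih1 ih2 =>
    intro L1 R1 h
    rcases List.append_eq_append_iff.1 h with ⟨c, e1, e2⟩ | ⟨c, e1, e2⟩
    · obtain ⟨A0, cs, B0, a, b, g, x, y⟩ := ih2 c R1 e2
      exact ⟨F ++ A0, cs, B0, hF.append a, b, g, by rw [e1, x]; simp, y⟩
    · obtain ⟨A0, cs, B0, a, b, g, x, y⟩ := ih1 L1 c e1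
      exact ⟨A0, cs, B0 ++ G, a, b.append hG, g, x, by rw [e2, y]; simp⟩
  | @wrap F a hF ih =>
    intro L1 R1 h
    cases L1 with
    | nil => exact ⟨[], [], _, IsForest.nil, IsForest.wrap a hF, by simp [Good], by simp, by
        simpa using h.symm⟩
    | cons x L1 =>
      rcases list_snoc R1 with rfl | ⟨R2, c, rfl⟩
      · exact ⟨_, [], [], IsForest.wrap a hF, IsForest.nil, by simp [Good], by
          simpa using h.symm, by simp⟩
      · simp only [List.cons_append, List.cons.injEq] at h
        obtain ⟨rfl, h⟩ := h
        rw [← List.append_assoc] at h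
        have h' := List.append_inj' h rfl
        obtain ⟨A0, cs, B0, f1, f2, g, e1, e2⟩ := ih _ _ h'.1
        have hc : c = (false, a) := by have := h'.2; simp at this; exact this.symm
        refine ⟨[], (a, A0, B0) :: cs, [], IsForest.nil, IsForest.nil, ?_, ?_, ?_⟩
        · rw [Good_cons]; exact ⟨⟨f1, f2⟩, g⟩
        · simp [LL_cons, e1]
        · simp [RR_cons, e2, hc]

theorem spine_of_context {α : Type*} {PL PR : List (Paren α)} (h : IsContext PL PR) :
    ∃ cs, cs ≠ [] ∧ Good cs ∧ PL = LL cs ∧ PR = RR cs := by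
  obtain ⟨hL, hR, a, F, hF, h⟩ := h
  cases PL with
  | nil => simp at hL
  | cons x L1 =>
    rcases list_snoc PR with rfl | ⟨R2, c, rfl⟩
    · simp at hR
    · simp only [List.cons_append, List.cons.injEq] at h
      obtain ⟨rfl, h⟩ := h
      rw [← List.append_assoc] at h
      have h' := List.append_inj' h rfl
      obtain ⟨A0, cs, B0, f1, f2, g, e1, e2⟩ := spine_split hF _ _ h'.1.symm
      have hc : c = (false, a) := by have := h'.2; simp at this; exact this
      refine ⟨(a, A0, B0) :: cs, by simp, ?_, ?_, ?_⟩
      · rw [Good_cons]; exact ⟨⟨f1, f2⟩, g⟩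
      · simp [LL_cons, e1]
      · simp [RR_cons, e2, hc]

theorem ht_LL {α : Type*} (cs : List (Sp α)) (h : Good cs) : ht (LL cs) = cs.length := by
  induction cs with
  | nil => simp [ht]
  | cons c cs ih =>
    rw [Good_cons] at h
    have e : LL (c :: cs) = [(true, c.1)] ++ c.2.1 ++ LL cs := by simp [LL_cons]
    rw [e, ht_append, ht_append, ih h.2, (forest_ht h.1.1).1]
    simp [ht, sg]; omega

/-- Swapping a crossing forest in the left part. -/
theorem swapL {α : Type*} (k : ℕ) (u D v PR D1 : List (Paren α)) (hX : XGood k D) (hD : IsForest D)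
    (hD1 : IsForest D1) : Redu k (u ++ D ++ v) PR (u ++ D1 ++ v) PR := by
  intro F0 Fm F1 G0 Gm G1 W h1 h2 hF hG hFm hGm a b c d hc he
  have h1' : p1 W = (F0 ++ u) ++ D ++ (v ++ Fm ++ PR ++ F1) := by rw [h1]; simp
  have h2' : p2 W = (G0 ++ u) ++ D ++ (v ++ Gm ++ PR ++ G1) := by rw [h2]; simp
  obtain ⟨y, hy, hv⟩ := hX _ _ _ _ W h1' h2' hF hG hc he (by simp; omega) (by simp; omega)
  obtain ⟨W', e1, e2, e3, e4⟩ := replace1 W _ _ _ _ _ h1' h2' hc hF hG hD y hy hv D1 hD1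
  exact ⟨W', by rw [e1]; simp, by rw [e2]; simp, e3, e4⟩

theorem swapR {α : Type*} (k : ℕ) (u D v PL D1 : List (Paren α)) (hX : XGood k D) (hD : IsForest D)
    (hD1 : IsForest D1) : Redu k PL (u ++ D ++ v) PL (u ++ D1 ++ v) := by
  intro F0 Fm F1 G0 Gm G1 W h1 h2 hF hG hFm hGm a b c d hc he
  have h1' : p1 W = (F0 ++ PL ++ Fm ++ u) ++ D ++ (v ++ F1) := by rw [h1]; simp
  have h2' : p2 W = (G0 ++ PL ++ Gm ++ u) ++ D ++ (v ++ G1) := by rw [h2]; simp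
  obtain ⟨y, hy, hv⟩ := hX _ _ _ _ W h1' h2' hF hG hc he (by simp; omega) (by simp; omega)
  obtain ⟨W', e1, e2, e3, e4⟩ := replace1 W _ _ _ _ _ h1' h2' hc hF hG hD y hy hv D1 hD1
  exact ⟨W', by rw [e1]; simp, by rw [e2]; simp, e3, e4⟩

/-- `U` repeats vertically with a short period. -/
def Shiftable {α : Type*} (k : ℕ) (U : List (Sp α)) : Prop :=
  ∃ h, 1 ≤ h ∧ h ≤ U.length ∧ (∀ i, i + h < U.length → U[i]? = U[i + h]?) ∧
    (LL (U.take h)).length ≤ 4 * k ∧ (RR (U.take h)).length ≤ 4 * k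

/-- An occurrence of (nodes of) the spine `U` in the forest `G`. -/
def Img {α : Type*} (G : List (Paren α)) (U : List (Sp α)) (a e : ℕ) : Prop :=
  (∀ i, 0 < i → i < (LL U).length → G[a + i]? = (LL U)[i]?) ∧
  (∀ i, i < (RR U).length → G[e + 1 + i]? = (RR U)[i]?) ∧
  ∀ i, i ≤ U.length → Nd G (a + (LL (U.take i)).length) (e + (RR (U.drop i)).length)

theorem LL_split {α : Type*} (U : List (Sp α)) (i : ℕ) (c : Sp α) (h : U[i]? = some c) :
    LL U = LL (U.take i) ++ ((true, c.1) :: c.2.1) ++ LL (U.drop (i+1)) := by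
  obtain ⟨hi, e⟩ := List.getElem?_eq_some_iff.1 h
  conv_lhs => rw [← List.take_append_drop i U, List.drop_eq_getElem_cons hi, e]
  rw [LL_append, LL_cons]; simp

theorem RR_split {α : Type*} (U : List (Sp α)) (i : ℕ) (c : Sp α) (h : U[i]? = some c) :
    RR U = RR (U.drop (i+1)) ++ (c.2.2 ++ [(false, c.1)]) ++ RR (U.take i) := by
  obtain ⟨hi, e⟩ := List.getElem?_eq_some_iff.1 h
  conv_lhs => rw [← List.take_append_drop i U, List.drop_eq_getElem_cons hi, e]
  rw [RR_append, RR_cons]; simp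

theorem LL_take_succ {α : Type*} (U : List (Sp α)) (i : ℕ) (c : Sp α) (h : U[i]? = some c) :
    (LL (U.take (i+1))).length = (LL (U.take i)).length + c.2.1.length + 1 := by
  rw [List.take_add_one, h, LL_append]; simp [LL_cons]; omega

theorem RR_drop_succ {α : Type*} (U : List (Sp α)) (i : ℕ) (c : Sp α) (h : U[i]? = some c) :
    (RR (U.drop i)).length = (RR (U.drop (i+1))).length + c.2.2.length + 1 := by
  obtain ⟨hi, e⟩ := List.getElem?_eq_some_iff.1 h
  rw [List.drop_eq_getElem_cons hi, e, RR_cons]; simp; omega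

theorem LL_take_len {α : Type*} (U : List (Sp α)) (i : ℕ) :
    (LL U).length = (LL (U.take i)).length + (LL (U.drop i)).length := by
  conv_lhs => rw [← List.take_append_drop i U, LL_append]
  simp

theorem RR_take_len {α : Type*} (U : List (Sp α)) (i : ℕ) :
    (RR U).length = (RR (U.take i)).length + (RR (U.drop i)).length := by
  conv_lhs => rw [← List.take_append_drop i U, RR_append]
  simp; omega

theorem Img_HH {α : Type*} {G : List (Paren α)} {U : List (Sp α)} {a e : ℕ} (hU : Good U)
    (h : Img G U a e) : ∀ i, i ≤ U.length → HH G (a + (LL (U.take i)).length) = HH G a + i := by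
  by_cases hn : U = []
  · subst hn; intro i hi; simp at hi; simp [hi]
  have h0 := h.2.2 0 (by omega)
  simp at h0
  have hop := Nd_open h0
  obtain ⟨c, U', rfl⟩ := List.exists_cons_of_ne_nil hn
  have key : ∀ j, 1 ≤ j → j ≤ (LL (c :: U')).length →
      HH G (a + j) = HH G a + HH (LL (c :: U')) j := by
    intro j hj
    induction j, hj using Nat.le_induction with
    | base =>
      intro _
      have := HH_succ (LL (c :: U')) 0 (true, c.1) (by simp [LL_cons])
      rw [HH_zero] at this
      simp [sg] at this
      rw [hop]
      omega
    | succ j hj ih =>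
      intro hl
      obtain ⟨d, hd⟩ : ∃ d, (LL (c :: U'))[j]? = some d := ⟨_, List.getElem?_eq_getElem (by omega)⟩
      have e1 := HH_succ _ _ _ hd
      have e2 := HH_succ _ _ _ ((h.1 j (by omega) (by omega)).trans hd)
      have := ih (by omega)
      rw [← add_assoc]; omega
  intro i hi
  rcases Nat.eq_zero_or_pos i with rfl | hi0
  · simp
  have hl := LL_take_len (c :: U') i
  rw [key _ _ (by omega)]
  · congr 1
    have hE : LL (c :: U') = LL ((c :: U').take i) ++ LL ((c :: U').drop i) := by
      rw [← LL_append, List.take_append_drop]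
    rw [hE, HH_app_left _ _ _ le_rfl, HH_len, ht_LL]
    · simp at hi ⊢; omega
    · have := List.take_append_drop i (c :: U')
      rw [← this, Good_append] at hU; exact hU.1
    · exact le_rfl
  · obtain ⟨i, rfl⟩ : ∃ i', i = i' + 1 := ⟨i - 1, by omega⟩
    simp [LL_cons]

theorem small_shiftable {α : Type*} {k : ℕ} {U : List (Sp α)} (hn : U ≠ [])
    (h1 : (LL U).length ≤ 4 * k) (h2 : (RR U).length ≤ 4 * k) : Shiftable k U := by
  refine ⟨U.length, List.length_pos_iff.2 hn, le_rfl, fun i hi => by omega, ?_, ?_⟩ <;>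
    rwa [List.take_length]

theorem RR_drop_anti {α : Type*} (U : List (Sp α)) {i j : ℕ} (h : i ≤ j) :
    (RR (U.drop j)).length ≤ (RR (U.drop i)).length := by
  have := RR_take_len (U.drop i) (j - i)
  rw [List.drop_drop, show i + (j - i) = j by omega] at this
  omega

theorem LL_take_mono {α : Type*} (U : List (Sp α)) {i j : ℕ} (h : i ≤ j) :
    (LL (U.take i)).length ≤ (LL (U.take j)).length := by
  have := LL_take_len (U.take j) i
  rw [List.take_take, min_eq_left h] at this
  omega

theorem img_core {α : Type*} {k : ℕ} {G : List (Paren α)} {U : List (Sp α)} {a e a2 e2 : ℕ}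
    (hU : Good U) (hn : U ≠ []) (h : Img G U a e) (h' : Img G U a2 e2) (ha : a < a2)
    (ha' : a2 ≤ a + 4 * k) (he : e2 ≤ e + 4 * k) (he' : e ≤ e2 + 4 * k) (hne : e ≠ e2) :
    Shiftable k U := by
  have v0 := h.2.2 0 (by omega)
  have g0 := h'.2.2 0 (by omega)
  have vn := h.2.2 U.length le_rfl
  have gn := h'.2.2 U.length le_rfl
  simp only [List.take_zero, List.drop_zero, LL_nil, List.length_nil, add_zero, List.take_length,
    List.drop_length, RR_nil] at v0 g0 vn gn
  have hv := Img_HH hU h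
  have hg := Img_HH hU h'
  have vn1 := vn.1
  have gn1 := gn.1
  -- the far case
  by_cases hfar : e + (RR U).length < a2
  · exact small_shiftable hn (by omega) (by omega)
  have hnest := (Nd_laminar v0 g0 ha).resolve_left hfar
  have hH : HH G a < HH G a2 := v0.2.2.2 a2 ha (by omega)
  obtain ⟨h0, hh0⟩ : ∃ h0 : ℕ, HH G a2 = HH G a + h0 := ⟨(HH G a2 - HH G a).toNat, by omega⟩
  have hh1 : 1 ≤ h0 := by omega
  have hvn := hv U.length le_rfl
  rw [List.take_length] at hvn
  by_cases hbig : U.length < h0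
  · have hx : (LL U).length < a2 - a := by
      by_contra hcon
      rcases Nat.lt_or_ge a2 (a + (LL U).length) with hl | hl
      · have := g0.2.2.2 _ hl (by omega)
        omega
      · rw [show a + (LL U).length = a2 by omega] at hvn
        omega
    have hy : e2 + (RR U).length < e := by
      rcases Nd_laminar vn g0 (by omega) with h1 | h1
      · omega
      · exact h1
    exact small_shiftable hn (by omega) (by omega)
  push Not at hbig
  have hgv : ∀ i, i + h0 ≤ U.length →
      a2 + (LL (U.take i)).length = a + (LL (U.take (i + h0))).length ∧
      e2 + (RR (U.drop i)).length = e + (RR (U.drop (i + h0))).length := by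
    intro i hi
    have n1 := h'.2.2 i (by omega)
    have n2 := h.2.2 (i + h0) hi
    have l1 := LL_take_len U i
    have l2 := LL_take_len U (i + h0)
    have l3 := RR_take_len U i
    have l4 := RR_take_len U (i + h0)
    have heq := Nd_same (z := a2 + (LL U).length) n1 n2 (by omega) (by omega) (by omega) (by omega)
      (by rw [hv _ hi, hg _ (by omega)]; push_cast; omega)
    refine ⟨heq, ?_⟩
    rw [heq] at n1
    exact Nd_unique n1 n2
  have g00 := hgv 0 (by omega)
  simp only [List.take_zero, List.drop_zero, LL_nil, List.length_nil, add_zero, zero_add] at g00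
  have l4 := RR_take_len U h0
  refine ⟨h0, hh1, hbig, ?_, by omega, by omega⟩
  intro i hi
  obtain ⟨c, hc⟩ : ∃ c, U[i]? = some c := ⟨_, List.getElem?_eq_getElem (by omega)⟩
  obtain ⟨d, hd⟩ : ∃ d, U[i + h0]? = some d := ⟨_, List.getElem?_eq_getElem (by omega)⟩
  rw [hc, hd]
  have x1 := hgv i (by omega)
  have x2 := hgv (i + 1) (by omega)
  have c1 := LL_take_succ U i c hc
  have c2 := RR_drop_succ U i c hc
  have d1 := LL_take_succ U _ d hd
  have d2 := RR_drop_succ U _ d hd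
  rw [show i + 1 + h0 = i + h0 + 1 by omega] at x2
  have sc := LL_split U i c hc
  have sd := LL_split U _ d hd
  have tc := RR_split U i c hc
  have td := RR_split U _ d hd
  have lc := congrArg List.length sc
  have ld := congrArg List.length sd
  have mc := congrArg List.length tc
  have md := congrArg List.length td
  simp only [List.length_append, List.length_cons, List.length_nil] at lc ld mc md
  have hA : c.2.1 = d.2.1 := by
    apply List.ext_getElem?
    intro j
    by_cases hj : j < c.2.1.length
    · have q1 := h'.1 ((LL (U.take i)).length + (j + 1)) (by omega) (by omega)
      have q2 := h.1 ((LL (U.take (i + h0))).length + (j + 1)) (by omega) (by omega)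
      have q3 : (LL U)[(LL (U.take i)).length + (j + 1)]? = c.2.1[j]? := by
        rw [sc, get_mid _ _ _ _ (by simp; omega)]; simp
      have q4 : (LL U)[(LL (U.take (i + h0))).length + (j + 1)]? = d.2.1[j]? := by
        rw [sd, get_mid _ _ _ _ (by simp; omega)]; simp
      rw [← q3, ← q4, ← q1, ← q2]
      congr 1; omega
    · rw [List.getElem?_eq_none (by omega), List.getElem?_eq_none (by omega)]
  have hB : c.2.2 ++ [(false, c.1)] = d.2.2 ++ [(false, d.1)] := by
    apply List.ext_getElem?
    intro j
    by_cases hj : j < c.2.2.length + 1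
    · have q1 := h'.2.1 ((RR (U.drop (i + 1))).length + j) (by omega)
      have q2 := h.2.1 ((RR (U.drop (i + h0 + 1))).length + j) (by omega)
      have q3 : (RR U)[(RR (U.drop (i + 1))).length + j]? = (c.2.2 ++ [(false, c.1)])[j]? := by
        rw [tc, get_mid _ _ _ _ (by simp; omega)]
      have q4 : (RR U)[(RR (U.drop (i + h0 + 1))).length + j]? = (d.2.2 ++ [(false, d.1)])[j]? := by
        rw [td, get_mid _ _ _ _ (by simp; omega)]
      rw [← q3, ← q4, ← q1, ← q2]
      congr 1; omega
    · rw [List.getElem?_eq_none (by simp; omega), List.getElem?_eq_none (by simp; omega)]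
  have hB' := List.append_inj' hB rfl
  have : c.1 = d.1 := by have := hB'.2; simp at this; exact this
  rw [show c = d from Prod.ext this (Prod.ext hA hB'.1)]

theorem img_eq {α : Type*} {k : ℕ} {G : List (Paren α)} {U : List (Sp α)} {a e a2 e2 : ℕ}
    (hU : Good U) (hn : U ≠ []) (h : Img G U a e) (h' : Img G U a2 e2) (hS : ¬ Shiftable k U)
    (ha : a ≤ a2 + 4 * k) (ha' : a2 ≤ a + 4 * k) (he : e2 ≤ e + 4 * k) (he' : e ≤ e2 + 4 * k) :
    a = a2 ∧ e = e2 := by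
  have v0 := h.2.2 0 (by omega)
  have g0 := h'.2.2 0 (by omega)
  simp only [List.take_zero, List.drop_zero, LL_nil, List.length_nil, add_zero] at v0 g0
  by_cases hE : e = e2
  · subst hE
    exact ⟨Nd_unique' v0 g0, rfl⟩
  rcases lt_trichotomy a a2 with hl | rfl | hl
  · exact absurd (img_core hU hn h h' hl ha' he he' hE) hS
  · have := Nd_unique v0 g0; exact ⟨rfl, by omega⟩
  · exact absurd (img_core hU hn h' h hl ha he' he (Ne.symm hE)) hS

theorem Al_fun {α : Type*} {W : List (Op α)} {x y y' : ℕ} (h : Al W x y) (h' : Al W x y') :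
    y = y' := by
  have := Al_mono h h'
  have := Al_mono h' h
  omega

theorem cum_append_sub {α : Type*} (A : List (Op α)) (p q : Paren α) (B : List (Op α)) (n : ℕ) :
    cum (A ++ Op.sub p q :: B) ((p1 A).length + 1 + n) =
      cum (A ++ [Op.sub p q]) ((p1 A).length + 1) + cum B n := by
  induction A with
  | nil => simp [cum, show 1 + n = n + 1 by omega]
  | cons o A ih =>
    cases o with
    | del p =>
      simp only [List.cons_append, p1_del, List.length_cons,
        show (p1 A).length + 1 + 1 + n = ((p1 A).length + 1 + n) + 1 by omega, cum, ih]
      omega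
    | ins p =>
      simp only [List.cons_append, p1_ins,
        show (p1 A).length + 1 + n = ((p1 A).length + n) + 1 by omega, cum]
      rw [show (p1 A).length + n + 1 = (p1 A).length + 1 + n by omega, ih]
      omega
    | sub p q =>
      simp only [List.cons_append, p1_sub, List.length_cons,
        show (p1 A).length + 1 + 1 + n = ((p1 A).length + 1 + n) + 1 by omega, cum, ih]
      omega

theorem cum0_clean {α : Type*} (m : ℕ) (B : List (Op α)) (h : cum B m = 0) (hm : m ≤ (p1 B).length) :
    ∃ S B', B = ids S ++ B' ∧ S.length = m := by
  induction m generalizing B with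
  | zero => exact ⟨[], B, rfl, rfl⟩
  | succ m ih =>
    cases B with
    | nil => simp at hm
    | cons o B =>
      cases o with
      | del p => simp [cum] at h
      | ins p => simp [cum] at h
      | sub p q =>
        simp [cum] at h hm
        obtain ⟨S, B', rfl, e⟩ := ih B h.2 hm
        exact ⟨p :: S, B', by simp [ids, h.1], by simp [e]⟩

theorem clean_anchor {α : Type*} {W : List (Op α)} {x g b : ℕ} (h : Al W x g) (hb : x + 1 ≤ b)
    (hb' : b ≤ (p1 W).length) (hc : cum W (x + 1) = cum W b) :
    ∀ i, i < b - (x + 1) → Al W (x + 1 + i) (g + 1 + i) ∧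
      (p1 W)[x + 1 + i]? = (p2 W)[g + 1 + i]? := by
  obtain ⟨W1, p, q, W2, rfl, rfl, rfl⟩ := Al_Vx h
  obtain ⟨m, rfl⟩ : ∃ m, b = (p1 W1).length + 1 + m := ⟨b - ((p1 W1).length + 1), by omega⟩
  have e0 := cum_append_sub W1 p q W2 0
  have e1 := cum_append_sub W1 p q W2 m
  rw [cum_zero] at e0
  simp only [add_zero] at e0
  obtain ⟨S, B', rfl, hS⟩ := cum0_clean m W2 (by omega) (by simp at hb'; omega)
  intro i hi
  have hsplit : W1 ++ Op.sub p q :: (ids S ++ B') = (W1 ++ [Op.sub p q]) ++ ids S ++ B' := by simp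
  rw [hsplit]
  have t1 : (p1 (W1 ++ [Op.sub p q])).length = (p1 W1).length + 1 := by simp
  have t2 : (p2 (W1 ++ [Op.sub p q])).length = (p2 W1).length + 1 := by simp
  rw [← t1, ← t2]
  constructor
  · rw [Al_mid _ _ _ _ _ (by simp; omega), Al_ids]; exact ⟨rfl, by omega⟩
  · rw [p1_append, p1_append, p2_append, p2_append, get_mid _ _ _ _ (by simp; omega),
      get_mid _ _ _ _ (by simp; omega), p1_ids, p2_ids]

theorem img_transport {α : Type*} {W : List (Op α)} {U : List (Sp α)} {a e : ℕ} (hn : U ≠ [])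
    (hF : IsForest (p1 W)) (hG : IsForest (p2 W)) (hc : Cons W) (h : Img (p1 W) U a e)
    (hl : cum W (a + 1) = cum W (a + (LL U).length + 1))
    (hr : cum W (e + 1) = cum W (e + (RR U).length + 1)) :
    ∃ q q', Al W a q ∧ Al W e q' ∧ Al W (e + (RR U).length) (q' + (RR U).length) ∧
      Img (p2 W) U q q' := by
  have v0 := h.2.2 0 (by omega)
  have vn := h.2.2 U.length le_rfl
  simp only [List.take_zero, List.drop_zero, LL_nil, List.length_nil, add_zero, List.take_length,
    List.drop_length, RR_nil] at v0 vn
  have v01 := v0.2.1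
  have vn1 := vn.1
  have pl : 0 < (LL U).length := by
    obtain ⟨c, U', rfl⟩ := List.exists_cons_of_ne_nil hn
    simp [LL_cons]
  have pr : 0 < (RR U).length := by
    obtain ⟨c, U', rfl⟩ := List.exists_cons_of_ne_nil hn
    simp [RR_cons]
  obtain ⟨g, -, -, hA, -⟩ := clean_al (by omega) (by omega) hl
  obtain ⟨g', -, -, hA', -⟩ := clean_al (by omega) (by omega) hr
  have hA := hA ((LL U).length - 1) (by omega)
  have hA' := hA' ((RR U).length - 1) (by omega)
  rw [show a + 1 + ((LL U).length - 1) = a + (LL U).length by omega] at hA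
  rw [show e + 1 + ((RR U).length - 1) = e + (RR U).length by omega] at hA'
  obtain ⟨q, hq⟩ := Mt_exists hG _ (Al_lt hA').2
  obtain ⟨q', hq'⟩ := Mt_exists hG _ (Al_lt hA).2
  have B0 := hc _ _ _ _ hA' (Or.inr v0) hq
  have Bn := hc _ _ _ _ hA (Or.inl vn) hq'
  have C := clean_anchor B0 (by omega) (by omega) hl
  have C' := clean_anchor Bn (by omega) (by omega) hr
  have D : ∀ i, i ≤ (LL U).length → Al W (a + i) (q + i) := by
    intro i hi
    rcases Nat.eq_zero_or_pos i with rfl | hi0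
    · exact B0
    · have := (C (i - 1) (by omega)).1
      rwa [show a + 1 + (i - 1) = a + i by omega, show q + 1 + (i - 1) = q + i by omega] at this
  have D' : ∀ i, i ≤ (RR U).length → Al W (e + i) (q' + i) := by
    intro i hi
    rcases Nat.eq_zero_or_pos i with rfl | hi0
    · exact Bn
    · have := (C' (i - 1) (by omega)).1
      rwa [show e + 1 + (i - 1) = e + i by omega, show q' + 1 + (i - 1) = q' + i by omega] at this
  refine ⟨q, q', B0, Bn, D' _ le_rfl, ?_, ?_, ?_⟩
  · intro i hi hi'
    rw [← h.1 i hi hi']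
    have := (C (i - 1) (by omega)).2
    rw [show a + 1 + (i - 1) = a + i by omega, show q + 1 + (i - 1) = q + i by omega] at this
    exact this.symm
  · intro i hi
    rw [← h.2.1 i hi]
    exact (C' i (by omega)).2.symm
  · intro i hi
    have l1 := LL_take_len U i
    have l2 := RR_take_len U i
    have n := h.2.2 i hi
    have d1 := D (LL (U.take i)).length (by omega)
    have d2 := D' (RR (U.drop i)).length (by omega)
    obtain ⟨j, hj⟩ := Mt_exists hG _ (Al_lt d1).2
    have d3 := hc _ _ _ _ d1 (Or.inl n) hj
    have := Al_fun d2 d3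
    subst this
    have lt := (Al_mono d1 d2).1 n.1
    rcases hj with hj | hj
    · exact hj
    · have := hj.1; omega

theorem spine_Nd {α : Type*} (F0 : List (Paren α)) (cs : List (Sp α)) (Fm F1 : List (Paren α))
    (hcs : Good cs) (hm : IsForest Fm) (i : ℕ) (hi : i < cs.length) :
    Nd (F0 ++ LL cs ++ Fm ++ RR cs ++ F1) (F0.length + (LL (cs.take i)).length)
      (F0.length + (LL cs).length + Fm.length + (RR (cs.drop i)).length - 1) := by
  obtain ⟨c, hc⟩ : ∃ c, cs[i]? = some c := ⟨_, List.getElem?_eq_getElem hi⟩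
  have hm' := List.mem_of_getElem? hc
  have hd : Good (cs.drop (i + 1)) := fun x hx => hcs x (List.mem_of_mem_drop hx)
  set M := (true, c.1) :: (c.2.1 ++ ((LL (cs.drop (i+1)) ++ Fm ++ RR (cs.drop (i+1))) ++ c.2.2)) ++
    [(false, c.1)] with hM
  set N := c.2.1 ++ ((LL (cs.drop (i+1)) ++ Fm ++ RR (cs.drop (i+1))) ++ c.2.2) with hN
  have fN : IsForest N := (hcs c hm').1.append ((spine_forest _ hd _ hm).append (hcs c hm').2)
  have nd : IsNode M 0 (N.length + 1) := by
    refine ⟨by omega, by simp [hM], ⟨c.1, by simp [hM], by simp [hM]⟩, ?_⟩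
    have : frag M 1 (N.length + 1) = N := by simp [frag, hM]
    simpa [this] using fN
  have hF : F0 ++ LL cs ++ Fm ++ RR cs ++ F1 =
      (F0 ++ LL (cs.take i)) ++ M ++ (RR (cs.take i) ++ F1) := by
    rw [LL_split cs i c hc, RR_split cs i c hc]; simp [hM, hN]
  have := Nd_mid (F0 ++ LL (cs.take i)) M (RR (cs.take i) ++ F1) _ _ (IsNode_Nd nd)
  rw [hF]
  have l1 := LL_split cs i c hc
  have l1 := congrArg List.length l1
  have l2 := RR_drop_succ cs i c hc
  simp only [List.length_append, List.length_cons] at l1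
  convert this using 1
  · simp
  · simp [hN]; omega

theorem img_spine {α : Type*} (F0 : List (Paren α)) (X U : List (Sp α)) (R : List (Sp α))
    (Fm F1 : List (Paren α)) (hcs : Good (X ++ U ++ R)) (hR : R ≠ []) (hm : IsForest Fm) :
    Img (F0 ++ LL (X ++ U ++ R) ++ Fm ++ RR (X ++ U ++ R) ++ F1) U (F0.length + (LL X).length)
      (F0.length + (LL (X ++ U ++ R)).length + Fm.length + (RR R).length - 1) := by
  have pR : 0 < (RR R).length := by
    obtain ⟨c, U', rfl⟩ := List.exists_cons_of_ne_nil hR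
    simp [RR_cons]
  have pR' := List.length_pos_iff.2 hR
  refine ⟨?_, ?_, ?_⟩
  · intro i _ hi
    have : F0 ++ LL (X ++ U ++ R) ++ Fm ++ RR (X ++ U ++ R) ++ F1 =
      (F0 ++ LL X) ++ LL U ++ (LL R ++ Fm ++ RR (X ++ U ++ R) ++ F1) := by simp [LL_append]
    rw [this]
    have e := get_mid (F0 ++ LL X) (LL U) (LL R ++ Fm ++ RR (X ++ U ++ R) ++ F1) i hi
    rwa [List.length_append] at e
  · intro i hi
    have : F0 ++ LL (X ++ U ++ R) ++ Fm ++ RR (X ++ U ++ R) ++ F1 =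
      (F0 ++ LL (X ++ U ++ R) ++ Fm ++ RR R) ++ RR U ++ (RR X ++ F1) := by simp [RR_append]
    rw [this]
    have e := get_mid (F0 ++ LL (X ++ U ++ R) ++ Fm ++ RR R) (RR U) (RR X ++ F1) i hi
    simp only [List.length_append] at e
    rw [← e]; congr 1; omega
  · intro i hi
    have := spine_Nd F0 (X ++ U ++ R) Fm F1 hcs hm (X.length + i) (by simp; omega)
    convert this using 1
    · have : (X ++ U ++ R).take (X.length + i) = X ++ U.take i := by
        rw [List.append_assoc, List.take_length_add_append, List.take_append_of_le_length hi]
      rw [this, LL_append]; simp; omega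
    · have : (X ++ U ++ R).drop (X.length + i) = U.drop i ++ R := by
        rw [List.append_assoc, List.drop_length_add_append, List.drop_append_of_le_length hi]
      rw [this, RR_append]; simp; omega

/-- The alignment crosses both halves of the context diagonally. -/
def Cross2 {α : Type*} (W : List (Op α)) (L R F0 Fm G0 Gm : List (Paren α)) : Prop :=
  (∃ y, y ≤ L.length ∧ Vx W (F0.length + y) (G0.length + y)) ∧
  ∃ y', y' ≤ R.length ∧ Vx W (F0.length + L.length + Fm.length + y')
    (G0.length + L.length + Gm.length + y')

theorem RR_pos {α : Type*} {R : List (Sp α)} (hR : R ≠ []) : 0 < (RR R).length := by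
  obtain ⟨c, U', rfl⟩ := List.exists_cons_of_ne_nil hR
  simp [RR_cons]

theorem unit_cross {α : Type*} {k : ℕ} {W : List (Op α)} {F0 Fm F1 G0 Gm G1 : List (Paren α)}
    {X U R : List (Sp α)} (hcs : Good (X ++ U ++ R)) (hR : R ≠ []) (hU : U ≠ [])
    (hS : ¬ Shiftable k U)
    (h1 : p1 W = F0 ++ LL (X ++ U ++ R) ++ Fm ++ RR (X ++ U ++ R) ++ F1)
    (h2 : p2 W = G0 ++ LL (X ++ U ++ R) ++ Gm ++ RR (X ++ U ++ R) ++ G1)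
    (hF : IsForest (p1 W)) (hG : IsForest (p2 W)) (hFm : IsForest Fm) (hGm : IsForest Gm)
    (a : F0.length ≤ G0.length + 2 * k) (b : G0.length ≤ F0.length + 2 * k)
    (c : F0.length + Fm.length ≤ G0.length + Gm.length + 2 * k)
    (d : G0.length + Gm.length ≤ F0.length + Fm.length + 2 * k) (hc : Cons W) (he : ed W ≤ 2 * k)
    (hl : cum W (F0.length + (LL X).length + 1) = cum W (F0.length + (LL (X ++ U)).length + 1))
    (hr : cum W (F0.length + (LL (X ++ U ++ R)).length + Fm.length + (RR R).length - 1 + 1) =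
      cum W (F0.length + (LL (X ++ U ++ R)).length + Fm.length + (RR (U ++ R)).length - 1 + 1)) :
    Cross2 W (LL (X ++ U ++ R)) (RR (X ++ U ++ R)) F0 Fm G0 Gm := by
  have pR := RR_pos hR
  have i1 := img_spine F0 X U R Fm F1 hcs hR hFm
  have i2 := img_spine G0 X U R Gm G1 hcs hR hGm
  rw [← h1] at i1
  rw [← h2] at i2
  obtain ⟨q, q', a1, a2, a3, i3⟩ := img_transport hU hF hG hc i1
    (by rw [hl, LL_append]; simp [add_assoc])
    (by rw [hr, RR_append]; congr 1; simp; omega)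
  have w1 := Vx_width (Vx_of_Al a1).1
  have w2 := Vx_width (Vx_of_Al a2).1
  have gU : Good U := by rw [Good_append, Good_append] at hcs; exact hcs.1.2
  obtain ⟨rfl, rfl⟩ := img_eq gU hU i2 i3 hS (by omega) (by omega) (by omega) (by omega)
  refine ⟨⟨(LL X).length, by simp [LL_append], (Vx_of_Al a1).1⟩,
    ⟨(RR R).length, by simp [RR_append], ?_⟩⟩
  have := (Vx_of_Al a2).2
  convert this using 1 <;> omega

theorem unit_multi {α : Type*} {k : ℕ} {W : List (Op α)} {F0 Fm F1 G0 Gm G1 : List (Paren α)}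
    {cs R : List (Sp α)} (hcs : Good cs) (hR : R ≠ [])
    (h1 : p1 W = F0 ++ LL cs ++ Fm ++ RR cs ++ F1)
    (h2 : p2 W = G0 ++ LL cs ++ Gm ++ RR cs ++ G1)
    (hF : IsForest (p1 W)) (hG : IsForest (p2 W)) (hFm : IsForest Fm) (hGm : IsForest Gm)
    (a : F0.length ≤ G0.length + 2 * k) (b : G0.length ≤ F0.length + 2 * k)
    (c : F0.length + Fm.length ≤ G0.length + Gm.length + 2 * k)
    (d : G0.length + Gm.length ≤ F0.length + Fm.length + 2 * k) (hc : Cons W) (he : ed W ≤ 2 * k)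
    (Us : List (List (Sp α))) : ∀ (X : List (Sp α)), cs = X ++ Us.flatten ++ R →
    (∀ U ∈ Us, U ≠ [] ∧ ¬ Shiftable k U) →
    Cross2 W (LL cs) (RR cs) F0 Fm G0 Gm ∨
    cum W (F0.length + (LL X).length + 1) +
      cum W (F0.length + (LL cs).length + Fm.length + (RR R).length - 1 + 1) + Us.length ≤
    cum W (F0.length + (LL (X ++ Us.flatten)).length + 1) +
      cum W (F0.length + (LL cs).length + Fm.length + (RR (Us.flatten ++ R)).length - 1 + 1) := by
  induction Us with
  | nil => intro X _ _; right; simp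
  | cons U Us ih =>
    intro X hX hU
    rcases ih (X ++ U) (by simp [hX]) (fun V hV => hU V (by simp [hV])) with h | h
    · exact Or.inl h
    by_cases hcl : cum W (F0.length + (LL X).length + 1) =
        cum W (F0.length + (LL (X ++ U)).length + 1) ∧
      cum W (F0.length + (LL cs).length + Fm.length + (RR (Us.flatten ++ R)).length - 1 + 1) =
      cum W (F0.length + (LL cs).length + Fm.length + (RR (U ++ (Us.flatten ++ R))).length - 1 + 1)
    · left
      have hX' : cs = X ++ U ++ (Us.flatten ++ R) := by simp [hX]
      subst hX'
      exact unit_cross hcs (by simp [hR]) (hU U (by simp)).1 (hU U (by simp)).2 h1 h2 hF hG hFm hGm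
        a b c d hc he hcl.1 hcl.2
    · right
      have m1 := cum_mono W (show F0.length + (LL X).length + 1 ≤
        F0.length + (LL (X ++ U)).length + 1 by simp [LL_append])
      have m2 := cum_mono W (show
        F0.length + (LL cs).length + Fm.length + (RR (Us.flatten ++ R)).length - 1 + 1 ≤
        F0.length + (LL cs).length + Fm.length + (RR (U ++ (Us.flatten ++ R))).length - 1 + 1 by
          rw [RR_append U]; simp; omega)
      simp only [List.flatten_cons, List.append_assoc, List.length_cons] at h ⊢ hcl m1 m2
      omega

theorem multi_cross {α : Type*} {k : ℕ} {W : List (Op α)} {F0 Fm F1 G0 Gm G1 : List (Paren α)}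
    {cs R : List (Sp α)} (hcs : Good cs) (hR : R ≠ [])
    (h1 : p1 W = F0 ++ LL cs ++ Fm ++ RR cs ++ F1)
    (h2 : p2 W = G0 ++ LL cs ++ Gm ++ RR cs ++ G1)
    (hF : IsForest (p1 W)) (hG : IsForest (p2 W)) (hFm : IsForest Fm) (hGm : IsForest Gm)
    (a : F0.length ≤ G0.length + 2 * k) (b : G0.length ≤ F0.length + 2 * k)
    (c : F0.length + Fm.length ≤ G0.length + Gm.length + 2 * k)
    (d : G0.length + Gm.length ≤ F0.length + Fm.length + 2 * k) (hc : Cons W) (he : ed W ≤ 2 * k)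
    (Us : List (List (Sp α))) (X : List (Sp α)) (hX : cs = X ++ Us.flatten ++ R)
    (hUs : ∀ U ∈ Us, U ≠ [] ∧ ¬ Shiftable k U) (hlen : Us.length = 2 * k + 1) :
    Cross2 W (LL cs) (RR cs) F0 Fm G0 Gm := by
  rcases unit_multi hcs hR h1 h2 hF hG hFm hGm a b c d hc he Us X hX hUs with h | h
  · exact h
  exfalso
  have pR := RR_pos hR
  have pR' : 0 < (LL R).length := by
    obtain ⟨c, U', rfl⟩ := List.exists_cons_of_ne_nil hR
    simp [LL_cons]
  have m1 := cum_mono W (show F0.length + (LL (X ++ Us.flatten)).length + 1 ≤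
    F0.length + (LL cs).length + Fm.length + (RR R).length - 1 + 1 by
      rw [hX, LL_append (X ++ Us.flatten), List.length_append]; omega)
  have m2 := cum_le W (F0.length + (LL cs).length + Fm.length + (RR (Us.flatten ++ R)).length - 1 + 1)
  omega

def stub {α : Type*} (k : ℕ) (a : α) : List (Sp α) := [(a, chn a (10 * k + 1), chn a (10 * k + 1))]

theorem stub_good {α : Type*} (k : ℕ) (a : α) : Good (stub k a) := by
  intro c hc
  simp [stub] at hc; subst hc
  exact ⟨chn_forest _ _, chn_forest _ _⟩

theorem stub_len {α : Type*} (k : ℕ) (a : α) :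
    (LL (stub k a)).length + (RR (stub k a)).length = 40 * k + 6 := by
  simp [stub, LL_cons, RR_cons, chn_len]; omega

theorem Redu_of_cross {α : Type*} {k : ℕ} {L R : List (Paren α)} (hLR : IsForest (L ++ R))
    (h : ∀ (F0 Fm F1 G0 Gm G1 : List (Paren α)) (W : List (Op α)),
      p1 W = F0 ++ L ++ Fm ++ R ++ F1 → p2 W = G0 ++ L ++ Gm ++ R ++ G1 →
      IsForest (p1 W) → IsForest (p2 W) → IsForest Fm → IsForest Gm →
      F0.length ≤ G0.length + 2 * k → G0.length ≤ F0.length + 2 * k →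
      F0.length + Fm.length ≤ G0.length + Gm.length + 2 * k →
      G0.length + Gm.length ≤ F0.length + Fm.length + 2 * k →
      Cons W → ed W ≤ 2 * k → Cross2 W L R F0 Fm G0 Gm) (r r' : List (Paren α))
    (hr : IsForest (r ++ r')) : Redu k L R r r' := by
  intro F0 Fm F1 G0 Gm G1 W h1 h2 hF hG hFm hGm a b c d hc he
  obtain ⟨⟨y, hy, hv⟩, y', hy', hv'⟩ := h F0 Fm F1 G0 Gm G1 W h1 h2 hF hG hFm hGm a b c d hc he
  exact replace2 W F0 L Fm R F1 G0 Gm G1 h1 h2 hc hF hG hFm hGm hLR y y' hy hv hy' hv' r r' hr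

theorem spine3 {α : Type*} {k : ℕ} {cs R : List (Sp α)} (hcs : Good cs) (hR : R ≠ [])
    (Us : List (List (Sp α))) (X : List (Sp α)) (hX : cs = X ++ Us.flatten ++ R)
    (hUs : ∀ U ∈ Us, U ≠ [] ∧ ¬ Shiftable k U) (hlen : Us.length = 2 * k + 1) (a : α) :
    Equi k (LL cs) (RR cs) (LL (stub k a)) (RR (stub k a)) := by
  have f1 := spine_forest' cs hcs
  have f2 := spine_forest' _ (stub_good k a)
  refine Equi_of_Redu f1 f2 (Redu_of_cross f1 ?_ _ _ f2) (Redu_of_cross f2 ?_ _ _ f1)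
  · intro F0 Fm F1 G0 Gm G1 W h1 h2 hF hG hFm hGm a b c d hc he
    exact multi_cross hcs hR h1 h2 hF hG hFm hGm a b c d hc he Us X hX hUs hlen
  · intro F0 Fm F1 G0 Gm G1 W h1 h2 hF hG hFm hGm aa b c d hc he
    set C := chn a (10 * k + 1) with hC
    have eL : LL (stub k a) = (true, a) :: C := by simp [stub, LL_cons, ← hC]
    have eR : RR (stub k a) = C ++ [(false, a)] := by simp [stub, RR_cons, ← hC]
    rw [eL, eR] at h1 h2 ⊢
    have X := chn_XGood k a
    rw [← hC] at X
    obtain ⟨y, hy, hv⟩ := X (F0 ++ [(true, a)]) (Fm ++ (C ++ [(false, a)]) ++ F1) (G0 ++ [(true, a)])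
      (Gm ++ (C ++ [(false, a)]) ++ G1) W (by rw [h1]; simp) (by rw [h2]; simp) hF hG hc he
      (by simp; omega) (by simp; omega)
    obtain ⟨y', hy', hv'⟩ := X (F0 ++ (true, a) :: C ++ Fm) ([(false, a)] ++ F1)
      (G0 ++ (true, a) :: C ++ Gm) ([(false, a)] ++ G1) W (by rw [h1]; simp) (by rw [h2]; simp) hF hG
      hc he (by simp; omega) (by simp; omega)
    refine ⟨⟨y + 1, by simp; omega, ?_⟩, ⟨y', by simp; omega, ?_⟩⟩
    · convert hv using 1 <;> simp <;> omega
    · convert hv' using 1 <;> simp <;> omega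

/-- The `n`-th power of a list. -/
def pw {β : Type*} (s : List β) (n : ℕ) : List β := (List.replicate n s).flatten

@[simp] theorem pw_zero {β : Type*} (s : List β) : pw s 0 = [] := rfl
theorem pw_succ {β : Type*} (s : List β) (n : ℕ) : pw s (n + 1) = s ++ pw s n := by
  simp [pw, List.replicate_succ]
theorem pw_add {β : Type*} (s : List β) (m n : ℕ) : pw s (m + n) = pw s m ++ pw s n := by
  induction m with
  | zero => simp
  | succ m ih => rw [show m + 1 + n = (m + n) + 1 by omega, pw_succ, pw_succ, ih]; simp
@[simp] theorem pw_one {β : Type*} (s : List β) : pw s 1 = s := by simp [pw]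
theorem pw_succ' {β : Type*} (s : List β) (n : ℕ) : pw s (n + 1) = pw s n ++ s := by
  rw [pw_add, pw_one]
theorem pw_len {β : Type*} (s : List β) (n : ℕ) : (pw s n).length = n * s.length := by
  simp [pw]
theorem LL_pw {α : Type*} (C : List (Sp α)) (n : ℕ) : LL (pw C n) = pw (LL C) n := by
  induction n with
  | zero => rfl
  | succ n ih => rw [pw_succ, LL_append, ih, pw_succ]
theorem RR_pw {α : Type*} (C : List (Sp α)) (n : ℕ) : RR (pw C n) = pw (RR C) n := by
  induction n with
  | zero => rfl
  | succ n ih => rw [pw_succ, RR_append, ih, pw_succ']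
theorem Good_pw {α : Type*} {C : List (Sp α)} (h : Good C) (n : ℕ) : Good (pw C n) := by
  induction n with
  | zero => simp [Good]
  | succ n ih => rw [pw_succ, Good_append]; exact ⟨h, ih⟩

theorem pw_swap {β : Type*} (s a b : List β) (e r : ℕ) (h : pw s (e + 1) = a ++ s ++ b) :
    a ++ pw s r ++ b = pw s (e + r) := by
  have hcom : a ++ s = s ++ a := by
    have h1 : a ++ s <+: pw s (e + 2) := by
      rw [show e + 2 = e + 1 + 1 by omega, pw_succ', h]
      exact ⟨b ++ s, by simp⟩
    have h2 : s ++ a <+: pw s (e + 2) := by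
      rw [show e + 2 = e + 1 + 1 by omega, pw_succ, h]
      exact ⟨s ++ b, by simp⟩
    have := List.prefix_of_prefix_length_le h1 h2 (by simp; omega)
    exact this.eq_of_length (by simp; omega)
  have hcr : ∀ r, a ++ pw s r = pw s r ++ a := by
    intro r
    induction r with
    | zero => simp
    | succ r ih => rw [pw_succ, ← List.append_assoc, hcom, List.append_assoc, ih]; simp
  have hab : a ++ b = pw s e := by
    rw [pw_succ, hcom, List.append_assoc] at h
    exact (List.append_cancel_left h).symm
  rw [hcr, List.append_assoc, hab, ← pw_add, add_comm]

theorem pigeon2 (c : ℕ → ℕ) (hc : ∀ m n, m ≤ n → c m ≤ c n) (n : ℕ) (hn : ∀ m, c m < n)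
    (l r : ℕ → ℕ) (hl : ∀ i, i < n → l i ≤ l (i + 1)) (hr : ∀ i, i < n → r (i + 1) ≤ r i)
    (hlr : l n ≤ r n) : ∃ i, i < n ∧ c (l i) = c (l (i + 1)) ∧ c (r (i + 1)) = c (r i) := by
  by_contra hcon
  push Not at hcon
  have key : ∀ i, i ≤ n → c (l 0) + c (r i) + i ≤ c (l i) + c (r 0) := by
    intro i
    induction i with
    | zero => intro _; omega
    | succ i ih =>
      intro hi
      have := ih (by omega)
      have a1 := hc _ _ (hl i (by omega))
      have a2 := hc _ _ (hr i (by omega))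
      have := hcon i (by omega)
      by_cases h : c (l i) = c (l (i + 1))
      · have := this h; omega
      · omega
  have := key n le_rfl
  have := hc _ _ hlr
  have := hn (r 0)
  omega

theorem peel {β : Type*} {u v u' v' : List β} (h : u ++ v = u' ++ v') (hl : u'.length ≤ u.length) :
    ∃ c, u = u' ++ c ∧ v' = c ++ v := by
  rcases List.append_eq_append_iff.1 h with ⟨c, e1, e2⟩ | ⟨c, e1, e2⟩
  · have : c = [] := by
      have := congrArg List.length e1; simp at this
      exact List.length_eq_zero_iff.1 (by omega)
    subst this; exact ⟨[], by simpa using e1.symm, by simpa using e2.symm⟩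
  · exact ⟨c, e1, e2⟩

theorem peel5 {β : Type*} {A S B T Z G P M Q Y : List β}
    (h : A ++ S ++ B ++ T ++ Z = G ++ P ++ M ++ Q ++ Y) (h1 : G.length ≤ A.length)
    (h2 : A.length + S.length ≤ G.length + P.length)
    (h3 : G.length + P.length + M.length ≤ A.length + S.length + B.length)
    (h4 : A.length + S.length + B.length + T.length ≤ G.length + P.length + M.length + Q.length) :
    ∃ a b a' b', A = G ++ a ∧ P = a ++ S ++ b ∧ B = b ++ M ++ a' ∧ Q = a' ++ T ++ b' ∧
      Z = b' ++ Y := by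
  obtain ⟨a, rfl, e1⟩ := peel (u := A) (v := S ++ B ++ T ++ Z) (u' := G) (v' := P ++ M ++ Q ++ Y)
    (by simpa using h) h1
  simp only [List.length_append] at h2 h3 h4
  obtain ⟨b, rfl, e2⟩ := peel (u := P) (v := M ++ Q ++ Y) (u' := a ++ S) (v' := B ++ T ++ Z)
    (by simpa using e1) (by simp; omega)
  simp only [List.length_append] at h2 h3 h4
  obtain ⟨a', rfl, e3⟩ := peel (u := B) (v := T ++ Z) (u' := b ++ M) (v' := Q ++ Y)
    (by simpa using e2) (by simp; omega)
  simp only [List.length_append] at h2 h3 h4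
  obtain ⟨b', rfl, e4⟩ := peel (u := Q) (v := Y) (u' := a' ++ T) (v' := Z)
    (by simpa using e3) (by simp; omega)
  exact ⟨a, b, a', b', rfl, rfl, rfl, rfl, e4⟩

theorem inj5 {β : Type*} {A S B T Z G P M Q Y : List β}
    (h : A ++ S ++ B ++ T ++ Z = G ++ P ++ M ++ Q ++ Y) (h1 : G.length = A.length)
    (h2 : S.length = P.length) (h3 : B.length = M.length) (h4 : T.length = Q.length) :
    A = G ∧ S = P ∧ B = M ∧ T = Q ∧ Z = Y := by
  have a := List.append_inj h (by simp; omega)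
  have b := List.append_inj a.1 (by simp; omega)
  have c := List.append_inj b.1 (by simp; omega)
  have d := List.append_inj c.1 (by omega)
  exact ⟨d.1, d.2, c.2, b.2, a.2⟩

/-- Middle part of the target is a forest. -/
theorem mid_forest {α : Type*} {C : List (Sp α)} (hC : C ≠ []) (gC : Good C)
    {W1 W2 W3 : List (Op α)}
    (hc : Cons (W1 ++ ids (LL C) ++ W2 ++ ids (RR C) ++ W3))
    (hG : IsForest (p2 (W1 ++ ids (LL C) ++ W2 ++ ids (RR C) ++ W3)))
    (hm : IsForest (p1 W2)) : IsForest (p2 W2) := by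
  obtain ⟨C', c, rfl⟩ : ∃ C' c, C = C' ++ [c] := by
    rcases list_snoc C with h | h
    · exact absurd h hC
    · exact h
  rw [Good_append, Good_cons] at gC
  obtain ⟨-, ⟨gA, gB⟩, -⟩ := gC
  have eL : LL (C' ++ [c]) = LL C' ++ [(true, c.1)] ++ c.2.1 := by simp [LL_append, LL_cons]
  have eR : RR (C' ++ [c]) = c.2.2 ++ [(false, c.1)] ++ RR C' := by simp [RR_append, RR_cons]
  have idsapp : ∀ u v : List (Paren α), ids (u ++ v) = ids u ++ ids v := by simp [ids]
  set W := W1 ++ ids (LL (C' ++ [c])) ++ W2 ++ ids (RR (C' ++ [c])) ++ W3 with hW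
  have e1 : W = (W1 ++ ids (LL C')) ++ Op.sub (true, c.1) (true, c.1) ::
      (ids c.2.1 ++ W2 ++ ids (RR (C' ++ [c])) ++ W3) := by
    rw [hW, eL, idsapp, idsapp]; simp [ids]
  have e2 : W = (W1 ++ ids (LL (C' ++ [c])) ++ W2 ++ ids c.2.2) ++ Op.sub (false, c.1) (false, c.1) ::
      (ids (RR C') ++ W3) := by
    rw [hW, eR, idsapp, idsapp]; simp [ids]
  have A1 := Al_of_eq (W1 ++ ids (LL C')) (true, c.1) (true, c.1)
    (ids c.2.1 ++ W2 ++ ids (RR (C' ++ [c])) ++ W3)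
  have A2 := Al_of_eq (W1 ++ ids (LL (C' ++ [c])) ++ W2 ++ ids c.2.2) (false, c.1) (false, c.1)
    (ids (RR C') ++ W3)
  rw [← e1] at A1
  rw [← e2] at A2
  -- node of F
  set N := (true, c.1) :: (c.2.1 ++ p1 W2 ++ c.2.2) ++ [(false, c.1)] with hN
  have nN : IsNode N 0 ((c.2.1 ++ p1 W2 ++ c.2.2).length + 1) := by
    refine ⟨by omega, by simp [hN], ⟨c.1, by simp [hN], by
      rw [hN, List.cons_append, List.getElem?_cons_succ, List.getElem?_concat_length]⟩, ?_⟩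
    have : frag N (0 + 1) ((c.2.1 ++ p1 W2 ++ c.2.2).length + 1) = c.2.1 ++ p1 W2 ++ c.2.2 := by
      rw [hN]
      generalize c.2.1 ++ p1 W2 ++ c.2.2 = Z
      simp [frag]
    rw [this]
    exact (gA.append hm).append gB
  have eF : p1 W = (p1 W1 ++ LL C') ++ N ++ (RR C' ++ p1 W3) := by
    rw [hW, eL, eR]; simp [hN]
  have nF := Nd_mid (p1 W1 ++ LL C') N (RR C' ++ p1 W3) _ _ (IsNode_Nd nN)
  rw [← eF] at nF
  obtain ⟨j, hj⟩ := Mt_exists hG _ (Al_lt A1).2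
  have A3 := hc _ _ ((p1 (W1 ++ ids (LL (C' ++ [c])) ++ W2 ++ ids c.2.2)).length) j A1 (Or.inl (by
    convert nF using 1
    · simp
    · simp [eL]; omega)) hj
  have hje := Al_fun A2 A3
  subst hje
  have nG : Nd (p2 W) (p2 (W1 ++ ids (LL C'))).length
      (p2 (W1 ++ ids (LL (C' ++ [c])) ++ W2 ++ ids c.2.2)).length := by
    rcases hj with h | h
    · exact h
    · have := h.1; simp [eL] at this
  have fG := ((IsNode_iff hG _ _).2 nG).2.2.2
  have : frag (p2 W) ((p2 (W1 ++ ids (LL C'))).length + 1)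
      (p2 (W1 ++ ids (LL (C' ++ [c])) ++ W2 ++ ids c.2.2)).length = c.2.1 ++ p2 W2 ++ c.2.2 := by
    have e3 : p2 W = (p2 W1 ++ LL C' ++ [(true, c.1)]) ++ (c.2.1 ++ p2 W2 ++ c.2.2) ++
        ([(false, c.1)] ++ RR C' ++ p2 W3) := by
      rw [hW, eL, eR]; simp
    rw [e3, frag, List.take_left', List.drop_left']
    · simp; omega
    · simp [eL]
  rw [this] at fG
  exact (forest_cancel_mid _ _ _ gA gB).1 fG

set_option maxHeartbeats 2000000 in
/-- Vertical reduction. -/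
theorem vert {α : Type*} {k : ℕ} (hk : 0 < k) {X C Y : List (Sp α)} {e : ℕ} (hC : C ≠ [])
    (gC : Good C) (gY : Good Y) (he : 10 * k ≤ e) (r : ℕ) :
    Redu k (LL (X ++ pw C (e + 1) ++ Y)) (RR (X ++ pw C (e + 1) ++ Y))
      (LL (X ++ pw C (e + r) ++ Y)) (RR (X ++ pw C (e + r) ++ Y)) := by
  intro F0 Fm F1 G0 Gm G1 W hF hG fF fG fm gm w1 w2 w3 w4 hc hed
  simp only [LL_append, RR_append, LL_pw, RR_pw] at hF hG ⊢
  have hl : 0 < (LL C).length := by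
    obtain ⟨c, U', rfl⟩ := List.exists_cons_of_ne_nil hC
    simp [LL_cons]
  have hr := RR_pos hC
  have lF := congrArg List.length hF
  simp only [List.length_append, pw_len] at lF
  obtain ⟨j, hj, c1, c2⟩ := pigeon2 (cum W) (fun m n h => cum_mono W h) (2 * k + 1)
    (fun m => by have := cum_le W m; omega)
    (fun j => F0.length + (LL X).length + (4 * k + j) * (LL C).length)
    (fun j => F0.length + (LL X).length + (e + 1) * (LL C).length + (LL Y).length + Fm.length +
      (RR Y).length + (e + 1 - (4 * k + j)) * (RR C).length)
    (fun i hi => by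
      have : (4 * k + i) * (LL C).length ≤ (4 * k + (i + 1)) * (LL C).length :=
        Nat.mul_le_mul_right _ (by omega)
      omega)
    (fun i hi => by
      have : (e + 1 - (4 * k + (i + 1))) * (RR C).length ≤ (e + 1 - (4 * k + i)) * (RR C).length :=
        Nat.mul_le_mul_right _ (by omega)
      omega)
    (by
      have : (4 * k + (2 * k + 1)) * (LL C).length ≤ (e + 1) * (LL C).length :=
        Nat.mul_le_mul_right _ (by omega)
      omega)
  obtain ⟨j', hj'⟩ : ∃ j', j' = 4 * k + j := ⟨_, rfl⟩
  obtain ⟨m, rfl⟩ : ∃ m, e = j' + m := ⟨e - j', by omega⟩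
  have hm : 4 * k ≤ m := by omega
  rw [← add_assoc (4 * k) j 1, ← hj'] at c1 c2
  rw [show j' + m + 1 - (j' + 1) = m by omega, show j' + m + 1 - j' = m + 1 by omega] at c2
  have q1 : 4 * k ≤ j' * (LL C).length := by nlinarith
  have q2 : 4 * k ≤ m * (LL C).length := by nlinarith
  have q3 : 4 * k ≤ j' * (RR C).length := by nlinarith
  have q4 : 4 * k ≤ m * (RR C).length := by nlinarith
  have x1 : (j' + 1) * (LL C).length = j' * (LL C).length + (LL C).length := by ring
  have x2 : (j' + m + 1) * (LL C).length =
    j' * (LL C).length + m * (LL C).length + (LL C).length := by ring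
  have x3 : (m + 1) * (RR C).length = m * (RR C).length + (RR C).length := by ring
  have x4 : (j' + m + 1) * (RR C).length =
    j' * (RR C).length + m * (RR C).length + (RR C).length := by ring
  rw [x1] at c1
  rw [x2, x3] at c2
  rw [x2, x4] at lF
  obtain ⟨W1, S, W', e1, l1, s1⟩ := cum_clean W _ _ (by omega) (by omega) c1
  obtain ⟨W'', S', W3, e2, l2, s2⟩ := cum_clean W _ _ (by omega) (by omega) c2
  have e3 : (W1 ++ ids S) ++ W' = W'' ++ (ids S' ++ W3) := by rw [← e1, e2]; simp
  obtain ⟨W2, e4, -⟩ : ∃ W2, W'' = W1 ++ ids S ++ W2 ∧ W' = W2 ++ (ids S' ++ W3) := by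
    rcases List.append_eq_append_iff.1 e3 with ⟨c, a, b⟩ | ⟨c, a, b⟩
    · exact ⟨c, a, b⟩
    · have aa := congrArg (fun t => (p1 t).length) a
      simp at aa
      omega
  subst e4
  clear e3 e1 c1 c2
  subst e2
  rw [show j' + m + 1 = m + 1 + j' by omega, pw_add (RR C)] at hF hG
  have hF' : p1 W1 ++ S ++ p1 W2 ++ S' ++ p1 W3 = (F0 ++ LL X ++ pw (LL C) j') ++ LL C ++
      (pw (LL C) m ++ LL Y ++ Fm ++ RR Y ++ pw (RR C) m) ++ RR C ++ (pw (RR C) j' ++ RR X ++ F1) := by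
    simp only [p1_append, p1_ids] at hF
    rw [hF, show m + 1 + j' = j' + (1 + m) by omega, pw_add (LL C), pw_add (LL C) 1 m,
      pw_add (RR C) m 1]
    simp
  simp only [p1_append, p1_ids, List.length_append] at l2
  obtain ⟨f1, f2, f3, f4, f5⟩ := inj5 hF' (by simp [pw_len]; omega) (by omega)
    (by simp [pw_len]; omega) (by omega)
  subst f2 f4
  have hm2 : IsForest (p1 W2) := by
    rw [f3]
    have := spine_forest (pw C m ++ Y) (by rw [Good_append]; exact ⟨Good_pw gC m, gY⟩) Fm fm
    simpa [LL_append, RR_append, LL_pw, RR_pw] using this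
  have hg2 := mid_forest hC gC hc fG hm2
  have v1 := Vx_width (W := W1 ++ ids (LL C) ++ W2 ++ ids (RR C) ++ W3) (x := (p1 W1).length)
    (y := (p2 W1).length) ⟨W1, ids (LL C) ++ W2 ++ ids (RR C) ++ W3, by simp, rfl, rfl⟩
  have v2 := Vx_width (W := W1 ++ ids (LL C) ++ W2 ++ ids (RR C) ++ W3)
    (x := (p1 (W1 ++ ids (LL C) ++ W2)).length)
    (y := (p2 (W1 ++ ids (LL C) ++ W2)).length) ⟨W1 ++ ids (LL C) ++ W2, ids (RR C) ++ W3, by simp, rfl, rfl⟩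
  simp only [p1_append, p2_append, p1_ids, p2_ids, List.length_append] at v2
  have hG' : p2 W1 ++ LL C ++ p2 W2 ++ RR C ++ p2 W3 = (G0 ++ LL X) ++ pw (LL C) (j' + m + 1) ++
      (LL Y ++ Gm ++ RR Y) ++ pw (RR C) (j' + m + 1) ++ (RR X ++ G1) := by
    simp only [p2_append, p2_ids] at hG
    rw [hG, show m + 1 + j' = j' + m + 1 by omega, ← pw_add,
      show m + 1 + j' = j' + m + 1 by omega]
    simp
  obtain ⟨a, b, a', b', g1, g2, g3, g4, g5⟩ := peel5 hG' (by simp; omega)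
    (by simp only [List.length_append, pw_len]; omega)
    (by simp only [List.length_append, pw_len]; omega)
    (by simp only [List.length_append, pw_len]; omega)
  have hids : ∀ u v : List (Paren α), ids u ++ ids v = ids (u ++ v) := by simp [ids]
  have sw : ∀ (cs : List (Sp α)) (V : List (Op α)), Good cs → IsForest (p1 V) → IsForest (p2 V) → 
      IsForest (p1 (ids (LL cs) ++ V ++ ids (RR cs))) ∧ IsForest (p2 (ids (LL cs) ++ V ++ ids (RR cs))) := by
    intro cs V h1 h2 h3
    simp only [p1_append, p2_append, p1_ids, p2_ids]
    exact ⟨spine_forest _ h1 _ h2, spine_forest _ h1 _ h3⟩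
  obtain ⟨z1, z2⟩ := sw C W2 gC hm2 hg2
  obtain ⟨z3, z4⟩ := sw (pw C r) W2 (Good_pw gC r) hm2 hg2
  have ew : W1 ++ ids (LL C) ++ W2 ++ ids (RR C) ++ W3 =
    W1 ++ (ids (LL C) ++ W2 ++ ids (RR C)) ++ W3 := by simp
  rw [ew] at hc fF fG
  have cM := cut_in _ _ _ (cut_in _ _ _ hc)
  have cO := cut_out _ _ _ z1 z2 hc
  have hM : Cons (ids (LL (pw C r)) ++ W2 ++ ids (RR (pw C r))) := by
    have := spine_forest' _ (Good_pw gC r)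
    apply paste _ _ _ hm2 hg2 _ _ _ cM
    · rw [hids, p1_ids]; exact this
    · rw [hids, p2_ids]; exact this
    · rw [hids]; exact Cons_ids _
  refine ⟨W1 ++ (ids (LL (pw C r)) ++ W2 ++ ids (RR (pw C r))) ++ W3, ?_, ?_, ?_, ?_⟩
  · simp only [p1_append, p1_ids, f1, f3, f5, LL_pw, RR_pw]
    rw [show j' + m + r = j' + (r + m) by omega, pw_add (LL C), pw_add (LL C) r m,
      show j' + (r + m) = m + r + j' by omega, pw_add (RR C), pw_add (RR C) m]
    simp
  · simp only [p2_append, p2_ids, g1, g3, g5, LL_pw, RR_pw]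
    rw [← pw_swap _ _ _ _ r g2, ← pw_swap _ _ _ _ r g4]
    simp
  · apply paste _ _ _ z3 z4 _ _ cO hM
    · rw [p1_append, p1_append] at fF
      rw [p1_append]; exact (forest_cancel _ _ _ z1).1 fF
    · rw [p2_append, p2_append] at fG
      rw [p2_append]; exact (forest_cancel _ _ _ z2).1 fG
  · intro w hw hq
    simp only [cost_append, cost_ids w hw]
    simp

theorem vert_equi {α : Type*} {k : ℕ} (hk : 0 < k) {X C Y : List (Sp α)} {e : ℕ} (hC : C ≠ [])
    (hg : Good (X ++ pw C (e + 1) ++ Y)) (he : 10 * k + 1 ≤ e) :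
    Equi k (LL (X ++ pw C (e + 1) ++ Y)) (RR (X ++ pw C (e + 1) ++ Y))
      (LL (X ++ pw C e ++ Y)) (RR (X ++ pw C e ++ Y)) := by
  have hg' := hg
  rw [Good_append, Good_append] at hg
  obtain ⟨⟨gX, gp⟩, gY⟩ := hg
  have gC : Good C := by rw [pw_succ, Good_append] at gp; exact gp.1
  have gE : Good (X ++ pw C e ++ Y) := by
    rw [Good_append, Good_append]; exact ⟨⟨gX, Good_pw gC e⟩, gY⟩
  obtain ⟨e', rfl⟩ : ∃ e', e = e' + 1 := ⟨e - 1, by omega⟩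
  exact Equi_of_Redu (spine_forest' _ hg') (spine_forest' _ gE)
    (vert hk hC gC gY (by omega) 0) (vert hk hC gC gY (by omega) 2)

/-- Number of red characters of `T` in positions `[a, b)`. -/
noncomputable def redIn {α : Type*} (k : ℕ) (T : List (Paren α)) (a b : ℕ) : ℕ :=
  ((Finset.Ico a b).filter fun i => ¬ IsBlack k T i).card

theorem redIn_le {α : Type*} (k : ℕ) (T : List (Paren α)) (a b : ℕ) : redIn k T a b ≤ b - a := by
  unfold redIn
  refine (Finset.card_filter_le _ _).trans ?_
  simp

theorem redIn_add {α : Type*} (k : ℕ) (T : List (Paren α)) {a b c : ℕ} (h1 : a ≤ b) (h2 : b ≤ c) :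
    redIn k T a c = redIn k T a b + redIn k T b c := by
  unfold redIn
  rw [← Finset.Ico_union_Ico_eq_Ico h1 h2, Finset.filter_union, Finset.card_union_of_disjoint]
  exact Finset.disjoint_filter_filter (Finset.Ico_disjoint_Ico_consecutive a b c)

theorem redCount_eq {α : Type*} (k : ℕ) (T : List (Paren α)) :
    redCount k T = redIn k T 0 T.length := by
  unfold redCount redIn
  rw [Finset.range_eq_Ico]

theorem zone_rich {α : Type*} {k : ℕ} (hk : 0 < k) (u D v : List (Paren α)) (hD : IsForest D)
    (h : 84 * k ^ 2 + 50 * k < redIn k (u ++ D ++ v) u.length (u.length + D.length)) :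
    XGood k D := by
  set Q := (Finset.Ico u.length (u.length + D.length)).filter
    fun i => ¬ IsBlack k (u ++ D ++ v) i with hQ
  have hcard : (Q.image (fun i => i - u.length)).card = Q.card := by
    apply Finset.card_image_of_injOn
    intro x hx y hy hxy
    simp [hQ] at hx hy hxy
    omega
  apply red_rich k hk D hD (Q.image (fun i => i - u.length)) _ (by rw [hcard]; exact h)
  intro ρ hρ
  simp only [Finset.mem_image, hQ, Finset.mem_filter, Finset.mem_Ico] at hρ
  obtain ⟨i, ⟨⟨h1, h2⟩, h3⟩, rfl⟩ := hρ
  refine ⟨by omega, fun h4 h5 hb => h3 ?_⟩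
  refine ⟨i - 21 * k, i + 21 * k, by simp; omega, by omega, by omega, ?_⟩
  convert hb using 1
  apply List.ext_getElem?
  intro n
  by_cases hn : n < 42 * k
  · rw [frag_get _ _ _ _ (by omega), frag_get _ _ _ _ (by omega),
      show i - 21 * k + n = u.length + (i - u.length - 21 * k + n) by omega,
      get_mid _ _ _ _ (by omega)]
  · rw [List.getElem?_eq_none, List.getElem?_eq_none] <;> simp [frag] <;> omega

def len {α : Type*} (cs : List (Sp α)) : ℕ := (LL cs).length + (RR cs).length

/-- Length-minimal spine in its equivalence class. -/
def Minl {α : Type*} (k : ℕ) (cs : List (Sp α)) : Prop :=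
  Good cs ∧ ∀ cs', cs' ≠ [] → Good cs' → Equi k (LL cs) (RR cs) (LL cs') (RR cs') → len cs ≤ len cs'

theorem zoneL {α : Type*} {k : ℕ} (hk : 0 < k) (X Y : List (Sp α)) (c : Sp α)
    (hm : Minl k (X ++ [c] ++ Y)) :
    redIn k (LL (X ++ [c] ++ Y)) ((LL X).length + 1) ((LL X).length + 1 + c.2.1.length)
      ≤ 84 * k ^ 2 + 50 * k := by
  by_contra hcon
  push Not at hcon
  have e : ∀ D, LL (X ++ [(c.1, D, c.2.2)] ++ Y) = (LL X ++ [(true, c.1)]) ++ D ++ LL Y := by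
    intro D; simp [LL_append, LL_cons]
  have eR : ∀ D, RR (X ++ [(c.1, D, c.2.2)] ++ Y) = RR (X ++ [c] ++ Y) := by
    intro D; simp [RR_append, RR_cons]
  have hle := redIn_le k (LL (X ++ [c] ++ Y)) ((LL X).length + 1) ((LL X).length + 1 + c.2.1.length)
  have e0 : LL (X ++ [c] ++ Y) = _ := e c.2.1
  have hg := hm.1
  rw [Good_append, Good_append, Good_cons] at hg
  obtain ⟨⟨gX, ⟨g1, g2⟩, -⟩, gY⟩ := hg
  have hX : XGood k c.2.1 := by
    apply zone_rich hk (LL X ++ [(true, c.1)]) c.2.1 (LL Y) g1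
    rw [← e0]; simpa using hcon
  have fc := chn_forest c.1 (10 * k + 1)
  have g' : Good (X ++ [(c.1, chn c.1 (10 * k + 1), c.2.2)] ++ Y) := by
    rw [Good_append, Good_append, Good_cons]
    exact ⟨⟨gX, ⟨fc, g2⟩, by simp [Good]⟩, gY⟩
  have := hm.2 (X ++ [(c.1, chn c.1 (10 * k + 1), c.2.2)] ++ Y) (by simp) g' (by
    apply Equi_of_Redu (spine_forest' _ hm.1) (spine_forest' _ g')
    · rw [eR (chn c.1 (10 * k + 1)), e (chn c.1 (10 * k + 1))]
      have := swapL k (LL X ++ [(true, c.1)]) c.2.1 (LL Y) (RR (X ++ [c] ++ Y)) _ hX g1 fc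
      rw [← e0] at this; exact this
    · rw [eR (chn c.1 (10 * k + 1)), e (chn c.1 (10 * k + 1))]
      have := swapL k (LL X ++ [(true, c.1)]) _ (LL Y) (RR (X ++ [c] ++ Y)) _
        (chn_XGood k c.1) fc g1
      rw [← e0] at this; exact this)
  simp [len, LL_append, LL_cons, RR_append, RR_cons, chn_len] at this
  have : k ≤ k ^ 2 := Nat.le_self_pow (by omega) k
  omega

theorem zoneR {α : Type*} {k : ℕ} (hk : 0 < k) (X Y : List (Sp α)) (c : Sp α)
    (hm : Minl k (X ++ [c] ++ Y)) :
    redIn k (RR (X ++ [c] ++ Y)) ((RR Y).length) ((RR Y).length + c.2.2.length)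
      ≤ 84 * k ^ 2 + 50 * k := by
  by_contra hcon
  push Not at hcon
  have e : ∀ D, RR (X ++ [(c.1, c.2.1, D)] ++ Y) = RR Y ++ D ++ ([(false, c.1)] ++ RR X) := by
    intro D; simp [RR_append, RR_cons]
  have eR : ∀ D, LL (X ++ [(c.1, c.2.1, D)] ++ Y) = LL (X ++ [c] ++ Y) := by
    intro D; simp [LL_append, LL_cons]
  have hle := redIn_le k (RR (X ++ [c] ++ Y)) ((RR Y).length) ((RR Y).length + c.2.2.length)
  have e0 : RR (X ++ [c] ++ Y) = _ := e c.2.2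
  have hg := hm.1
  rw [Good_append, Good_append, Good_cons] at hg
  obtain ⟨⟨gX, ⟨g1, g2⟩, -⟩, gY⟩ := hg
  have hX : XGood k c.2.2 := by
    apply zone_rich hk (RR Y) c.2.2 ([(false, c.1)] ++ RR X) g2
    rw [← e0]; simpa using hcon
  have fc := chn_forest c.1 (10 * k + 1)
  have g' : Good (X ++ [(c.1, c.2.1, chn c.1 (10 * k + 1))] ++ Y) := by
    rw [Good_append, Good_append, Good_cons]
    exact ⟨⟨gX, ⟨g1, fc⟩, by simp [Good]⟩, gY⟩
  have := hm.2 (X ++ [(c.1, c.2.1, chn c.1 (10 * k + 1))] ++ Y) (by simp) g' (by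
    apply Equi_of_Redu (spine_forest' _ hm.1) (spine_forest' _ g')
    · rw [eR (chn c.1 (10 * k + 1)), e (chn c.1 (10 * k + 1))]
      have := swapR k (RR Y) c.2.2 ([(false, c.1)] ++ RR X) (LL (X ++ [c] ++ Y)) _ hX g2 fc
      rw [← e0] at this; exact this
    · rw [eR (chn c.1 (10 * k + 1)), e (chn c.1 (10 * k + 1))]
      have := swapR k (RR Y) _ ([(false, c.1)] ++ RR X) (LL (X ++ [c] ++ Y)) _
        (chn_XGood k c.1) fc g2
      rw [← e0] at this; exact this)
  simp [len, LL_append, LL_cons, RR_append, RR_cons, chn_len] at this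
  have : k ≤ k ^ 2 := Nat.le_self_pow (by omega) k
  omega

theorem per_prefix {β : Type*} (U : List β) (h n : ℕ) (hh : h ≤ U.length)
    (hp : ∀ i, i + h < U.length → U[i]? = U[i + h]?) :
    pw (U.take h) n <+: U ∨ U <+: pw (U.take h) n := by
  have h1 : U <+: U.take h ++ U := by
    nth_rewrite 1 [← List.take_append_drop h U]
    rw [List.prefix_append_right_inj]
    have : U.drop h = U.take (U.length - h) := by
      apply List.ext_getElem?
      intro i
      rw [List.getElem?_drop, List.getElem?_take]
      split_ifs with hi
      · rw [add_comm h i]; exact (hp i (by omega)).symm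
      · rw [List.getElem?_eq_none]; omega
    rw [this]
    exact List.take_prefix _ _
  have h2 : ∀ n, U <+: pw (U.take h) n ++ U := by
    intro n
    induction n with
    | zero => simp
    | succ n ih =>
      rw [pw_succ, List.append_assoc]
      exact h1.trans ((List.prefix_append_right_inj _).2 ih)
  exact List.prefix_or_prefix_of_prefix (List.prefix_append _ _) (h2 n)

theorem shift_bound {α : Type*} {k : ℕ} (hk : 0 < k) (X U Y : List (Sp α))
    (hm : Minl k (X ++ U ++ Y)) (hU : U = [] ∨ Shiftable k U) :
    len U ≤ 80 * k ^ 2 + 16 * k := by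
  rcases hU with rfl | ⟨h, h1, h2, hp, b1, b2⟩
  · simp [len]
  rcases per_prefix U h (10 * k + 2) h2 hp with ⟨t, ht⟩ | ⟨t, ht⟩
  · exfalso
    set C := U.take h with hC
    have hC0 : C ≠ [] := by
      intro h0
      have h00 : C.length = h := by rw [hC, List.length_take]; omega
      rw [h0, List.length_nil] at h00; omega
    have ecs : X ++ U ++ Y = X ++ pw C (10 * k + 1 + 1) ++ (t ++ Y) := by
      rw [← ht]; simp
    have hg := hm.1
    rw [ecs] at hg
    have he := vert_equi (k := k) hk hC0 hg (by omega)
    have g' : Good (X ++ pw C (10 * k + 1) ++ (t ++ Y)) := by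
      rw [Good_append, Good_append] at hg ⊢
      refine ⟨⟨hg.1.1, ?_⟩, hg.2⟩
      have := hg.1.2
      rw [pw_succ, Good_append] at this; exact this.2
    have := hm.2 (X ++ pw C (10 * k + 1) ++ (t ++ Y)) (by rw [pw_succ]; simp [hC0]) g'
      (by rw [ecs]; exact he)
    rw [ecs] at this
    have := RR_pos hC0
    rw [pw_succ C (10 * k + 1)] at *
    simp only [len, LL_append, RR_append, List.length_append] at *
    omega
  · have e1 := congrArg (fun x => (LL x).length) ht
    have e2 := congrArg (fun x => (RR x).length) ht
    simp only [LL_append, RR_append, LL_pw, RR_pw, pw_len, List.length_append] at e1 e2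
    have e3 : (10 * k + 2) * (LL (U.take h)).length ≤ (10 * k + 2) * (4 * k) :=
      Nat.mul_le_mul_left _ b1
    have e4 : (10 * k + 2) * (RR (U.take h)).length ≤ (10 * k + 2) * (4 * k) :=
      Nat.mul_le_mul_left _ b2
    have e5 : (10 * k + 2) * (4 * k) = 40 * k ^ 2 + 8 * k := by ring
    unfold len
    omega

theorem first_unit {α : Type*} (k : ℕ) (V : List (Sp α)) : (V = [] ∨ Shiftable k V) ∨
    ∃ U' c V', V = U' ++ [c] ++ V' ∧ (U' = [] ∨ Shiftable k U') ∧ ¬ Shiftable k (U' ++ [c]) := by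
  induction V using List.reverseRecOn with
  | nil => exact Or.inl (Or.inl rfl)
  | append_singleton t c ih =>
    rcases ih with h | ⟨U', c', V', rfl, h2, h3⟩
    · by_cases hs : Shiftable k (t ++ [c])
      · exact Or.inl (Or.inr hs)
      · exact Or.inr ⟨t, c, [], by simp, h, hs⟩
    · exact Or.inr ⟨U', c', V' ++ [c], by simp, h2, h3⟩

theorem count_main {α : Type*} {k : ℕ} (hk : 0 < k) (cs : List (Sp α)) (hm : Minl k cs) (n : ℕ) :
    ∀ X V, cs = X ++ V →
    (¬ ∃ (Us : List (List (Sp α))) (R : List (Sp α)), V = Us.flatten ++ R ∧ R ≠ [] ∧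
      (∀ U ∈ Us, U ≠ [] ∧ ¬ Shiftable k U) ∧ Us.length = n) →
    redIn k (LL cs) (LL X).length (LL cs).length + redIn k (RR cs) 0 (RR V).length
      ≤ n * (248 * k ^ 2 + 116 * k + 2) := by
  induction n with
  | zero =>
    intro X V hcs hno
    have : V = [] := by
      by_contra h
      exact hno ⟨[], V, by simp, h, by simp, rfl⟩
    subst this
    have h1 := redIn_le k (LL cs) (LL X).length (LL cs).length
    have h2 := redIn_le k (RR cs) 0 0
    subst hcs
    simp at h1 h2 ⊢
    exact ⟨h1, h2⟩
  | succ n ih =>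
    intro X V hcs hno
    have ex : (n + 1) * (248 * k ^ 2 + 116 * k + 2) =
      n * (248 * k ^ 2 + 116 * k + 2) + (248 * k ^ 2 + 116 * k + 2) := by ring
    rw [ex]
    rcases first_unit k V with h | ⟨U', c, V', rfl, h2, h3⟩
    · have hb := shift_bound hk X V [] (by simpa [hcs] using hm) h
      have h1 := redIn_le k (LL cs) (LL X).length (LL cs).length
      have h2 := redIn_le k (RR cs) 0 (RR V).length
      have : (LL cs).length = (LL X).length + (LL V).length := by rw [hcs, LL_append]; simp
      unfold len at hb
      omega
    · have hI := ih (X ++ U' ++ [c]) V' (by rw [hcs]; simp) (by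
        rintro ⟨Us, R, rfl, hR, hUs, hl⟩
        refine hno ⟨(U' ++ [c]) :: Us, R, by simp, hR, ?_, by simp [hl]⟩
        intro U hU
        rcases List.mem_cons.1 hU with rfl | hU
        · exact ⟨by simp, h3⟩
        · exact hUs U hU)
      have hb := shift_bound hk X U' ([c] ++ V') (by rw [hcs] at hm; simpa using hm) h2
      have ecs : cs = (X ++ U') ++ [c] ++ V' := by rw [hcs]; simp
      have zL := zoneL hk (X ++ U') V' c (by rw [← ecs]; exact hm)
      have zR := zoneR hk (X ++ U') V' c (by rw [← ecs]; exact hm)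
      rw [← ecs] at zL zR
      have l1 : (LL (X ++ U' ++ [c])).length = (LL X).length + (LL U').length + 1 + c.2.1.length := by
        simp [LL_append, LL_cons]; omega
      have l2 : (LL cs).length = (LL (X ++ U' ++ [c])).length + (LL V').length := by
        rw [ecs, LL_append]; simp
      have l3 : (RR (U' ++ [c] ++ V')).length =
          (RR V').length + c.2.2.length + 1 + (RR U').length := by
        simp [RR_append, RR_cons]; omega
      have l4 : (LL (X ++ U')).length = (LL X).length + (LL U').length := by simp [LL_append]
      rw [l4] at zL
      rw [l1] at hI l2
      rw [l3]
      rw [redIn_add k (LL cs) (a := (LL X).length) (b := (LL X).length + (LL U').length) (by omega)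
        (by omega),
        redIn_add k (LL cs) (a := (LL X).length + (LL U').length)
          (b := (LL X).length + (LL U').length + 1) (by omega) (by omega),
        redIn_add k (LL cs) (a := (LL X).length + (LL U').length + 1)
          (b := (LL X).length + (LL U').length + 1 + c.2.1.length) (by omega) (by omega),
        redIn_add k (RR cs) (a := 0) (b := (RR V').length) (by omega) (by omega),
        redIn_add k (RR cs) (a := (RR V').length) (b := (RR V').length + c.2.2.length)
          (by omega) (by omega)]
      have r1 := redIn_le k (LL cs) (LL X).length ((LL X).length + (LL U').length)
      have r2 := redIn_le k (LL cs) ((LL X).length + (LL U').length)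
        ((LL X).length + (LL U').length + 1)
      have r3 := redIn_le k (RR cs) ((RR V').length + c.2.2.length)
        ((RR V').length + c.2.2.length + 1 + (RR U').length)
      unfold len at hb
      omega

/-- Lemma 5.11: for every context `P = ⟨PL; PR⟩` and threshold
`k ∈ ℤ₊`, there exists a context `P' = ⟨PL'; PR'⟩` with `|P'| ≤ |P|` and at most
`1152k³` red characters such that `P` and `P'` are `ted^w_{≤k}`-equivalent for
every normalized quasimetric weight function `w`. -/
theorem context_reduction {α : Type*} (k : ℕ) (hk : 0 < k)
    (PL PR : List (Paren α)) (hP : IsContext PL PR) :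
    ∃ PL' PR' : List (Paren α), IsContext PL' PR' ∧
      PL'.length + PR'.length ≤ PL.length + PR.length ∧
      redCount k PL' + redCount k PR' ≤ 1152 * k ^ 3 ∧
      ∀ w : Option α → Option α → ℝ≥0, Normalized w → Quasimetric w →
        ContextEquiv k w PL PR PL' PR' := by
  obtain ⟨cs0, hn0, hg0, rfl, rfl⟩ := spine_of_context hP
  have hex : ∃ m, ∃ cs, cs ≠ [] ∧ Good cs ∧ Equi k (LL cs0) (RR cs0) (LL cs) (RR cs) ∧ len cs = m :=
    ⟨_, cs0, hn0, hg0, Equi_refl _ _ _, rfl⟩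
  obtain ⟨cs, hn, hg, hE, hl⟩ := Nat.find_spec hex
  have hmin : Minl k cs := by
    refine ⟨hg, fun cs' hn' hg' hE' => ?_⟩
    rw [hl]
    exact Nat.find_min' hex ⟨cs', hn', hg',
      Equi_trans (spine_forest' _ hg0) (spine_forest' _ hg) hE hE', rfl⟩
  have hle : len cs ≤ len cs0 := by
    rw [hl]
    exact Nat.find_min' hex ⟨cs0, hn0, hg0, Equi_refl _ _ _, rfl⟩
  refine ⟨LL cs, RR cs, context_of_spine cs hg hn, hle, ?_, hE⟩
  rw [redCount_eq, redCount_eq]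
  have k1 : k ≤ k ^ 3 := Nat.le_self_pow (by omega) k
  have k2 : k ^ 2 ≤ k ^ 3 := Nat.pow_le_pow_right hk (by omega)
  by_cases hno : ∃ (Us : List (List (Sp α))) (R : List (Sp α)), cs = Us.flatten ++ R ∧ R ≠ [] ∧
      (∀ U ∈ Us, U ≠ [] ∧ ¬ Shiftable k U) ∧ Us.length = 2 * k + 1
  · obtain ⟨Us, R, e, hR, hUs, hlen⟩ := hno
    obtain ⟨c, -, -⟩ := List.exists_cons_of_ne_nil hn
    have := hmin.2 (stub k c.1) (by simp [stub]) (stub_good k c.1)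
      (spine3 hg hR Us [] (by simpa using e) hUs hlen c.1)
    have e2 := stub_len k c.1
    unfold len at this
    have r1 := redIn_le k (LL cs) 0 (LL cs).length
    have r2 := redIn_le k (RR cs) 0 (RR cs).length
    omega
  · have := count_main hk cs hmin (2 * k + 1) [] cs rfl hno
    simp only [LL_nil, List.length_nil] at this
    have e3 : (2 * k + 1) * (248 * k ^ 2 + 116 * k + 2) =
      496 * k ^ 3 + 480 * k ^ 2 + 120 * k + 2 := by ring
    omega
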